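/- The set of extreme points of the closed unit ball of J(ℝ²) (with the total variation norm) equals { μ_γ/ℓ(γ) : γ ∈ Γ }, where Γ is the set of Lipschitz maps γ : [0,1] → ℝ² that are injective on [0,1) and satisfy γ(0) = γ(1), and ℓ(γ) := ∫₀¹ |γ′(t)| dt. -/

import Mathlib

open MeasureTheory Filter
open scoped ENNReal NNReal RealInnerProductSpace

noncomputable section

abbrev Ed (d : ℕ) : Type := EuclideanSpace ℝ (Fin d)

/-- A (Lipschitz) curve is a Lipschitz map `ℝ → ℝ^d`. -/
def IsLip {d : ℕ} (γ : ℝ → Ed d) : Prop := ∃ K : ℝ≥0, LipschitzWith K γ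

/-- `(σ, τ)` is the polar decomposition of a finite vector measure `μ = τσ`, `‖τ‖ = 1` σ-a.e. -/
def IsPolarVM (σ : Measure (Ed 2)) (τ : Ed 2 → Ed 2) : Prop :=
  IsFiniteMeasure σ ∧ Measurable τ ∧ ∀ᵐ x ∂σ, ‖τ x‖ = 1

/-- The vector measure `τσ` is divergence-free in the sense of distributions. -/
def DivFree (σ : Measure (Ed 2)) (τ : Ed 2 → Ed 2) : Prop :=
  ∀ φ : Ed 2 → ℝ, ContDiff ℝ (⊤ : ℕ∞) φ → HasCompactSupport φ →
    ∫ x, fderiv ℝ φ x (τ x) ∂σ = 0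

/-- The pairing `⟨μ, Φ⟩` of the vector measure `μ = τσ` with a test vector field. -/
def Jpair (σ : Measure (Ed 2)) (τ : Ed 2 → Ed 2) (Φ : Ed 2 → Ed 2) : ℝ :=
  ∫ x, ⟪Φ x, τ x⟫ ∂σ

/-- Membership in the closed unit ball of `J(ℝ²)` (divergence-free measures with total
variation at most one). -/
def memJball (σ : Measure (Ed 2)) (τ : Ed 2 → Ed 2) : Prop :=
  IsPolarVM σ τ ∧ DivFree σ τ ∧ σ Set.univ ≤ 1

/-- `τσ` is an extreme point of the closed unit ball of `J(ℝ²)` (measures being identified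
when all their pairings with test vector fields agree). -/
def IsExtremeJ (σ : Measure (Ed 2)) (τ : Ed 2 → Ed 2) : Prop :=
  memJball σ τ ∧
    ∀ (σ₁ : Measure (Ed 2)) (τ₁ : Ed 2 → Ed 2) (σ₂ : Measure (Ed 2)) (τ₂ : Ed 2 → Ed 2),
      memJball σ₁ τ₁ → memJball σ₂ τ₂ → ∀ t : ℝ, t ∈ Set.Ioo (0:ℝ) 1 →
      (∀ Φ : Ed 2 → Ed 2, Continuous Φ → HasCompactSupport Φ →
        Jpair σ τ Φ = (1 - t) * Jpair σ₁ τ₁ Φ + t * Jpair σ₂ τ₂ Φ) →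
      ∀ Φ : Ed 2 → Ed 2, Continuous Φ → HasCompactSupport Φ →
        Jpair σ₁ τ₁ Φ = Jpair σ τ Φ ∧ Jpair σ₂ τ₂ Φ = Jpair σ τ Φ

theorem Ultrafilter.exists_tendsto_of_bounded {ι X : Type*} [PseudoMetricSpace X] [ProperSpace X]
    (𝒰 : Ultrafilter ι) {f : ι → X} {x₀ : X} {C : ℝ} (h : ∀ᶠ a in 𝒰, dist (f a) x₀ ≤ C) :
    ∃ x, Tendsto f 𝒰 (nhds x) := by
  have h2 : (𝒰.map f : Filter X) ≤ Filter.principal (Metric.closedBall x₀ C) := by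
    exact Filter.le_principal_iff.mpr h
  obtain ⟨x, _, hx⟩ := (isCompact_closedBall x₀ C).ultrafilter_le_nhds (𝒰.map f) h2
  exact ⟨x, hx⟩

open scoped CompactlySupported in
theorem exists_measure_of_ultralimit {ι X : Type*} [TopologicalSpace X] [T2Space X]
    [LocallyCompactSpace X] [SigmaCompactSpace X] [MeasurableSpace X] [BorelSpace X]
    (𝒰 : Ultrafilter ι) (m : ι → Measure X) [∀ a, IsFiniteMeasure (m a)] {θ : ℝ}
    (hθ : Tendsto (fun a => (m a).real Set.univ) 𝒰 (nhds θ)) :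
    ∃ ν : Measure X, ν Set.univ ≤ ENNReal.ofReal θ ∧
      ∀ f : C_c(X, ℝ), Tendsto (fun a => ∫ x, f x ∂m a) 𝒰 (nhds (∫ x, f x ∂ν)) := by
  have hint : ∀ a (f : C_c(X, ℝ)), Integrable f (m a) := fun a f =>
    f.continuous.integrable_of_hasCompactSupport f.hasCompactSupport
  have hlim : ∀ f : C_c(X, ℝ), ∃ l, Tendsto (fun a => ∫ x, f x ∂m a) 𝒰 (nhds l) := by
    intro f
    obtain ⟨C, hC⟩ := f.hasCompactSupport.exists_bound_of_continuous f.continuous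
    apply Ultrafilter.exists_tendsto_of_bounded 𝒰 (x₀ := 0) (C := max C 0 * (θ + 1))
    filter_upwards [hθ.eventually (ge_mem_nhds (lt_add_one θ))] with a ha
    rw [dist_zero_right]
    calc ‖∫ x, f x ∂m a‖ ≤ max C 0 * (m a).real Set.univ :=
          norm_integral_le_of_norm_le_const (ae_of_all _ fun x => (hC x).trans (le_max_left _ _))
      _ ≤ _ := by gcongr
  choose L hL using hlim
  let Λ₀ : C_c(X, ℝ) →ₗ[ℝ] ℝ :=
    { toFun := L
      map_add' := fun f g => by
        refine tendsto_nhds_unique (hL _) (((hL f).add (hL g)).congr fun a => ?_)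
        rw [← integral_add (hint a f) (hint a g)]; rfl
      map_smul' := fun c f => by
        refine tendsto_nhds_unique (hL _) (((hL f).const_mul c).congr fun a => ?_)
        rw [← integral_const_mul]; rfl }
  let Λ : C_c(X, ℝ) →ₚ[ℝ] ℝ := PositiveLinearMap.mk₀ Λ₀ fun f hf =>
    ge_of_tendsto' (hL f) fun a => integral_nonneg fun x => hf x
  refine ⟨RealRMK.rieszMeasure Λ, ?_, fun f => ?_⟩
  · have hK : ∀ K : Set X, IsCompact K → RealRMK.rieszMeasure Λ K ≤ ENNReal.ofReal θ := by
      intro K hK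
      obtain ⟨f, hf1, -, hf2, hf3⟩ := exists_continuous_one_zero_of_isCompact hK isClosed_empty
        (Set.disjoint_empty K)
      refine (RealRMK.rieszMeasure_le_of_eq_one Λ (f := ⟨f, hf2⟩) (fun x => (hf3 x).1) hK hf1).trans
        (ENNReal.ofReal_le_ofReal ?_)
      refine le_of_tendsto_of_tendsto' (hL _) hθ fun a => ?_
      calc ∫ x, f x ∂m a ≤ ∫ x, (1 : ℝ) ∂m a :=
            integral_mono (hint a ⟨f, hf2⟩) (integrable_const _) fun x => (hf3 x).2
        _ = _ := by simp
    rw [← iUnion_compactCovering X, (directed_of_isDirected_le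
      (compactCovering_subset X)).measure_iUnion]
    exact iSup_le fun n => hK _ (isCompact_compactCovering X n)
  · rw [RealRMK.integral_rieszMeasure]
    exact hL f

/-- A bounded compactly supported field, equal to the identity on the unit ball. -/
def truncId (y : Ed 2) : Ed 2 := (max 0 (min 1 (2 - ‖y‖))) • y

theorem continuous_truncId : Continuous truncId := by
  unfold truncId; fun_prop

theorem truncId_of_norm_le {y : Ed 2} (hy : ‖y‖ ≤ 1) : truncId y = y := by
  unfold truncId
  rw [min_eq_left (by linarith), max_eq_right zero_le_one, one_smul]

theorem hasCompactSupport_truncId : HasCompactSupport truncId := by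
  refine HasCompactSupport.intro (isCompact_closedBall (0 : Ed 2) 2) fun y hy => ?_
  have : 2 < ‖y‖ := by simpa using hy
  unfold truncId
  rw [max_eq_left ((min_le_right _ _).trans (by linarith)), zero_smul]

theorem norm_truncId_le (y : Ed 2) : ‖truncId y‖ ≤ 1 := by
  unfold truncId
  rw [norm_smul, Real.norm_of_nonneg (le_max_left _ _)]
  rcases le_total ‖y‖ 1 with h | h
  · rw [min_eq_left (by linarith), max_eq_right zero_le_one]; linarith
  · rw [min_eq_right (by linarith)]
    rcases le_total ‖y‖ 2 with h2 | h2
    · rw [max_eq_right (by linarith)]; nlinarith [sq_nonneg (‖y‖ - 1)]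
    · rw [max_eq_left (by linarith)]; simp

/-- The first moment in the second variable of a finite measure on `E × E` is a polar vector
measure. -/
theorem exists_polar_of_measure (m : Measure (Ed 2 × Ed 2)) [IsFiniteMeasure m] :
    ∃ (σ : Measure (Ed 2)) (τ : Ed 2 → Ed 2), IsPolarVM σ τ ∧ σ Set.univ ≤ m Set.univ ∧
      ∀ Φ : Ed 2 → Ed 2, Continuous Φ → HasCompactSupport Φ →
        ∫ z, ⟪Φ z.1, truncId z.2⟫ ∂m = Jpair σ τ Φ := by
  set f : Ed 2 → Ed 2 := fun x => ∫ y, truncId y ∂(m.condKernel x) with hf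
  have hfm : StronglyMeasurable f :=
    StronglyMeasurable.integral_kernel (f := fun y => truncId y) (κ := m.condKernel)
      continuous_truncId.stronglyMeasurable
  have hf1 : ∀ x, ‖f x‖ ≤ 1 := fun x => by
    have := norm_integral_le_of_norm_le_const (μ := m.condKernel x)
      (ae_of_all _ norm_truncId_le)
    simpa using this
  set σ := m.fst.withDensity (fun x => ENNReal.ofReal ‖f x‖) with hσ
  have hdm : Measurable fun x => ENNReal.ofReal ‖f x‖ := hfm.measurable.norm.ennreal_ofReal
  have hσle : σ Set.univ ≤ m Set.univ := by
    rw [hσ, withDensity_apply _ MeasurableSet.univ, Measure.restrict_univ]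
    calc ∫⁻ x, ENNReal.ofReal ‖f x‖ ∂m.fst ≤ ∫⁻ x, 1 ∂m.fst :=
          lintegral_mono fun x => by simpa using ENNReal.ofReal_le_ofReal (hf1 x)
      _ = _ := by rw [lintegral_one, Measure.fst_univ]
  refine ⟨σ, fun x => ‖f x‖⁻¹ • f x, ⟨⟨hσle.trans_lt (measure_lt_top _ _)⟩, ?_, ?_⟩, hσle, ?_⟩
  · exact hfm.measurable.norm.inv.smul hfm.measurable
  · rw [hσ, ae_withDensity_iff hdm]
    refine ae_of_all _ fun x hx => ?_
    have : 0 < ‖f x‖ := by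
      by_contra h
      exact hx (ENNReal.ofReal_of_nonpos (not_lt.mp h))
    rw [norm_smul, norm_inv, norm_norm, inv_mul_cancel₀ this.ne']
  · intro Φ hΦ hΦc
    obtain ⟨C, hC⟩ := hΦc.exists_bound_of_continuous hΦ
    have hint : Integrable (fun z : Ed 2 × Ed 2 => ⟪Φ z.1, truncId z.2⟫) m := by
      refine Integrable.of_bound (C := C) (Continuous.aestronglyMeasurable ?_) (ae_of_all _ ?_)
      · exact (hΦ.comp continuous_fst).inner (continuous_truncId.comp continuous_snd)
      · intro z
        calc ‖⟪Φ z.1, truncId z.2⟫‖ ≤ ‖Φ z.1‖ * ‖truncId z.2‖ := norm_inner_le_norm _ _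
          _ ≤ C * 1 := by
            gcongr
            · exact (norm_nonneg _).trans (hC 0)
            · exact hC _
            · exact norm_truncId_le _
          _ = C := mul_one C
    rw [← Measure.integral_condKernel hint, Jpair, hσ,
      integral_withDensity_eq_integral_toReal_smul hdm (ae_of_all _ fun _ => ENNReal.ofReal_lt_top)]
    refine integral_congr_ae (ae_of_all _ fun x => ?_)
    have hi : Integrable truncId (m.condKernel x) :=
      Integrable.of_bound (C := 1) continuous_truncId.aestronglyMeasurable
        (ae_of_all _ norm_truncId_le)
    have h1 : ∫ y, ⟪Φ x, truncId y⟫ ∂(m.condKernel x) = ⟪Φ x, f x⟫ := integral_inner hi (Φ x)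
    simp only [h1, ENNReal.toReal_ofReal (norm_nonneg _), smul_eq_mul, inner_smul_right]
    by_cases h0 : f x = 0
    · simp [h0]
    · rw [← mul_assoc, mul_inv_cancel₀ (norm_ne_zero_iff.mpr h0), one_mul]

open scoped CompactlySupported in
theorem exists_polar_of_ultralimit {ι : Type*} (𝒰 : Ultrafilter ι)
    (m : ι → Measure (Ed 2 × Ed 2)) [∀ a, IsFiniteMeasure (m a)] {θ : ℝ}
    (hθ : Tendsto (fun a => (m a).real Set.univ) 𝒰 (nhds θ)) :
    ∃ (σ : Measure (Ed 2)) (τ : Ed 2 → Ed 2), IsPolarVM σ τ ∧ σ Set.univ ≤ ENNReal.ofReal θ ∧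
      ∀ Φ : Ed 2 → Ed 2, Continuous Φ → HasCompactSupport Φ →
        Tendsto (fun a => ∫ z, ⟪Φ z.1, truncId z.2⟫ ∂m a) 𝒰 (nhds (Jpair σ τ Φ)) := by
  obtain ⟨ν, hν, hlim⟩ := exists_measure_of_ultralimit 𝒰 m hθ
  have : IsFiniteMeasure ν := ⟨hν.trans_lt ENNReal.ofReal_lt_top⟩
  obtain ⟨σ, τ, h1, h2, h3⟩ := exists_polar_of_measure ν
  refine ⟨σ, τ, h1, h2.trans hν, fun Φ hΦ hΦc => ?_⟩
  rw [← h3 Φ hΦ hΦc]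
  have hcs : HasCompactSupport (fun z : Ed 2 × Ed 2 => (⟪Φ z.1, truncId z.2⟫ : ℝ)) := by
    refine HasCompactSupport.intro (hΦc.isCompact.prod hasCompactSupport_truncId.isCompact) ?_
    intro z hz
    rw [Set.mem_prod, not_and_or] at hz
    rcases hz with hz | hz
    · simp [image_eq_zero_of_notMem_tsupport hz]
    · simp [image_eq_zero_of_notMem_tsupport hz]
  exact hlim ⟨⟨fun z => ⟪Φ z.1, truncId z.2⟫,
    (hΦ.comp continuous_fst).inner (continuous_truncId.comp continuous_snd)⟩, hcs⟩

section JpairBasics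

variable {σ : Measure (Ed 2)} {τ : Ed 2 → Ed 2}

lemma IsPolarVM.integrable_inner (h : IsPolarVM σ τ) {Φ : Ed 2 → Ed 2} (hΦ : Measurable Φ)
    {C : ℝ} (hC : ∀ x, ‖Φ x‖ ≤ C) : Integrable (fun x => ⟪Φ x, τ x⟫) σ := by
  obtain ⟨hf, hm, h1⟩ := h
  refine Integrable.of_bound (C := C) (hΦ.inner hm).aestronglyMeasurable ?_
  filter_upwards [h1] with x hx
  calc ‖⟪Φ x, τ x⟫‖ ≤ ‖Φ x‖ * ‖τ x‖ := norm_inner_le_norm _ _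
    _ ≤ C := by rw [hx, mul_one]; exact hC x

lemma IsPolarVM.abs_Jpair_le (h : IsPolarVM σ τ) {Φ : Ed 2 → Ed 2}
    {C : ℝ} (hC : ∀ x, ‖Φ x‖ ≤ C) : |Jpair σ τ Φ| ≤ C * σ.real Set.univ := by
  obtain ⟨hf, hm, h1⟩ := h
  rw [← Real.norm_eq_abs]
  refine norm_integral_le_of_norm_le_const ?_
  filter_upwards [h1] with x hx
  calc ‖⟪Φ x, τ x⟫‖ ≤ ‖Φ x‖ * ‖τ x‖ := norm_inner_le_norm _ _
    _ ≤ C := by rw [hx, mul_one]; exact hC x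

lemma exists_norm_le_of_hasCompactSupport {Φ : Ed 2 → Ed 2} (hΦ : Continuous Φ)
    (hc : HasCompactSupport Φ) : ∃ C : ℝ, 0 < C ∧ ∀ x, ‖Φ x‖ ≤ C := by
  obtain ⟨C, hC⟩ := hc.exists_bound_of_continuous hΦ
  exact ⟨max C 1, by positivity, fun x => (hC x).trans (le_max_left _ _)⟩

lemma IsPolarVM.integrable_pair (h : IsPolarVM σ τ) {Φ : Ed 2 → Ed 2} (hΦ : Continuous Φ)
    (hc : HasCompactSupport Φ) : Integrable (fun x => ⟪Φ x, τ x⟫) σ := by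
  obtain ⟨C, -, hC⟩ := exists_norm_le_of_hasCompactSupport hΦ hc
  exact h.integrable_inner hΦ.measurable hC

lemma Jpair_smul (c : ℝ) (Φ : Ed 2 → Ed 2) : Jpair σ τ (c • Φ) = c * Jpair σ τ Φ := by
  simp only [Jpair, Pi.smul_apply, inner_smul_left, conj_trivial, integral_const_mul]

lemma IsPolarVM.Jpair_sub (h : IsPolarVM σ τ) {Φ Ψ : Ed 2 → Ed 2} (hΦ : Continuous Φ)
    (hc : HasCompactSupport Φ) (hΨ : Continuous Ψ) (hc' : HasCompactSupport Ψ) :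
    Jpair σ τ (Φ - Ψ) = Jpair σ τ Φ - Jpair σ τ Ψ := by
  simp only [Jpair, Pi.sub_apply, inner_sub_left]
  exact integral_sub (h.integrable_pair hΦ hc) (h.integrable_pair hΨ hc')

lemma Jpair_ofReal_smul {c : ℝ} (hc : 0 ≤ c) (Φ : Ed 2 → Ed 2) :
    Jpair (ENNReal.ofReal c • σ) τ Φ = c * Jpair σ τ Φ := by
  rw [Jpair, integral_smul_measure, ENNReal.toReal_ofReal hc, smul_eq_mul, Jpair]

lemma IsPolarVM.ofReal_smul (h : IsPolarVM σ τ) (c : ℝ) :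
    IsPolarVM (ENNReal.ofReal c • σ) τ := by
  obtain ⟨hf, hm, h1⟩ := h
  refine ⟨?_, hm, Measure.ae_smul_measure h1 _⟩
  exact σ.smul_finite ENNReal.ofReal_ne_top

lemma DivFree.ofReal_smul (h : DivFree σ τ) (c : ℝ) : DivFree (ENNReal.ofReal c • σ) τ := by
  intro φ hφ hc
  rw [integral_smul_measure, h φ hφ hc, smul_zero]

lemma Jpair_gradient (φ : Ed 2 → ℝ) :
    Jpair σ τ (gradient φ) = ∫ x, fderiv ℝ φ x (τ x) ∂σ := by
  simp only [Jpair, inner_gradient_left]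

lemma continuous_gradient {φ : Ed 2 → ℝ} (h : ContDiff ℝ 1 φ) : Continuous (gradient φ) := by
  have := h.continuous_fderiv (by simp)
  exact (InnerProductSpace.toDual ℝ (Ed 2)).symm.continuous.comp this

lemma hasCompactSupport_gradient {φ : Ed 2 → ℝ} (h : HasCompactSupport φ) :
    HasCompactSupport (gradient φ) :=
  (h.fderiv (𝕜 := ℝ)).comp_left (g := (InnerProductSpace.toDual ℝ (Ed 2)).symm) (map_zero _)

lemma divFree_iff : DivFree σ τ ↔ ∀ φ : Ed 2 → ℝ, ContDiff ℝ (⊤ : ℕ∞) φ →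
    HasCompactSupport φ → Jpair σ τ (gradient φ) = 0 := by
  simp only [DivFree, Jpair_gradient]

lemma isPolarVM_zero (hτ : Measurable τ) : IsPolarVM 0 τ :=
  ⟨inferInstance, hτ, by simp⟩

/-- Measurable fields bounded by one are `L¹`-limits of test fields bounded by one. -/
lemma exists_test_integral_norm_sub_le (ν : Measure (Ed 2)) [IsFiniteMeasure ν]
    {f : Ed 2 → Ed 2} (hf : Measurable f) (h1 : ∀ x, ‖f x‖ ≤ 1) {ε : ℝ} (hε : 0 < ε) :
    ∃ Φ : Ed 2 → Ed 2, Continuous Φ ∧ HasCompactSupport Φ ∧ (∀ x, ‖Φ x‖ ≤ 1) ∧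
      ∫ x, ‖Φ x - f x‖ ∂ν ≤ ε := by
  have hi : Integrable f ν := Integrable.of_bound (C := 1) hf.aestronglyMeasurable
    (Eventually.of_forall h1)
  obtain ⟨g, hgc, hg, hgcont, hgi⟩ := hi.exists_hasCompactSupport_integral_sub_le
    (half_pos hε)
  have hpos : ∀ x, 0 < max 1 ‖g x‖ := fun x => lt_of_lt_of_le one_pos (le_max_left _ _)
  have hcont : Continuous fun x => (max 1 ‖g x‖)⁻¹ • g x :=
    ((continuous_const.max hgcont.norm).inv₀ fun x => (hpos x).ne').smul hgcont
  have hle : ∀ x, ‖(max 1 ‖g x‖)⁻¹ • g x‖ ≤ 1 := fun x => by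
    rw [norm_smul, norm_inv, Real.norm_of_nonneg (hpos x).le, inv_mul_le_iff₀ (hpos x), mul_one]
    exact le_max_right _ _
  refine ⟨fun x => (max 1 ‖g x‖)⁻¹ • g x, hcont, ?_, hle, ?_⟩
  · exact hgc.mono fun x hx hx' => hx (by simp [hx'])
  · have key : ∀ x, ‖(max 1 ‖g x‖)⁻¹ • g x - f x‖ ≤ 2 * ‖f x - g x‖ := by
      intro x
      have h2 : ‖(max 1 ‖g x‖)⁻¹ • g x - g x‖ ≤ ‖f x - g x‖ := by
        have e : (max 1 ‖g x‖)⁻¹ • g x - g x = ((max 1 ‖g x‖)⁻¹ - 1) • g x := by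
          rw [sub_smul, one_smul]
        rcases le_total ‖g x‖ 1 with h | h
        · rw [max_eq_left h]; simp
        · rw [e, max_eq_right h, norm_smul, Real.norm_eq_abs, abs_of_nonpos
            (by rw [sub_nonpos]; exact inv_le_one_of_one_le₀ h)]
          have : 0 < ‖g x‖ := by linarith
          have e2 : -(‖g x‖⁻¹ - 1) * ‖g x‖ = ‖g x‖ - 1 := by field_simp; ring
          rw [e2]
          have := norm_sub_norm_le (g x) (f x)
          rw [norm_sub_rev] at this
          linarith [h1 x]
      calc _ = ‖((max 1 ‖g x‖)⁻¹ • g x - g x) + (g x - f x)‖ := by congr 1; abel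
        _ ≤ _ := by
          refine (norm_add_le _ _).trans ?_
          rw [norm_sub_rev (g x) (f x)]; linarith
    calc _ ≤ ∫ x, 2 * ‖f x - g x‖ ∂ν := by
            refine integral_mono_of_nonneg (Eventually.of_forall fun _ => norm_nonneg _)
              ((hi.sub hgi).norm.const_mul 2) (Eventually.of_forall key)
      _ ≤ ε := by rw [integral_const_mul]; linarith

/-- The total variation of `τσ` is `σ`. -/
lemma IsPolarVM.exists_lt_Jpair (h : IsPolarVM σ τ) {c : ℝ} (hc : c < σ.real Set.univ) :
    ∃ Φ : Ed 2 → Ed 2, Continuous Φ ∧ HasCompactSupport Φ ∧ (∀ x, ‖Φ x‖ ≤ 1) ∧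
      c < Jpair σ τ Φ := by
  obtain ⟨hf, hm, h1⟩ := h
  have hm' : Measurable fun x => if ‖τ x‖ ≤ 1 then τ x else 0 :=
    Measurable.ite (measurableSet_le hm.norm measurable_const) hm measurable_const
  obtain ⟨Φ, hΦ, hΦc, hΦ1, hΦ2⟩ := exists_test_integral_norm_sub_le σ hm'
    (fun x => by split_ifs with h <;> simp [h]) (ε := (σ.real Set.univ - c) / 2) (by linarith)
  refine ⟨Φ, hΦ, hΦc, hΦ1, ?_⟩
  have hP : IsPolarVM σ τ := ⟨hf, hm, h1⟩
  have hint := hP.integrable_pair hΦ hΦc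
  have hint2 : Integrable (fun x => ‖Φ x - if ‖τ x‖ ≤ 1 then τ x else 0‖) σ := by
    refine Integrable.of_bound (C := 2) (hΦ.measurable.sub hm').norm.aestronglyMeasurable
      (Eventually.of_forall fun x => ?_)
    rw [norm_norm]
    refine (norm_sub_le _ _).trans ?_
    have : ‖if ‖τ x‖ ≤ 1 then τ x else 0‖ ≤ 1 := by split_ifs with h <;> simp [h]
    linarith [hΦ1 x]
  have : ∫ x, (1 - ‖Φ x - if ‖τ x‖ ≤ 1 then τ x else 0‖) ∂σ ≤ Jpair σ τ Φ := by
    refine integral_mono_ae ((integrable_const _).sub hint2) hint ?_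
    filter_upwards [h1] with x hx
    simp only [hx, le_refl, if_true]
    have e1 : ⟪Φ x, τ x⟫ = ⟪τ x, τ x⟫ + ⟪Φ x - τ x, τ x⟫ := by rw [← inner_add_left]; simp
    have e2 := abs_real_inner_le_norm (Φ x - τ x) (τ x)
    rw [e1, real_inner_self_eq_norm_sq, hx]
    rw [hx] at e2
    linarith [(abs_le.1 e2).1]
  rw [integral_sub (integrable_const _) hint2] at this
  simp at this
  linarith

lemma IsPolarVM.real_univ_le (h : IsPolarVM σ τ) {c : ℝ}
    (hc : ∀ Φ : Ed 2 → Ed 2, Continuous Φ → HasCompactSupport Φ → (∀ x, ‖Φ x‖ ≤ 1) →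
      Jpair σ τ Φ ≤ c) : σ.real Set.univ ≤ c := by
  by_contra! hlt
  obtain ⟨Φ, h1, h2, h3, h4⟩ := h.exists_lt_Jpair hlt
  exact absurd (hc Φ h1 h2 h3) (not_le.2 h4)

/-- Complementary divergence-free parts of an extreme point are proportional to it. -/
lemma IsExtremeJ.eq_mul_of_add_eq (h : IsExtremeJ σ τ) {θ : ℝ} (h0 : 0 ≤ θ) (hθ1 : θ ≤ 1)
    {σ₁ σ₂ : Measure (Ed 2)} {τ₁ τ₂ : Ed 2 → Ed 2}
    (p₁ : IsPolarVM σ₁ τ₁) (p₂ : IsPolarVM σ₂ τ₂) (d₁ : DivFree σ₁ τ₁) (d₂ : DivFree σ₂ τ₂)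
    (m₁ : σ₁ Set.univ ≤ ENNReal.ofReal θ) (m₂ : σ₂ Set.univ ≤ ENNReal.ofReal (1 - θ))
    (hadd : ∀ Φ : Ed 2 → Ed 2, Continuous Φ → HasCompactSupport Φ →
      Jpair σ₁ τ₁ Φ + Jpair σ₂ τ₂ Φ = Jpair σ τ Φ)
    {Φ : Ed 2 → Ed 2} (hΦ : Continuous Φ) (hc : HasCompactSupport Φ) :
    Jpair σ₁ τ₁ Φ = θ * Jpair σ τ Φ := by
  rcases h0.eq_or_lt with rfl | h0
  · have : σ₁ = 0 := by simpa using m₁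
    simp [this, Jpair]
  rcases hθ1.eq_or_lt with rfl | hθ1
  · have : σ₂ = 0 := by simpa using m₂
    rw [← hadd Φ hΦ hc, this]; simp [Jpair]
  have key : ∀ {ν : Measure (Ed 2)} {c : ℝ}, 0 < c → ν Set.univ ≤ ENNReal.ofReal c →
      (ENNReal.ofReal c⁻¹ • ν) Set.univ ≤ 1 := by
    intro ν c hc hν
    rw [Measure.smul_apply, smul_eq_mul]
    calc _ ≤ ENNReal.ofReal c⁻¹ * ENNReal.ofReal c := by gcongr
      _ = 1 := by
        rw [← ENNReal.ofReal_mul (inv_nonneg.2 hc.le), inv_mul_cancel₀ hc.ne', ENNReal.ofReal_one]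
  have h2 : 0 < 1 - θ := by linarith
  have := (h.2 (ENNReal.ofReal θ⁻¹ • σ₁) τ₁ (ENNReal.ofReal (1 - θ)⁻¹ • σ₂) τ₂
    ⟨p₁.ofReal_smul _, d₁.ofReal_smul _, key h0 m₁⟩
    ⟨p₂.ofReal_smul _, d₂.ofReal_smul _, key h2 m₂⟩ (1 - θ) ⟨h2, by linarith⟩ (by
      intro Ψ hΨ hΨc
      rw [Jpair_ofReal_smul (inv_nonneg.2 h0.le), Jpair_ofReal_smul (inv_nonneg.2 h2.le),
        ← hadd Ψ hΨ hΨc]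
      field_simp; ring) Φ hΦ hc).1
  rw [Jpair_ofReal_smul (inv_nonneg.2 h0.le)] at this
  rw [← this]; field_simp

end JpairBasics

section CurveCurrents

variable {γ : ℝ → Ed 2} {K : ℝ≥0}

lemma LipschitzWith.exists_lipschitzOnWith_comp (hγ : LipschitzWith K γ) {φ : Ed 2 → ℝ}
    (hφ : ContDiff ℝ 1 φ) (a b : ℝ) : ∃ C : ℝ≥0, LipschitzOnWith C (φ ∘ γ) (Set.uIcc a b) :=
  (hφ.locallyLipschitz.comp hγ.locallyLipschitz).locallyLipschitzOn
    |>.exists_lipschitzOnWith_of_compact isCompact_uIcc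

lemma LipschitzWith.ae_deriv_comp (hγ : LipschitzWith K γ) {φ : Ed 2 → ℝ}
    (hφ : ContDiff ℝ 1 φ) :
    ∀ᵐ t, HasDerivAt (φ ∘ γ) (fderiv ℝ φ (γ t) (deriv γ t)) t := by
  filter_upwards [hγ.ae_differentiableAt_real] with t ht
  exact ((hφ.differentiable (by simp)) (γ t)).hasFDerivAt.comp_hasDerivAt t ht.hasDerivAt

/-- The fundamental theorem of calculus along a Lipschitz curve. -/
lemma LipschitzWith.integral_fderiv_deriv (hγ : LipschitzWith K γ) {φ : Ed 2 → ℝ}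
    (hφ : ContDiff ℝ 1 φ) (a b : ℝ) :
    ∫ t in a..b, fderiv ℝ φ (γ t) (deriv γ t) = φ (γ b) - φ (γ a) := by
  obtain ⟨C, hC⟩ := hγ.exists_lipschitzOnWith_comp hφ a b
  have := hC.absolutelyContinuousOnInterval.integral_deriv_eq_sub
  rw [Function.comp_apply, Function.comp_apply] at this
  rw [← this]
  refine intervalIntegral.integral_congr_ae ?_
  filter_upwards [hγ.ae_deriv_comp hφ] with t ht _
  exact ht.deriv.symm

lemma LipschitzWith.norm_deriv_le (hγ : LipschitzWith K γ) (t : ℝ) : ‖deriv γ t‖ ≤ K :=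
  norm_deriv_le_of_lipschitz hγ

lemma LipschitzWith.intervalIntegrable_inner_deriv (hγ : LipschitzWith K γ) {Φ : Ed 2 → Ed 2}
    (hΦ : Continuous Φ) (a b : ℝ) :
    IntervalIntegrable (fun t => ⟪Φ (γ t), deriv γ t⟫) volume a b := by
  obtain ⟨C, hC⟩ := (isCompact_uIcc (a := a) (b := b)).exists_bound_of_continuousOn
    (hΦ.comp hγ.continuous).continuousOn
  refine (intervalIntegrable_const (c := C * K)).mono_fun
    (((hΦ.comp hγ.continuous).measurable.inner (measurable_deriv γ)).aestronglyMeasurable) ?_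
  filter_upwards [ae_restrict_mem measurableSet_uIoc] with t ht
  have h0 := hC t (Set.uIoc_subset_uIcc ht)
  calc ‖⟪Φ (γ t), deriv γ t⟫‖ ≤ ‖Φ (γ t)‖ * ‖deriv γ t‖ := norm_inner_le_norm _ _
    _ ≤ C * K := mul_le_mul h0 (hγ.norm_deriv_le t) (norm_nonneg _) ((norm_nonneg _).trans h0)
    _ ≤ ‖C * K‖ := le_abs_self _

/-- The vector measure induced by an arc of a Lipschitz curve. -/
lemma LipschitzWith.exists_polar (hγ : LipschitzWith K γ) {a b : ℝ} (hab : a ≤ b) :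
    ∃ (σ : Measure (Ed 2)) (τ : Ed 2 → Ed 2), IsPolarVM σ τ ∧
      σ Set.univ ≤ ENNReal.ofReal (K * (b - a)) ∧
      ∀ Φ : Ed 2 → Ed 2, Continuous Φ → HasCompactSupport Φ →
        Jpair σ τ Φ = ∫ t in a..b, ⟪Φ (γ t), deriv γ t⟫ := by
  have hmeas : Measurable fun t => (γ t, (K : ℝ)⁻¹ • deriv γ t) := by
    have h1 := measurable_deriv γ
    have h2 := hγ.continuous.measurable
    fun_prop
  have hfin : IsFiniteMeasure (ENNReal.ofReal K • (volume.restrict (Set.Ioc a b)) : Measure ℝ) :=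
    Measure.smul_finite _ ENNReal.ofReal_ne_top
  obtain ⟨σ, τ, h1, h2, h3⟩ := exists_polar_of_measure
    ((ENNReal.ofReal K • (volume.restrict (Set.Ioc a b)) : Measure ℝ).map
      fun t => (γ t, (K : ℝ)⁻¹ • deriv γ t))
  refine ⟨σ, τ, h1, h2.trans (le_of_eq ?_), fun Φ hΦ hΦc => ?_⟩
  · rw [Measure.map_apply hmeas MeasurableSet.univ]
    simp only [Set.preimage_univ, Measure.smul_apply, Measure.restrict_apply_univ,
      Real.volume_Ioc, smul_eq_mul, ENNReal.ofReal_mul K.coe_nonneg]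
  · have hcont : Continuous fun z : Ed 2 × Ed 2 => ⟪Φ z.1, truncId z.2⟫ :=
      (hΦ.comp continuous_fst).inner (continuous_truncId.comp continuous_snd)
    rw [← h3 Φ hΦ hΦc, integral_map hmeas.aemeasurable hcont.aestronglyMeasurable,
      integral_smul_measure, ENNReal.toReal_ofReal K.coe_nonneg, intervalIntegral.integral_of_le hab,
      ← integral_smul]
    refine integral_congr_ae (Eventually.of_forall fun t => ?_)
    have hle := hγ.norm_deriv_le t
    rcases eq_or_ne (K : ℝ) 0 with h0 | h0
    · rw [h0, norm_le_zero_iff] at hle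
      simp [h0, hle]
    · have : ‖(K : ℝ)⁻¹ • deriv γ t‖ ≤ 1 := by
        rw [norm_smul, norm_inv, Real.norm_of_nonneg K.coe_nonneg,
          inv_mul_le_iff₀ (by positivity), mul_one]
        exact hle
      simp only [truncId_of_norm_le this, inner_smul_right, smul_eq_mul]
      field_simp

lemma LipschitzWith.exists_polar_divFree (hγ : LipschitzWith K γ) {a b : ℝ} (hab : a ≤ b)
    (h : γ a = γ b) :
    ∃ (σ : Measure (Ed 2)) (τ : Ed 2 → Ed 2), IsPolarVM σ τ ∧ DivFree σ τ ∧
      σ Set.univ ≤ ENNReal.ofReal (K * (b - a)) ∧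
      ∀ Φ : Ed 2 → Ed 2, Continuous Φ → HasCompactSupport Φ →
        Jpair σ τ Φ = ∫ t in a..b, ⟪Φ (γ t), deriv γ t⟫ := by
  obtain ⟨σ, τ, h1, h2, h3⟩ := hγ.exists_polar hab
  refine ⟨σ, τ, h1, divFree_iff.2 fun φ hφ hφc => ?_, h2, h3⟩
  have hφ1 : ContDiff ℝ 1 φ := hφ.of_le (by exact_mod_cast le_top)
  rw [h3 _ (continuous_gradient hφ1) (hasCompactSupport_gradient hφc)]
  simp only [inner_gradient_left]
  rw [hγ.integral_fderiv_deriv hφ1, h, sub_self]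

end CurveCurrents

/-- The clockwise rotation by a right angle. -/
def perp (v : Ed 2) : Ed 2 := !₂[v 1, -v 0]

@[simp] lemma perp_apply_zero (v : Ed 2) : perp v 0 = v 1 := rfl

@[simp] lemma perp_apply_one (v : Ed 2) : perp v 1 = -v 0 := rfl

lemma inner_eq_two (v w : Ed 2) : ⟪v, w⟫ = v 0 * w 0 + v 1 * w 1 := by
  simp [PiLp.inner_apply, Fin.sum_univ_two, mul_comm]

lemma norm_sq_eq_two (v : Ed 2) : ‖v‖ ^ 2 = v 0 ^ 2 + v 1 ^ 2 := by
  rw [← real_inner_self_eq_norm_sq, inner_eq_two]; ring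

@[simp] lemma norm_perp (v : Ed 2) : ‖perp v‖ = ‖v‖ := by
  have : ‖perp v‖ ^ 2 = ‖v‖ ^ 2 := by rw [norm_sq_eq_two, norm_sq_eq_two]; simp; ring
  exact (sq_eq_sq₀ (norm_nonneg _) (norm_nonneg _)).1 this

@[simp] lemma inner_perp_self (v : Ed 2) : ⟪perp v, v⟫ = 0 := by
  rw [inner_eq_two]; simp; ring

lemma continuous_perp : Continuous perp := by
  unfold perp; fun_prop

/-- There is a closed Lipschitz curve inducing a nonzero vector measure. -/
lemma exists_closed_curve_integral_pos : ∃ (K : ℝ≥0) (γ : ℝ → Ed 2) (Φ : Ed 2 → Ed 2) (b : ℝ),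
    LipschitzWith K γ ∧ 0 ≤ b ∧ γ 0 = γ b ∧ Continuous Φ ∧ HasCompactSupport Φ ∧
      ∫ t in (0:ℝ)..b, ⟪Φ (γ t), deriv γ t⟫ ≠ 0 := by
  set e : Ed 2 := !₂[1, 0] with he
  set γ : ℝ → Ed 2 := fun t => Real.cos t • e - Real.sin t • perp e with hγ
  have hd : ∀ t, HasDerivAt γ ((-Real.sin t) • e - Real.cos t • perp e) t := fun t =>
    ((Real.hasDerivAt_cos t).smul_const e).sub ((Real.hasDerivAt_sin t).smul_const (perp e))
  have hn : ∀ c s : ℝ, ‖c • e - s • perp e‖ ^ 2 = c ^ 2 + s ^ 2 := fun c s => by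
    rw [norm_sq_eq_two]; simp [he]
  have hn1 : ∀ t, ‖γ t‖ = 1 := fun t => by
    rw [← abs_norm, ← abs_one, ← sq_eq_sq_iff_abs_eq_abs, hγ, hn]; simp
  have hder : ∀ t, deriv γ t = - perp (γ t) := fun t => by
    rw [(hd t).deriv]; ext i; fin_cases i <;> simp [hγ, he]
  refine ⟨1, γ, fun x => -(max 0 (2 - ‖x‖) • perp x), 2 * Real.pi, ?_, by positivity, ?_, ?_, ?_, ?_⟩
  · refine lipschitzWith_of_nnnorm_deriv_le (fun t => (hd t).differentiableAt) fun t => ?_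
    rw [← NNReal.coe_le_coe, coe_nnnorm, hder, norm_neg, norm_perp, hn1]; simp
  · simp [hγ]
  · exact ((continuous_const.max (continuous_const.sub continuous_norm)).smul continuous_perp).neg
  · refine HasCompactSupport.of_support_subset_isCompact (isCompact_closedBall (0 : Ed 2) 2) ?_
    intro x hx
    rw [mem_closedBall_zero_iff]
    by_contra! h
    exact hx (by simp [max_eq_left (by linarith : 2 - ‖x‖ ≤ 0)])
  · have : ∀ t, ⟪-(max 0 (2 - ‖γ t‖) • perp (γ t)), deriv γ t⟫ = (1 : ℝ) := fun t => by
      rw [hder, hn1, inner_neg_neg, real_inner_smul_left, real_inner_self_eq_norm_sq, norm_perp,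
        hn1]
      norm_num
    simp only [this]
    simp [Real.pi_ne_zero]

section ExtremeMass

variable {σ : Measure (Ed 2)} {τ : Ed 2 → Ed 2}

lemma IsExtremeJ.exists_Jpair_ne_zero (h : IsExtremeJ σ τ) :
    ∃ Φ : Ed 2 → Ed 2, Continuous Φ ∧ HasCompactSupport Φ ∧ Jpair σ τ Φ ≠ 0 := by
  by_contra! h0
  obtain ⟨K, γ, Φ, b, hγ, hb, hcl, hΦ, hΦc, hne⟩ := exists_closed_curve_integral_pos
  obtain ⟨σ₁, τ₁, p, d, m, hp⟩ := hγ.exists_polar_divFree hb hcl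
  set c : ℝ := (K * (b - 0) + 1)⁻¹ with hc
  have hpos : 0 < K * (b - 0) + 1 := by have := K.coe_nonneg; positivity
  have hcpos : 0 < c := inv_pos.2 hpos
  have hball : memJball (ENNReal.ofReal c • σ₁) τ₁ := by
    refine ⟨p.ofReal_smul _, d.ofReal_smul _, ?_⟩
    rw [Measure.smul_apply, smul_eq_mul]
    calc _ ≤ ENNReal.ofReal c * ENNReal.ofReal (K * (b - 0)) := by gcongr
      _ = ENNReal.ofReal (c * (K * (b - 0))) := (ENNReal.ofReal_mul hcpos.le).symm
      _ ≤ 1 := by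
        rw [ENNReal.ofReal_le_one, hc, inv_mul_le_iff₀ hpos]; linarith
  have hneg : memJball (ENNReal.ofReal c • σ₁) (fun x => -τ₁ x) := by
    obtain ⟨⟨q1, q2, q3⟩, q4, q5⟩ := hball
    refine ⟨⟨q1, q2.neg, by simpa using q3⟩, fun φ hφ hφc => ?_, q5⟩
    simp only [map_neg, integral_neg, q4 φ hφ hφc, neg_zero]
  have hJneg : ∀ Ψ, Jpair (ENNReal.ofReal c • σ₁) (fun x => -τ₁ x) Ψ =
      -Jpair (ENNReal.ofReal c • σ₁) τ₁ Ψ := fun Ψ => by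
    simp only [Jpair, inner_neg_right, integral_neg]
  have := (h.2 _ _ _ _ hball hneg (1 / 2) ⟨by norm_num, by norm_num⟩ (fun Ψ hΨ hΨc => by
    rw [h0 Ψ hΨ hΨc, hJneg]; ring) Φ hΦ hΦc).1
  rw [h0 Φ hΦ hΦc, Jpair_ofReal_smul hcpos.le, hp Φ hΦ hΦc] at this
  exact (mul_ne_zero hcpos.ne' hne) this

lemma IsExtremeJ.real_univ (h : IsExtremeJ σ τ) : σ.real Set.univ = 1 := by
  obtain ⟨Φ, hΦ, hΦc, hne⟩ := h.exists_Jpair_ne_zero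
  obtain ⟨p, d, m⟩ := h.1
  have hf := p.1
  have hle : σ.real Set.univ ≤ 1 := by
    rw [measureReal_def]
    exact ENNReal.toReal_le_of_le_ofReal zero_le_one (by simpa using m)
  have := h.eq_mul_of_add_eq measureReal_nonneg hle p
    (isPolarVM_zero (τ := τ) p.2.1) d (fun φ _ _ => by simp) (by simp)
    (by simp) (fun Ψ _ _ => by simp [Jpair]) hΦ hΦc
  have h2 : (σ.real Set.univ - 1) * Jpair σ τ Φ = 0 := by linarith
  rcases mul_eq_zero.1 h2 with h3 | h3
  · linarith
  · exact absurd h3 hne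

end ExtremeMass

section SoftCut

/-- A smooth function vanishing on `[-r, r]`, with derivative in `[0, 1]`, equal to one outside
`[-2r, 2r]`. -/
def softCut (r s : ℝ) : ℝ := ∫ x in (0:ℝ)..s, Real.smoothTransition ((x / r) ^ 2 - 1)

lemma continuous_softCut_integrand (r : ℝ) :
    Continuous fun x : ℝ => Real.smoothTransition ((x / r) ^ 2 - 1) :=
  Real.smoothTransition.continuous.comp (by fun_prop)

lemma hasDerivAt_softCut (r s : ℝ) :
    HasDerivAt (softCut r) (Real.smoothTransition ((s / r) ^ 2 - 1)) s :=
  intervalIntegral.integral_hasDerivAt_right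
    ((continuous_softCut_integrand r).intervalIntegrable _ _)
    ((continuous_softCut_integrand r).stronglyMeasurableAtFilter _ _)
    (continuous_softCut_integrand r).continuousAt

lemma deriv_softCut (r : ℝ) :
    deriv (softCut r) = fun s => Real.smoothTransition ((s / r) ^ 2 - 1) :=
  funext fun s => (hasDerivAt_softCut r s).deriv

lemma contDiff_softCut (r : ℝ) : ContDiff ℝ (⊤ : ℕ∞) (softCut r) := by
  rw [contDiff_infty_iff_deriv, deriv_softCut]
  refine ⟨fun s => (hasDerivAt_softCut r s).differentiableAt, ?_⟩
  exact Real.smoothTransition.contDiff.comp (by fun_prop)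

lemma softCut_eq_zero {r s : ℝ} (h : |s| ≤ r) : softCut r s = 0 := by
  rw [softCut, intervalIntegral.integral_congr (g := fun _ => 0), intervalIntegral.integral_zero]
  intro x hx
  refine Real.smoothTransition.zero_of_nonpos ?_
  have hx' : |x| ≤ r := by
    refine le_trans ?_ h
    rcases Set.mem_uIcc.1 hx with ⟨h1, h2⟩ | ⟨h1, h2⟩
    · rw [abs_of_nonneg h1]; exact h2.trans (le_abs_self _)
    · rw [abs_of_nonpos h2]; exact (neg_le_neg h1).trans (neg_le_abs _)
  have : |x / r| ≤ 1 := by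
    rw [abs_div, abs_of_nonneg ((abs_nonneg x).trans hx')]
    exact div_le_one_of_le₀ hx' ((abs_nonneg x).trans hx')
  have := (sq_le_one_iff_abs_le_one _).2 this
  linarith

end SoftCut

/-- The derivative of a real function vanishes almost everywhere on each level set. -/
lemma ae_deriv_eq_zero_of_eq (f : ℝ → ℝ) (c : ℝ) :
    ∀ᵐ t, ∀ f' : ℝ, HasDerivAt f f' t → f t = c → f' = 0 := by
  have hc := (countable_setOfPred_isolated_right_within (s := {t | f t = c})).measure_zero volume
  filter_upwards [compl_mem_ae_iff.2 hc] with t ht f' hf htc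
  by_contra hne
  refine ht ⟨htc, ?_⟩
  have h1 := hf.eventually_ne (c := c) hne
  rw [← Filter.empty_mem_iff_bot]
  · have h2 : {z | f z ≠ c} ∈ nhdsWithin t ({t | f t = c} ∩ Set.Ioi t) :=
      nhdsWithin_mono t (fun z hz => ne_of_gt hz.2) h1
    have h3 : {z | f z = c} ∈ nhdsWithin t ({t | f t = c} ∩ Set.Ioi t) :=
      mem_of_superset self_mem_nhdsWithin fun z hz => hz.1
    exact mem_of_superset (inter_mem h2 h3) fun z hz => hz.1 hz.2

section SimpleLoop

variable {γ : ℝ → Ed 2} {K : ℝ≥0} {G : ℝ → ℝ} {C : ℝ}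

lemma intervalIntegrable_mul_of_bound (hG : Measurable G) (hC : ∀ t, |G t| ≤ C) {f : ℝ → ℝ}
    {a b : ℝ} (hf : IntervalIntegrable f volume a b) :
    IntervalIntegrable (fun t => G t * f t) volume a b := by
  rw [intervalIntegrable_iff] at *
  exact hf.bdd_mul (c := C) hG.aestronglyMeasurable (Eventually.of_forall hC)

lemma LipschitzWith.intervalIntegrable_fderiv_deriv (hγ : LipschitzWith K γ) {φ : Ed 2 → ℝ}
    (hφ : ContDiff ℝ 1 φ) (a b : ℝ) :
    IntervalIntegrable (fun t => fderiv ℝ φ (γ t) (deriv γ t)) volume a b := by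
  simpa only [inner_gradient_left] using hγ.intervalIntegrable_inner_deriv
    (continuous_gradient hφ) a b

lemma simple_loop_endpoints (hinj : Set.InjOn γ (Set.Ico (0:ℝ) 1)) (hcl : γ 0 = γ 1)
    {s t : ℝ} (hs : s ∈ Set.Icc (0:ℝ) 1) (ht : t ∈ Set.Icc (0:ℝ) 1) (h : γ s = γ t) :
    s = t ∨ (s = 0 ∧ t = 1) ∨ (s = 1 ∧ t = 0) := by
  rcases hs.2.eq_or_lt with rfl | hs1 <;> rcases ht.2.eq_or_lt with rfl | ht1
  · exact Or.inl rfl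
  · exact Or.inr (Or.inr ⟨rfl, (hinj ⟨le_rfl, one_pos⟩ ⟨ht.1, ht1⟩ (hcl.trans h)).symm⟩)
  · exact Or.inr (Or.inl ⟨hinj ⟨hs.1, hs1⟩ ⟨le_rfl, one_pos⟩ (h.trans hcl.symm), rfl⟩)
  · exact Or.inl (hinj ⟨hs.1, hs1⟩ ⟨ht.1, ht1⟩ h)

lemma arc_integral_eq_zero_of_notMem_tsupport (hγ : LipschitzWith K γ)
    (hinj : Set.InjOn γ (Set.Ico (0:ℝ) 1)) (hcl : γ 0 = γ 1) (hG : Measurable G)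
    (hC : ∀ t, |G t| ≤ C)
    (hdiv : ∀ φ : Ed 2 → ℝ, ContDiff ℝ (⊤ : ℕ∞) φ → HasCompactSupport φ →
      ∫ t in (0:ℝ)..1, G t * fderiv ℝ φ (γ t) (deriv γ t) = 0)
    {φ : Ed 2 → ℝ} (hφ : ContDiff ℝ (⊤ : ℕ∞) φ) {a b : ℝ} (ha : 0 ≤ a) (hab : a ≤ b)
    (hb : b ≤ 1) (hφa : γ a ∉ tsupport φ) (hφb : γ b ∉ tsupport φ) :
    ∫ t in a..b, G t * fderiv ℝ φ (γ t) (deriv γ t) = 0 := by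
  obtain ⟨R, hR⟩ := ((isCompact_Icc (a := (0:ℝ)) (b := 1)).image hγ.continuous).isBounded
    |>.subset_ball (0 : Ed 2)
  set A := γ '' (Set.Icc 0 a ∪ Set.Icc b 1) ∩ tsupport φ with hA
  set B := γ '' Set.Icc a b ∩ tsupport φ with hB
  have hAc : IsClosed A :=
    ((isCompact_Icc.union isCompact_Icc).image hγ.continuous).isClosed.inter (isClosed_tsupport φ)
  have hBc : IsClosed B := (isCompact_Icc.image hγ.continuous).isClosed.inter (isClosed_tsupport φ)
  have hdisj : Disjoint (A ∪ (Metric.ball (0 : Ed 2) R)ᶜ) B := by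
    rw [Set.disjoint_left]
    rintro x (⟨⟨s, hs, rfl⟩, hx⟩ | hx) ⟨⟨t, ht, hst⟩, hx2⟩
    · have hs' : s ∈ Set.Icc (0:ℝ) 1 := by
        rcases hs with h | h
        · exact ⟨h.1, h.2.trans (hab.trans hb)⟩
        · exact ⟨(ha.trans hab).trans h.1, h.2⟩
      have hta : t ≠ a := by rintro rfl; exact hφa (hst ▸ hx)
      have htb : t ≠ b := by rintro rfl; exact hφb (hst ▸ hx)
      have h1 := lt_of_le_of_ne ht.1 hta.symm
      have h2 := lt_of_le_of_ne ht.2 htb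
      rcases simple_loop_endpoints hinj hcl ⟨ha.trans ht.1, ht.2.trans hb⟩ hs' hst with
        h | ⟨h, -⟩ | ⟨h, -⟩
      · rcases hs with h' | h'
        · linarith [h'.2]
        · linarith [h'.1]
      · linarith
      · linarith
    · exact hx (hR ⟨t, ⟨ha.trans ht.1, ht.2.trans hb⟩, hst⟩)
  obtain ⟨χ, hχ, hχr, hχ0, hχ1⟩ := exists_contMDiff_zero_iff_one_iff_of_isClosed
    (modelWithCornersSelf ℝ (Ed 2)) (n := ⊤)
    (hAc.union Metric.isOpen_ball.isClosed_compl) hBc hdisj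
  rw [contMDiff_iff_contDiff] at hχ
  have hχd : Differentiable ℝ χ := hχ.differentiable (by simp)
  have hφd : Differentiable ℝ φ := hφ.differentiable (by simp)
  have hχI : ∀ x, 0 ≤ χ x ∧ χ x ≤ 1 := fun x => hχr ⟨x, rfl⟩
  have hχ0' : ∀ x, χ x = 0 → fderiv ℝ χ x = 0 := fun x hx =>
    IsLocalMin.fderiv_eq_zero (Eventually.of_forall fun y => by rw [hx]; exact (hχI y).1)
  have hχ1' : ∀ x, χ x = 1 → fderiv ℝ χ x = 0 := fun x hx =>
    IsLocalMax.fderiv_eq_zero (Eventually.of_forall fun y => by rw [hx]; exact (hχI y).2)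
  have hprod : ∀ x, fderiv ℝ (fun y => χ y * φ y) x = χ x • fderiv ℝ φ x + φ x • fderiv ℝ χ x :=
    fun x => fderiv_fun_mul (hχd x) (hφd x)
  have hsupp : HasCompactSupport fun y => χ y * φ y := by
    refine HasCompactSupport.of_support_subset_isCompact (isCompact_closedBall (0 : Ed 2) R) ?_
    intro x hx
    by_contra hxR
    refine hx ?_
    have : χ x = 0 := (hχ0 x).1 (Or.inr fun h => hxR (Metric.ball_subset_closedBall h))
    simp [this]
  have hmain := hdiv _ (hχ.mul hφ) hsupp
  have hcontd : ContDiff ℝ 1 fun y => χ y * φ y := (hχ.mul hφ).of_le (by exact_mod_cast le_top)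
  have hii : ∀ p q : ℝ, IntervalIntegrable
      (fun t => G t * fderiv ℝ (fun y => χ y * φ y) (γ t) (deriv γ t)) volume p q := fun p q =>
    intervalIntegrable_mul_of_bound hG hC (hγ.intervalIntegrable_fderiv_deriv hcontd p q)
  have houtside : ∀ x, x ∉ tsupport φ → φ x = 0 ∧ fderiv ℝ φ x = 0 := fun x hx =>
    ⟨image_eq_zero_of_notMem_tsupport hx, by
      by_contra h
      exact hx (support_fderiv_subset ℝ h)⟩
  have hzero : ∀ t ∈ Set.Icc 0 a ∪ Set.Icc b 1,
      G t * fderiv ℝ (fun y => χ y * φ y) (γ t) (deriv γ t) = 0 := by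
    intro t ht
    rw [hprod]
    by_cases hx : γ t ∈ tsupport φ
    · have h0 : χ (γ t) = 0 := (hχ0 _).1 (Or.inl ⟨⟨t, ht, rfl⟩, hx⟩)
      simp [h0, hχ0' _ h0]
    · simp [houtside _ hx]
  have hone : ∀ t ∈ Set.Icc a b, G t * fderiv ℝ (fun y => χ y * φ y) (γ t) (deriv γ t) =
      G t * fderiv ℝ φ (γ t) (deriv γ t) := by
    intro t ht
    rw [hprod]
    by_cases hx : γ t ∈ tsupport φ
    · have h0 : χ (γ t) = 1 := (hχ1 _).1 ⟨⟨t, ht, rfl⟩, hx⟩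
      simp [h0, hχ1' _ h0]
    · simp [houtside _ hx]
  rw [← intervalIntegral.integral_add_adjacent_intervals (hii 0 b) (hii b 1),
    ← intervalIntegral.integral_add_adjacent_intervals (hii 0 a) (hii a b),
    intervalIntegral.integral_congr (a := 0) (b := a) (g := fun _ => 0),
    intervalIntegral.integral_congr (a := b) (b := 1) (g := fun _ => 0),
    intervalIntegral.integral_congr (a := a) (b := b)
      (g := fun t => G t * fderiv ℝ φ (γ t) (deriv γ t))] at hmain
  · simpa using hmain
  · intro t ht; rw [Set.uIcc_of_le hab] at ht; exact hone t ht
  · intro t ht; rw [Set.uIcc_of_le hb] at ht; exact hzero t (Or.inr ht)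
  · intro t ht; rw [Set.uIcc_of_le ha] at ht; exact hzero t (Or.inl ht)

lemma arc_integral_eq_zero_of_eq_zero (hγ : LipschitzWith K γ)
    (hinj : Set.InjOn γ (Set.Ico (0:ℝ) 1)) (hcl : γ 0 = γ 1) (hG : Measurable G)
    (hC : ∀ t, |G t| ≤ C)
    (hdiv : ∀ φ : Ed 2 → ℝ, ContDiff ℝ (⊤ : ℕ∞) φ → HasCompactSupport φ →
      ∫ t in (0:ℝ)..1, G t * fderiv ℝ φ (γ t) (deriv γ t) = 0)
    {φ : Ed 2 → ℝ} (hφ : ContDiff ℝ (⊤ : ℕ∞) φ) {a b : ℝ} (ha : 0 ≤ a) (hab : a ≤ b)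
    (hb : b ≤ 1) (hφa : φ (γ a) = 0) (hφb : φ (γ b) = 0) :
    ∫ t in a..b, G t * fderiv ℝ φ (γ t) (deriv γ t) = 0 := by
  have hφ1 : ContDiff ℝ 1 φ := hφ.of_le (by exact_mod_cast le_top)
  set r : ℕ → ℝ := fun n => 1 / ((n : ℝ) + 1) with hr
  have hrpos : ∀ n, 0 < r n := fun n => Nat.one_div_pos_of_nat
  have hnot : ∀ n x, φ x = 0 → x ∉ tsupport (softCut (r n) ∘ φ) := by
    intro n x hx
    rw [notMem_tsupport_iff_eventuallyEq]
    have : ∀ᶠ y in nhds x, |φ y| < r n := by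
      have h : Tendsto (fun y => |φ y|) (nhds x) (nhds |φ x|) := (hφ.continuous.abs).tendsto x
      rw [hx, abs_zero] at h
      exact h.eventually_lt_const (hrpos n)
    filter_upwards [this] with y hy
    exact softCut_eq_zero hy.le
  have hder : ∀ n x v, fderiv ℝ (softCut (r n) ∘ φ) x v =
      Real.smoothTransition ((φ x / r n) ^ 2 - 1) * fderiv ℝ φ x v := by
    intro n x v
    rw [((hasDerivAt_softCut (r n) (φ x)).comp_hasFDerivAt x
      ((hφ1.differentiable (by simp)) x).hasFDerivAt).fderiv]
    simp
  have hz : ∀ n, ∫ t in a..b, G t * fderiv ℝ (softCut (r n) ∘ φ) (γ t) (deriv γ t) = 0 :=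
    fun n => arc_integral_eq_zero_of_notMem_tsupport hγ hinj hcl hG hC hdiv
      ((contDiff_softCut (r n)).comp hφ) ha hab hb (hnot n _ hφa) (hnot n _ hφb)
  have hlim : Tendsto (fun n => ∫ t in a..b, G t * fderiv ℝ (softCut (r n) ∘ φ) (γ t) (deriv γ t))
      atTop (nhds (∫ t in a..b, G t * fderiv ℝ φ (γ t) (deriv γ t))) := by
    have hI := intervalIntegrable_mul_of_bound hG hC (hγ.intervalIntegrable_fderiv_deriv hφ1 a b)
    refine intervalIntegral.tendsto_integral_filter_of_dominated_convergence
      (fun t => |G t * fderiv ℝ φ (γ t) (deriv γ t)|) ?_ ?_ hI.abs ?_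
    · refine Eventually.of_forall fun n => ?_
      have := intervalIntegrable_mul_of_bound hG hC (hγ.intervalIntegrable_fderiv_deriv
        (((contDiff_softCut (r n)).comp hφ).of_le (by exact_mod_cast le_top)) a b)
      exact this.def'.aestronglyMeasurable
    · refine Eventually.of_forall fun n => Eventually.of_forall fun t _ => ?_
      rw [hder, Real.norm_eq_abs, mul_left_comm, abs_mul, abs_of_nonneg
        (Real.smoothTransition.nonneg _)]
      exact mul_le_of_le_one_left (abs_nonneg _) (Real.smoothTransition.le_one _)
    · filter_upwards [hγ.ae_deriv_comp hφ1, ae_deriv_eq_zero_of_eq (φ ∘ γ) 0] with t ht h0 _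
      simp only [hder]
      by_cases hφt : φ (γ t) = 0
      · simp [h0 _ ht hφt]
      · refine tendsto_const_nhds.congr' ?_
        have h1 : ∀ᶠ n in atTop, r n < |φ (γ t)| / 2 :=
          tendsto_one_div_add_atTop_nhds_zero_nat.eventually_lt_const (by positivity)
        filter_upwards [h1] with n hn
        rw [Real.smoothTransition.one_of_one_le, one_mul]
        have h2 : 2 ≤ |φ (γ t) / r n| := by
          rw [abs_div, abs_of_pos (hrpos n), le_div_iff₀ (hrpos n)]; linarith
        have := sq_abs (φ (γ t) / r n)
        nlinarith
  exact tendsto_nhds_unique hlim (by simp only [hz]; exact tendsto_const_nhds)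

/-- On a simple loop, divergence-free densities are constant along the tangent. -/
lemma simple_loop_density_const (hγ : LipschitzWith K γ)
    (hinj : Set.InjOn γ (Set.Ico (0:ℝ) 1)) (hcl : γ 0 = γ 1) (hG : Measurable G)
    (hC : ∀ t, |G t| ≤ C)
    (hdiv : ∀ φ : Ed 2 → ℝ, ContDiff ℝ (⊤ : ℕ∞) φ → HasCompactSupport φ →
      ∫ t in (0:ℝ)..1, G t * fderiv ℝ φ (γ t) (deriv γ t) = 0) :
    ∃ c : ℝ, ∀ᵐ t, t ∈ Set.Icc (0:ℝ) 1 → G t • deriv γ t = c • deriv γ t := by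
  have hle : ∀ {φ : Ed 2 → ℝ}, ContDiff ℝ (⊤ : ℕ∞) φ → ContDiff ℝ 1 φ := fun h =>
    h.of_le (by exact_mod_cast le_top)
  have hI : ∀ {φ : Ed 2 → ℝ}, ContDiff ℝ (⊤ : ℕ∞) φ → ∀ a b, IntervalIntegrable
      (fun t => G t * fderiv ℝ φ (γ t) (deriv γ t)) volume a b := fun h a b =>
    intervalIntegrable_mul_of_bound hG hC (hγ.intervalIntegrable_fderiv_deriv (hle h) a b)
  have hne : ∀ {s t : ℝ}, s ∈ Set.Ico (0:ℝ) 1 → t ∈ Set.Ico (0:ℝ) 1 → s ≠ t → γ s ≠ γ t :=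
    fun hs ht h => hinj.ne hs ht h
  -- the proportionality constant of an initial arc
  have hcb : ∀ b ∈ Set.Ioo (0:ℝ) 1, ∃ c : ℝ, ∀ φ : Ed 2 → ℝ, ContDiff ℝ (⊤ : ℕ∞) φ →
      ∫ t in (0:ℝ)..b, G t * fderiv ℝ φ (γ t) (deriv γ t) = c * (φ (γ b) - φ (γ 0)) := by
    intro b hb
    have h0b : γ b ≠ γ 0 := hne ⟨hb.1.le, hb.2⟩ ⟨le_rfl, one_pos⟩ hb.1.ne'
    set q : Ed 2 → ℝ := fun x => ‖x - γ 0‖ ^ 2 with hq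
    have hqs : ContDiff ℝ (⊤ : ℕ∞) q := (contDiff_id.sub contDiff_const).norm_sq ℝ
    have hqb : q (γ b) ≠ 0 := by simpa [hq, sub_eq_zero] using h0b
    refine ⟨(∫ t in (0:ℝ)..b, G t * fderiv ℝ q (γ t) (deriv γ t)) / q (γ b), fun φ hφ => ?_⟩
    set d := (φ (γ b) - φ (γ 0)) / q (γ b) with hd
    set ψ : Ed 2 → ℝ := fun x => φ x - φ (γ 0) - d * q x with hψ
    have hψs : ContDiff ℝ (⊤ : ℕ∞) ψ := (hφ.sub contDiff_const).sub (contDiff_const.mul hqs)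
    have hz := arc_integral_eq_zero_of_eq_zero hγ hinj hcl hG hC hdiv hψs le_rfl hb.1.le hb.2.le
      (by simp [hψ, hq]) (by simp only [hψ, hd]; field_simp; ring)
    have hder : ∀ x v, fderiv ℝ ψ x v = fderiv ℝ φ x v - d * fderiv ℝ q x v := by
      intro x v
      have h1 : HasFDerivAt φ (fderiv ℝ φ x) x := ((hle hφ).differentiable (by simp) x).hasFDerivAt
      have h2 : HasFDerivAt q (fderiv ℝ q x) x := ((hle hqs).differentiable (by simp) x).hasFDerivAt
      have h3 : HasFDerivAt ψ (fderiv ℝ φ x - d • fderiv ℝ q x) x :=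
        (h1.sub_const (φ (γ 0))).sub (h2.const_mul d)
      rw [h3.fderiv]
      simp
    simp only [hder] at hz
    have hsplit : ∀ t, G t * (fderiv ℝ φ (γ t) (deriv γ t) - d * fderiv ℝ q (γ t) (deriv γ t)) =
      G t * fderiv ℝ φ (γ t) (deriv γ t) - d * (G t * fderiv ℝ q (γ t) (deriv γ t)) :=
      fun t => by ring
    simp only [hsplit] at hz
    rw [intervalIntegral.integral_sub (hI hφ 0 b) ((hI hqs 0 b).const_mul d),
      intervalIntegral.integral_const_mul] at hz
    rw [sub_eq_zero.1 hz, hd]; ring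
  choose! c hc using hcb
  have hconst : ∀ b ∈ Set.Ioo (0:ℝ) 1, ∀ b' ∈ Set.Ioo (0:ℝ) 1, b < b' → c b = c b' := by
    intro b hb b' hb' hlt
    set q : Ed 2 → ℝ := fun x => ‖x - γ b‖ ^ 2 * ‖x - γ b'‖ ^ 2 with hq
    have hqs : ContDiff ℝ (⊤ : ℕ∞) q := ((contDiff_id.sub contDiff_const).norm_sq ℝ).mul
      ((contDiff_id.sub contDiff_const).norm_sq ℝ)
    have hz := arc_integral_eq_zero_of_eq_zero hγ hinj hcl hG hC hdiv hqs hb.1.le hlt.le hb'.2.le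
      (by simp [hq]) (by simp [hq])
    have h1 := hc b hb q hqs
    have h2 := hc b' hb' q hqs
    rw [← intervalIntegral.integral_add_adjacent_intervals (hI hqs 0 b) (hI hqs b b'), hz,
      add_zero, h1] at h2
    have h0 : q (γ 0) ≠ 0 := by
      have e1 := hne ⟨le_rfl, one_pos⟩ ⟨hb.1.le, hb.2⟩ hb.1.ne
      have e2 := hne ⟨le_rfl, one_pos⟩ ⟨hb'.1.le, hb'.2⟩ hb'.1.ne
      simp [hq, sub_eq_zero, e1, e2]
    have hqb : q (γ b) = 0 := by simp [hq]
    have hqb' : q (γ b') = 0 := by simp [hq]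
    rw [hqb, hqb', zero_sub] at h2
    exact mul_right_cancel₀ (neg_ne_zero.2 h0) h2
  refine ⟨c (1 / 2), ?_⟩
  have hall : ∀ b ∈ Set.Ioo (0:ℝ) 1, c b = c (1 / 2) := by
    intro b hb
    rcases lt_trichotomy b (1 / 2) with h | h | h
    · exact hconst b hb _ ⟨by norm_num, by norm_num⟩ h
    · rw [h]
    · exact (hconst _ ⟨by norm_num, by norm_num⟩ b hb h).symm
  have hcoord : ∀ i : Fin 2, ∀ᵐ t, t ∈ Set.Icc (0:ℝ) 1 →
      G t * deriv γ t i = c (1 / 2) * deriv γ t i := by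
    intro i
    set φ : Ed 2 → ℝ := fun x => x i with hφdef
    have hφ : ContDiff ℝ (⊤ : ℕ∞) φ := by fun_prop
    have hder : ∀ x v, fderiv ℝ φ x v = v i := by
      intro x v
      have : HasFDerivAt φ (EuclideanSpace.proj i : Ed 2 →L[ℝ] ℝ) x :=
        (EuclideanSpace.proj i : Ed 2 →L[ℝ] ℝ).hasFDerivAt
      rw [this.fderiv]; rfl
    have hI1 := hI hφ 0 1
    have hI2 := hγ.intervalIntegrable_fderiv_deriv (hle hφ) 0 1
    have hD := hI1.sub (hI2.const_mul (c (1 / 2)))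
    have hsm := hD.ae_hasDerivAt_integral
    have h01 : ∀ᵐ t : ℝ, t ≠ 0 ∧ t ≠ 1 := by
      have := ((Set.countable_singleton (1:ℝ)).insert 0).ae_notMem volume
      filter_upwards [this] with t ht
      simpa [not_or] using ht
    filter_upwards [hsm, h01] with t ht hne01 htI
    have htI' : t ∈ Set.Ioo (0:ℝ) 1 :=
      ⟨lt_of_le_of_ne htI.1 hne01.1.symm, lt_of_le_of_ne htI.2 hne01.2⟩
    have h1 := ht (by rwa [Set.uIcc_of_le zero_le_one]) 0 (by simp)
    have h2 : (fun x => ∫ s in (0:ℝ)..x, (G s * fderiv ℝ φ (γ s) (deriv γ s) -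
        c (1 / 2) * fderiv ℝ φ (γ s) (deriv γ s))) =ᶠ[nhds t] fun _ => 0 := by
      filter_upwards [isOpen_Ioo.mem_nhds htI'] with x hx
      rw [intervalIntegral.integral_sub (hI hφ 0 x)
        ((hγ.intervalIntegrable_fderiv_deriv (hle hφ) 0 x).const_mul _),
        intervalIntegral.integral_const_mul, hγ.integral_fderiv_deriv (hle hφ), hc x hx φ hφ,
        hall x hx, sub_self]
    have h3 := (h1.congr_of_eventuallyEq h2.symm).unique (hasDerivAt_const t (0:ℝ))
    simp only [hder] at h3
    linarith
  filter_upwards [hcoord 0, hcoord 1] with t h0 h1 ht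
  ext i
  fin_cases i
  · simpa using h0 ht
  · simpa using h1 ht

end SimpleLoop

section ConvexCombination

lemma IsPolarVM.abs_Jpair_sub_le {σ : Measure (Ed 2)} {τ : Ed 2 → Ed 2} (h : IsPolarVM σ τ)
    {Φ Ψ : Ed 2 → Ed 2} (hΦ : Measurable Φ) (hΨ : Measurable Ψ) {C : ℝ} (hC : ∀ x, ‖Φ x‖ ≤ C)
    (hC' : ∀ x, ‖Ψ x‖ ≤ C) :
    |Jpair σ τ Ψ - Jpair σ τ Φ| ≤ ∫ x, ‖Ψ x - Φ x‖ ∂σ := by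
  have := h.1
  have e : Jpair σ τ Ψ - Jpair σ τ Φ = ∫ x, ⟪Ψ x - Φ x, τ x⟫ ∂σ := by
    unfold Jpair
    rw [← integral_sub (h.integrable_inner hΨ hC') (h.integrable_inner hΦ hC)]
    simp only [inner_sub_left]
  rw [e]
  refine (abs_integral_le_integral_abs).trans
    (integral_mono_of_nonneg (ae_of_all _ fun _ => abs_nonneg _) ?_ ?_)
  · refine Integrable.of_bound (C := C + C) (hΨ.sub hΦ).norm.aestronglyMeasurable
      (ae_of_all _ fun x => ?_)
    rw [norm_norm]
    exact (norm_sub_le _ _).trans (add_le_add (hC' x) (hC x))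
  · filter_upwards [h.2.2] with x hx
    simpa [hx] using abs_real_inner_le_norm (Ψ x - Φ x) (τ x)

lemma eq_of_forall_abs_sub_le_mul {a b D : ℝ} (hD : ∀ ε > 0, |a - b| ≤ D * ε) : a = b := by
  refine eq_of_abs_sub_nonpos (le_of_forall_pos_le_add fun ε hε => ?_)
  have h1 := hD (ε / (|D| + 1)) (by positivity)
  refine h1.trans ?_
  have : D * (ε / (|D| + 1)) ≤ (|D| + 1) * (ε / (|D| + 1)) := by
    gcongr; linarith [le_abs_self D]
  rw [mul_div_cancel₀ _ (by positivity)] at this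
  linarith

lemma integral_norm_sub_mono {ν₁ ν : Measure (Ed 2)} [IsFiniteMeasure ν] (hle : ν₁ ≤ ν)
    {Φ Ψ : Ed 2 → Ed 2} (hΦ : Measurable Φ) (hΨ : Measurable Ψ) (hC : ∀ x, ‖Φ x‖ ≤ 1)
    (hC' : ∀ x, ‖Ψ x‖ ≤ 1) : ∫ x, ‖Ψ x - Φ x‖ ∂ν₁ ≤ ∫ x, ‖Ψ x - Φ x‖ ∂ν := by
  refine integral_mono_measure hle (ae_of_all _ fun x => norm_nonneg _) ?_
  refine Integrable.of_bound (C := 1 + 1) (hΨ.sub hΦ).norm.aestronglyMeasurable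
    (ae_of_all _ fun x => ?_)
  rw [norm_norm]
  exact (norm_sub_le _ _).trans (add_le_add (hC' x) (hC x))

lemma Jpair_combination_of_tests {σ σ₁ σ₂ : Measure (Ed 2)} {τ τ₁ τ₂ : Ed 2 → Ed 2}
    (h : IsPolarVM σ τ) (h₁ : IsPolarVM σ₁ τ₁) (h₂ : IsPolarVM σ₂ τ₂) {a b : ℝ}
    (hadd : ∀ Φ : Ed 2 → Ed 2, Continuous Φ → HasCompactSupport Φ →
      Jpair σ τ Φ = a * Jpair σ₁ τ₁ Φ + b * Jpair σ₂ τ₂ Φ)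
    {Φ : Ed 2 → Ed 2} (hΦ : Measurable Φ) (hC : ∀ x, ‖Φ x‖ ≤ 1) :
    Jpair σ τ Φ = a * Jpair σ₁ τ₁ Φ + b * Jpair σ₂ τ₂ Φ := by
  have := h.1
  have := h₁.1
  have := h₂.1
  refine eq_of_forall_abs_sub_le_mul (D := 1 + |a| + |b|) fun ε hε => ?_
  obtain ⟨Ψ, hΨc, hΨs, hΨ1, hΨ⟩ := exists_test_integral_norm_sub_le (σ + σ₁ + σ₂) hΦ hC hε
  have hm := hΨc.measurable
  have e := hadd Ψ hΨc hΨs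
  have b0 := (h.abs_Jpair_sub_le hΦ hm hC hΨ1).trans
    ((integral_norm_sub_mono (ν := σ + σ₁ + σ₂) (by
      rw [add_assoc]; exact Measure.le_add_right le_rfl) hΦ hm hC hΨ1).trans hΨ)
  have b1 := (h₁.abs_Jpair_sub_le hΦ hm hC hΨ1).trans
    ((integral_norm_sub_mono (ν := σ + σ₁ + σ₂) (by
      rw [add_comm σ, add_assoc]; exact Measure.le_add_right le_rfl) hΦ hm hC hΨ1).trans hΨ)
  have b2 := (h₂.abs_Jpair_sub_le hΦ hm hC hΨ1).trans
    ((integral_norm_sub_mono (ν := σ + σ₁ + σ₂) (Measure.le_add_left le_rfl)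
      hΦ hm hC hΨ1).trans hΨ)
  have e2 : Jpair σ τ Φ - (a * Jpair σ₁ τ₁ Φ + b * Jpair σ₂ τ₂ Φ) =
      -(Jpair σ τ Ψ - Jpair σ τ Φ) + a * (Jpair σ₁ τ₁ Ψ - Jpair σ₁ τ₁ Φ) +
        b * (Jpair σ₂ τ₂ Ψ - Jpair σ₂ τ₂ Φ) := by rw [e]; ring
  rw [e2]
  refine (abs_add_le _ _).trans ?_
  refine (add_le_add (abs_add_le _ _) le_rfl).trans ?_
  rw [abs_neg, abs_mul, abs_mul]
  have := mul_le_mul_of_nonneg_left b1 (abs_nonneg a)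
  have := mul_le_mul_of_nonneg_left b2 (abs_nonneg b)
  linarith

lemma IsPolarVM.Jpair_le_real_univ {σ : Measure (Ed 2)} {τ : Ed 2 → Ed 2} (h : IsPolarVM σ τ)
    {Φ : Ed 2 → Ed 2} (hC : ∀ x, ‖Φ x‖ ≤ 1) : Jpair σ τ Φ ≤ σ.real Set.univ := by
  simpa using (le_abs_self _).trans (h.abs_Jpair_le hC)

/-- A unit field that saturates the pairing is the polar direction. -/
lemma IsPolarVM.ae_eq_of_le_Jpair {σ : Measure (Ed 2)} {τ g : Ed 2 → Ed 2} (h : IsPolarVM σ τ)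
    (hg : Measurable g) (hC : ∀ x, ‖g x‖ ≤ 1) (hle : σ.real Set.univ ≤ Jpair σ τ g) :
    ∀ᵐ x ∂σ, τ x = g x := by
  have := h.1
  have hi := h.integrable_inner hg hC
  have hn : 0 ≤ᵐ[σ] fun x => 1 - ⟪g x, τ x⟫ := by
    filter_upwards [h.2.2] with x hx
    have h1 := (le_abs_self _).trans (abs_real_inner_le_norm (g x) (τ x))
    rw [hx, mul_one] at h1
    simpa using h1.trans (hC x)
  have hz : ∫ x, (1 - ⟪g x, τ x⟫) ∂σ = 0 := by
    refine le_antisymm ?_ (integral_nonneg_of_ae hn)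
    rw [integral_sub (integrable_const _) hi]
    simp only [integral_const, smul_eq_mul, mul_one]
    unfold Jpair at hle
    linarith
  have h0 := (integral_eq_zero_iff_of_nonneg_ae hn ((integrable_const _).sub hi)).1 hz
  filter_upwards [h0, h.2.2] with x hx h1
  have hx' : ⟪τ x, g x⟫ = 1 := by
    rw [real_inner_comm]; simp only [Pi.zero_apply] at hx; linarith
  have h2 := norm_sub_sq_real (τ x) (g x)
  rw [hx', h1] at h2
  have h3 := hC x
  have h4 : ‖τ x - g x‖ ^ 2 ≤ 0 := by nlinarith [norm_nonneg (g x)]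
  have h5 : ‖τ x - g x‖ = 0 := by nlinarith [norm_nonneg (τ x - g x)]
  exact sub_eq_zero.1 (norm_eq_zero.1 h5)

lemma Jpair_indicator_of_ae_eq {σ : Measure (Ed 2)} {τ g : Ed 2 → Ed 2} (h : IsPolarVM σ τ)
    (hg : ∀ᵐ x ∂σ, τ x = g x) {A : Set (Ed 2)} (hA : MeasurableSet A) :
    Jpair σ τ (A.indicator g) = σ.real A := by
  unfold Jpair
  rw [← integral_indicator_one hA]
  refine integral_congr_ae ?_
  filter_upwards [hg, h.2.2] with x hx h1
  by_cases hxA : x ∈ A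
  · simp [hxA, ← hx, h1]
  · simp [hxA]

/-- In a convex decomposition of a unit mass field, both parts have unit mass and the same
direction, and the first one is dominated by the whole. -/
lemma convex_decomposition {σ σ₁ σ₂ : Measure (Ed 2)} {τ τ₁ τ₂ g : Ed 2 → Ed 2}
    (h : IsPolarVM σ τ) (h₁ : IsPolarVM σ₁ τ₁) (h₂ : IsPolarVM σ₂ τ₂) {t : ℝ}
    (ht : t ∈ Set.Ioo (0:ℝ) 1) (hg : Measurable g) (hC : ∀ x, ‖g x‖ ≤ 1)
    (hgτ : ∀ᵐ x ∂σ, τ x = g x) (hm : σ.real Set.univ = 1) (hm₁ : σ₁.real Set.univ ≤ 1)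
    (hm₂ : σ₂.real Set.univ ≤ 1)
    (hadd : ∀ Φ : Ed 2 → Ed 2, Continuous Φ → HasCompactSupport Φ →
      Jpair σ τ Φ = (1 - t) * Jpair σ₁ τ₁ Φ + t * Jpair σ₂ τ₂ Φ) :
    (∀ᵐ x ∂σ₁, τ₁ x = g x) ∧ σ₁.real Set.univ = 1 ∧
      σ₁ ≤ ENNReal.ofReal (1 - t)⁻¹ • σ := by
  have := h.1
  have := h₁.1
  have := h₂.1
  have ht1 : 0 < 1 - t := sub_pos.2 ht.2
  have e := Jpair_combination_of_tests h h₁ h₂ hadd hg hC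
  have eσ : Jpair σ τ g = 1 := by
    have := Jpair_indicator_of_ae_eq h hgτ MeasurableSet.univ
    rwa [Set.indicator_univ, hm] at this
  have l1 := h₁.Jpair_le_real_univ hC
  have l2 := h₂.Jpair_le_real_univ hC
  have g1 : 1 ≤ Jpair σ₁ τ₁ g := by
    rw [eσ] at e
    nlinarith [ht.1]
  have g2 : 1 ≤ Jpair σ₂ τ₂ g := by
    rw [eσ] at e
    nlinarith [ht.1]
  have d1 := h₁.ae_eq_of_le_Jpair hg hC (hm₁.trans g1)
  have d2 := h₂.ae_eq_of_le_Jpair hg hC (hm₂.trans g2)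
  refine ⟨d1, le_antisymm hm₁ (g1.trans l1), ?_⟩
  refine Measure.le_iff.2 fun A hA => ?_
  have e := Jpair_combination_of_tests h h₁ h₂ hadd (hg.indicator hA) (fun x =>
    (norm_indicator_le_norm_self g x).trans (hC x))
  rw [Jpair_indicator_of_ae_eq h hgτ hA, Jpair_indicator_of_ae_eq h₁ d1 hA,
    Jpair_indicator_of_ae_eq h₂ d2 hA] at e
  have hle : σ₁.real A ≤ (1 - t)⁻¹ * σ.real A := by
    rw [inv_mul_eq_div, le_div_iff₀ ht1]
    nlinarith [ht.1, measureReal_nonneg (μ := σ₂) (s := A)]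
  rw [Measure.smul_apply, smul_eq_mul, ← ofReal_measureReal (μ := σ₁),
    ← ofReal_measureReal (μ := σ), ← ENNReal.ofReal_mul (by positivity)]
  exact ENNReal.ofReal_le_ofReal hle

/-- A measure dominated by a multiple of `σ` has a bounded measurable density. -/
lemma exists_bounded_density {σ σ₁ : Measure (Ed 2)} [IsFiniteMeasure σ] [IsFiniteMeasure σ₁]
    {C : ℝ} (hC : 0 ≤ C) (hle : σ₁ ≤ ENNReal.ofReal C • σ) :
    ∃ F : Ed 2 → ℝ, Measurable F ∧ (∀ x, |F x| ≤ C) ∧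
      ∀ f : Ed 2 → ℝ, ∫ x, f x ∂σ₁ = ∫ x, F x * f x ∂σ := by
  have := Measure.haveLebesgueDecomposition_of_sigmaFinite σ₁ σ
  have hac : σ₁ ≪ σ := Measure.absolutelyContinuous_of_le_smul hle
  have hb : ∀ᵐ x ∂σ, σ₁.rnDeriv σ x ≤ ENNReal.ofReal C := by
    refine ae_le_of_forall_setLIntegral_le_of_sigmaFinite (Measure.measurable_rnDeriv _ _) ?_
    intro s hs _
    rw [Measure.setLIntegral_rnDeriv hac, setLIntegral_const]
    simpa using hle s
  refine ⟨fun x => (min (σ₁.rnDeriv σ x) (ENNReal.ofReal C)).toReal,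
    ((Measure.measurable_rnDeriv _ _).min measurable_const).ennreal_toReal, fun x => ?_,
    fun f => ?_⟩
  · rw [abs_of_nonneg ENNReal.toReal_nonneg]
    exact ENNReal.toReal_le_of_le_ofReal hC (min_le_right _ _)
  · conv_lhs => rw [← Measure.withDensity_rnDeriv_eq _ _ hac]
    rw [integral_withDensity_eq_integral_toReal_smul (Measure.measurable_rnDeriv _ _)
      (Measure.rnDeriv_lt_top _ _)]
    refine integral_congr_ae ?_
    filter_upwards [hb] with x hx
    simp [min_eq_left hx]

end ConvexCombination

section SimpleLoopExtreme

variable {γ : ℝ → Ed 2} {K : ℝ≥0}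

lemma intervalIntegrable_inner_deriv_of_measurable (hγ : LipschitzWith K γ) {Φ : Ed 2 → Ed 2}
    (hΦ : Measurable Φ) {C : ℝ} (hC : ∀ x, ‖Φ x‖ ≤ C) (a b : ℝ) :
    IntervalIntegrable (fun t => ⟪Φ (γ t), deriv γ t⟫) volume a b := by
  have hm : Measurable fun t => ⟪Φ (γ t), deriv γ t⟫ :=
    (hΦ.comp hγ.continuous.measurable).inner (measurable_deriv γ)
  refine (intervalIntegrable_const (c := C * K)).mono_fun hm.aestronglyMeasurable
    (ae_of_all _ fun t => ?_)
  have hC0 : 0 ≤ C := (norm_nonneg _).trans (hC 0)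
  simp only [Real.norm_eq_abs]
  rw [abs_of_nonneg (mul_nonneg hC0 K.coe_nonneg)]
  exact (abs_real_inner_le_norm _ _).trans
    (mul_le_mul (hC _) (hγ.norm_deriv_le t) (norm_nonneg _) hC0)

lemma intervalIntegrable_norm_deriv (hγ : LipschitzWith K γ) (a b : ℝ) :
    IntervalIntegrable (fun t => ‖deriv γ t‖) volume a b :=
  (intervalIntegrable_const (c := (K : ℝ))).mono_fun (measurable_deriv γ).norm.aestronglyMeasurable
    (ae_of_all _ fun t => by simpa using hγ.norm_deriv_le t)

lemma abs_integral_inner_deriv_le (hγ : LipschitzWith K γ) {a b : ℝ} (hab : a ≤ b)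
    {Φ : Ed 2 → Ed 2} (hΦ : ∀ x, ‖Φ x‖ ≤ 1) :
    |∫ t in a..b, ⟪Φ (γ t), deriv γ t⟫| ≤ ∫ t in a..b, ‖deriv γ t‖ := by
  rw [← Real.norm_eq_abs]
  refine intervalIntegral.norm_integral_le_of_norm_le hab (ae_of_all _ fun t _ => ?_)
    (intervalIntegrable_norm_deriv hγ a b)
  rw [Real.norm_eq_abs]
  refine (abs_real_inner_le_norm _ _).trans ?_
  exact mul_le_of_le_one_left (norm_nonneg _) (hΦ _)

lemma simple_loop_length_pos (hγ : LipschitzWith K γ) (hinj : Set.InjOn γ (Set.Ico (0:ℝ) 1)) :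
    0 < ∫ t in (0:ℝ)..1, ‖deriv γ t‖ := by
  have hnn : 0 ≤ ∫ t in (0:ℝ)..1, ‖deriv γ t‖ :=
    intervalIntegral.integral_nonneg zero_le_one fun _ _ => norm_nonneg _
  refine lt_of_le_of_ne hnn fun h0 => ?_
  have hz := (intervalIntegral.integral_eq_zero_iff_of_le_of_nonneg_ae zero_le_one
    (ae_of_all _ fun t => norm_nonneg (deriv γ t))
    (intervalIntegrable_norm_deriv hγ 0 1)).1 h0.symm
  set φ : Ed 2 → ℝ := fun x => ‖x - γ 0‖ ^ 2 with hφ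
  have hφs : ContDiff ℝ 1 φ := (contDiff_id.sub contDiff_const).norm_sq ℝ
  have h1 := hγ.integral_fderiv_deriv hφs 0 (1 / 2)
  have h2 : ∫ t in (0:ℝ)..(1 / 2), fderiv ℝ φ (γ t) (deriv γ t) = 0 := by
    refine intervalIntegral.integral_zero_ae ?_
    have hz' := (ae_restrict_iff' measurableSet_Ioc).1 hz
    filter_upwards [hz'] with t ht htI
    rw [Set.uIoc_of_le (by norm_num)] at htI
    have := ht ⟨htI.1, htI.2.trans (by norm_num)⟩
    rw [norm_eq_zero.1 this, map_zero]
  rw [h2] at h1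
  have h3 : γ (1 / 2) = γ 0 := by
    simp only [hφ, sub_self, norm_zero] at h1
    have : ‖γ (1 / 2) - γ 0‖ ^ 2 = 0 := by linarith
    exact sub_eq_zero.1 (norm_eq_zero.1 (pow_eq_zero_iff two_ne_zero |>.1 this))
  have := hinj (by norm_num) (by norm_num) h3
  norm_num at this

lemma exists_direction_field (hγ : LipschitzWith K γ) (hinj : Set.InjOn γ (Set.Ico (0:ℝ) 1)) :
    ∃ g : Ed 2 → Ed 2, Measurable g ∧ (∀ x, ‖g x‖ ≤ 1) ∧
      ∀ t ∈ Set.Ico (0:ℝ) 1, g (γ t) = ‖deriv γ t‖⁻¹ • deriv γ t := by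
  have hemb := hγ.continuous.continuousOn.measurableEmbedding
    (measurableSet_Ico (a := (0:ℝ)) (b := 1)) hinj
  have hd : Measurable fun t : ℝ => ‖deriv γ t‖⁻¹ • deriv γ t :=
    (measurable_deriv γ).norm.inv.smul (measurable_deriv γ)
  obtain ⟨g, hg, hgc⟩ := hemb.exists_measurable_extend
    (g := fun t : Set.Ico (0:ℝ) 1 => ‖deriv γ t‖⁻¹ • deriv γ t)
    (hd.comp measurable_subtype_coe) (fun _ => inferInstance)
  have hs : MeasurableSet {x | ‖g x‖ ≤ 1} := measurableSet_le hg.norm measurable_const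
  refine ⟨{x | ‖g x‖ ≤ 1}.indicator g, hg.indicator hs, fun x => ?_, fun t ht => ?_⟩
  · by_cases hx : ‖g x‖ ≤ 1
    · rwa [Set.indicator_of_mem (by exact hx)]
    · rw [Set.indicator_of_notMem (by exact hx), norm_zero]; exact zero_le_one
  · have e : g (γ t) = ‖deriv γ t‖⁻¹ • deriv γ t := congrFun hgc ⟨t, ht⟩
    rw [Set.indicator_of_mem, e]
    rw [Set.mem_ofPred_eq, e, norm_smul, norm_inv, norm_norm]
    exact inv_mul_le_one

/-- A representation by a curve on test fields extends to bounded measurable fields. -/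
lemma Jpair_eq_curve_of_tests (hγ : LipschitzWith K γ) {σ : Measure (Ed 2)} {τ : Ed 2 → Ed 2}
    (h : IsPolarVM σ τ) {c : ℝ}
    (hrep : ∀ Φ : Ed 2 → Ed 2, Continuous Φ → HasCompactSupport Φ →
      Jpair σ τ Φ = c * ∫ t in (0:ℝ)..1, ⟪Φ (γ t), deriv γ t⟫)
    {Φ : Ed 2 → Ed 2} (hΦ : Measurable Φ) (hC : ∀ x, ‖Φ x‖ ≤ 1) :
    Jpair σ τ Φ = c * ∫ t in (0:ℝ)..1, ⟪Φ (γ t), deriv γ t⟫ := by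
  have := h.1
  set ρ : Measure (Ed 2) := (volume.restrict (Set.Ioc (0:ℝ) 1)).map γ with hρ
  refine eq_of_forall_abs_sub_le_mul (D := 1 + |c| * K) fun ε hε => ?_
  obtain ⟨Ψ, hΨc, hΨs, hΨ1, hΨ⟩ := exists_test_integral_norm_sub_le (σ + ρ) hΦ hC hε
  have hm := hΨc.measurable
  have e := hrep Ψ hΨc hΨs
  have b0 := (h.abs_Jpair_sub_le hΦ hm hC hΨ1).trans
    ((integral_norm_sub_mono (ν := σ + ρ) (Measure.le_add_right le_rfl) hΦ hm hC hΨ1).trans hΨ)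
  have b1 := (integral_norm_sub_mono (ν := σ + ρ) (Measure.le_add_left le_rfl) hΦ hm hC
    hΨ1).trans hΨ
  have hnm : Measurable fun x => ‖Ψ x - Φ x‖ := (hm.sub hΦ).norm
  rw [hρ, integral_map hγ.continuous.measurable.aemeasurable hnm.aestronglyMeasurable,
    ← intervalIntegral.integral_of_le zero_le_one] at b1
  have b2 : |(∫ t in (0:ℝ)..1, ⟪Ψ (γ t), deriv γ t⟫) - ∫ t in (0:ℝ)..1, ⟪Φ (γ t), deriv γ t⟫|
      ≤ K * ε := by
    rw [← intervalIntegral.integral_sub (intervalIntegrable_inner_deriv_of_measurable hγ hm hΨ1 _ _)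
      (intervalIntegrable_inner_deriv_of_measurable hγ hΦ hC _ _), ← Real.norm_eq_abs]
    refine (intervalIntegral.norm_integral_le_of_norm_le
      (g := fun t => K * ‖Ψ (γ t) - Φ (γ t)‖) zero_le_one (ae_of_all _ fun t _ => ?_) ?_).trans ?_
    · rw [← inner_sub_left, Real.norm_eq_abs, mul_comm]
      exact (abs_real_inner_le_norm _ _).trans
        (mul_le_mul_of_nonneg_left (hγ.norm_deriv_le t) (norm_nonneg _))
    · refine (intervalIntegrable_const (c := (K:ℝ) * 2)).mono_fun
        (((hm.sub hΦ).comp hγ.continuous.measurable).norm.const_mul _).aestronglyMeasurable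
        (ae_of_all _ fun t => ?_)
      simp only [norm_mul, norm_norm]
      have : ‖Ψ (γ t) - Φ (γ t)‖ ≤ ‖(2:ℝ)‖ := by
        rw [Real.norm_ofNat]
        linarith [norm_sub_le (Ψ (γ t)) (Φ (γ t)), hΨ1 (γ t), hC (γ t)]
      gcongr
    · rw [intervalIntegral.integral_const_mul]
      exact mul_le_mul_of_nonneg_left b1 K.2
  have e2 : Jpair σ τ Φ - c * ∫ t in (0:ℝ)..1, ⟪Φ (γ t), deriv γ t⟫ =
      -(Jpair σ τ Ψ - Jpair σ τ Φ) + c * ((∫ t in (0:ℝ)..1, ⟪Ψ (γ t), deriv γ t⟫) -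
        ∫ t in (0:ℝ)..1, ⟪Φ (γ t), deriv γ t⟫) := by rw [e]; ring
  rw [e2]
  refine (abs_add_le _ _).trans ?_
  rw [abs_neg, abs_mul]
  have := mul_le_mul_of_nonneg_left b2 (abs_nonneg c)
  linarith

/-- A divergence-free part of a simple loop dominated by it is the loop itself. -/
lemma simple_loop_dominated_eq (hγ : LipschitzWith K γ) (hinj : Set.InjOn γ (Set.Ico (0:ℝ) 1))
    (hcl : γ 0 = γ 1) {σ σ₁ : Measure (Ed 2)} {τ τ₁ g : Ed 2 → Ed 2} (h : IsPolarVM σ τ)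
    (h₁ : IsPolarVM σ₁ τ₁) (d₁ : DivFree σ₁ τ₁) {c : ℝ} (hc0 : c ≠ 0)
    (hrep : ∀ Φ : Ed 2 → Ed 2, Continuous Φ → HasCompactSupport Φ →
      Jpair σ τ Φ = c * ∫ t in (0:ℝ)..1, ⟪Φ (γ t), deriv γ t⟫)
    (hg : Measurable g) (hC : ∀ x, ‖g x‖ ≤ 1) (hgτ : ∀ᵐ x ∂σ, τ x = g x)
    (hgτ₁ : ∀ᵐ x ∂σ₁, τ₁ x = g x) (hm : σ.real Set.univ = 1) (hm₁ : σ₁.real Set.univ = 1)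
    {D : ℝ} (hD : 0 < D) (hle : σ₁ ≤ ENNReal.ofReal D • σ) {Φ : Ed 2 → Ed 2}
    (hΦ : Continuous Φ) (hΦs : HasCompactSupport Φ) :
    Jpair σ₁ τ₁ Φ = Jpair σ τ Φ := by
  have := h.1
  have := h₁.1
  obtain ⟨F, hF, hFD, hFi⟩ := exists_bounded_density hD.le hle
  have key : ∀ Ψ : Ed 2 → Ed 2, Measurable Ψ → ∀ B, (∀ x, ‖Ψ x‖ ≤ B) →
      Jpair σ₁ τ₁ Ψ = c * ∫ t in (0:ℝ)..1, F (γ t) * ⟪Ψ (γ t), deriv γ t⟫ := by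
    intro Ψ hΨ B hB
    have hB0 : 0 ≤ B := (norm_nonneg _).trans (hB 0)
    set M := D * (B + 1) with hM
    have hM0 : 0 < M := by positivity
    have e1 : Jpair σ₁ τ₁ Ψ = M * Jpair σ τ (fun x => (M⁻¹ * F x) • Ψ x) := by
      unfold Jpair
      have : ∫ x, ⟪Ψ x, τ₁ x⟫ ∂σ₁ = ∫ x, ⟪Ψ x, g x⟫ ∂σ₁ :=
        integral_congr_ae (by filter_upwards [hgτ₁] with x hx; rw [hx])
      rw [this, hFi, ← integral_const_mul]
      refine integral_congr_ae ?_
      filter_upwards [hgτ] with x hx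
      rw [hx, real_inner_smul_left]
      field_simp
    have hm' : Measurable fun x => (M⁻¹ * F x) • Ψ x := (hF.const_mul _).smul hΨ
    rw [e1, Jpair_eq_curve_of_tests hγ h hrep hm']
    · rw [mul_left_comm, ← intervalIntegral.integral_const_mul]
      congr 2 with t
      rw [real_inner_smul_left]
      field_simp
    · intro x
      rw [norm_smul, norm_mul, norm_inv, Real.norm_eq_abs, Real.norm_eq_abs, abs_of_pos hM0,
        mul_assoc, inv_mul_le_one₀ hM0, hM]
      exact mul_le_mul (hFD x) ((hB x).trans (by linarith)) (norm_nonneg _) hD.le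
  obtain ⟨k, hk⟩ := simple_loop_density_const hγ hinj hcl (G := fun t => F (γ t))
    (hF.comp hγ.continuous.measurable) (C := D) (fun t => hFD _) (fun φ hφ hφs => by
      have h1 : ContDiff ℝ 1 φ := hφ.of_le (by exact_mod_cast le_top)
      obtain ⟨B, -, hB⟩ := exists_norm_le_of_hasCompactSupport (continuous_gradient h1)
        (hasCompactSupport_gradient hφs)
      have h2 := key _ (continuous_gradient h1).measurable B hB
      rw [divFree_iff.1 d₁ φ hφ hφs] at h2
      simpa [inner_gradient_left, hc0] using h2.symm)
  have key2 : ∀ Ψ : Ed 2 → Ed 2, Measurable Ψ → (∀ x, ‖Ψ x‖ ≤ 1) →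
      Jpair σ₁ τ₁ Ψ = k * Jpair σ τ Ψ := by
    intro Ψ hΨ hB
    rw [key Ψ hΨ 1 hB, Jpair_eq_curve_of_tests hγ h hrep hΨ hB, mul_left_comm,
      ← intervalIntegral.integral_const_mul k]
    congr 1
    refine intervalIntegral.integral_congr_ae ?_
    filter_upwards [hk] with t ht htI
    rw [Set.uIoc_of_le zero_le_one] at htI
    rw [← real_inner_smul_right, ht ⟨htI.1.le, htI.2⟩, real_inner_smul_right]
  have hk1 : k = 1 := by
    have := key2 g hg hC
    have e1 := Jpair_indicator_of_ae_eq h hgτ MeasurableSet.univ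
    have e2 := Jpair_indicator_of_ae_eq h₁ hgτ₁ MeasurableSet.univ
    rw [Set.indicator_univ] at e1 e2
    rw [e1, e2, hm, hm₁] at this
    linarith
  obtain ⟨B, hB0, hB⟩ := exists_norm_le_of_hasCompactSupport hΦ hΦs
  have h3 := key2 (B⁻¹ • Φ) (hΦ.measurable.const_smul _) (fun x => by
    rw [Pi.smul_apply, norm_smul, norm_inv, Real.norm_eq_abs, abs_of_pos hB0, inv_mul_le_one₀ hB0]
    exact hB x)
  rw [Jpair_smul, Jpair_smul, hk1, one_mul] at h3
  exact mul_left_cancel₀ (inv_ne_zero hB0.ne') h3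

/-- The normalized current of a simple closed Lipschitz curve is extreme. -/
theorem simple_loop_isExtremeJ (hγ : LipschitzWith K γ)
    (hinj : Set.InjOn γ (Set.Ico (0:ℝ) 1)) (hcl : γ 0 = γ 1) {σ : Measure (Ed 2)}
    {τ : Ed 2 → Ed 2} (h : IsPolarVM σ τ)
    (hrep : ∀ Φ : Ed 2 → Ed 2, Continuous Φ → HasCompactSupport Φ → Jpair σ τ Φ =
      (∫ t in (0:ℝ)..1, ‖deriv γ t‖)⁻¹ * ∫ t in (0:ℝ)..1, ⟪Φ (γ t), deriv γ t⟫) :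
    IsExtremeJ σ τ := by
  have := h.1
  have hℓ := simple_loop_length_pos hγ hinj
  set ℓ := ∫ t in (0:ℝ)..1, ‖deriv γ t‖ with hℓdef
  have hle1 : σ.real Set.univ ≤ 1 := by
    refine h.real_univ_le fun Φ hΦ hΦs hΦ1 => ?_
    rw [hrep Φ hΦ hΦs, inv_mul_le_one₀ hℓ]
    exact (le_abs_self _).trans (abs_integral_inner_deriv_le hγ zero_le_one hΦ1)
  obtain ⟨g, hg, hC, hgγ⟩ := exists_direction_field hγ hinj
  have hJg : Jpair σ τ g = 1 := by
    rw [Jpair_eq_curve_of_tests hγ h hrep hg hC, inv_mul_eq_one₀ hℓ.ne', hℓdef]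
    refine intervalIntegral.integral_congr_ae ?_
    have : ∀ᵐ t : ℝ, t ≠ 1 := by
      simpa using (Set.countable_singleton (1:ℝ)).ae_notMem volume
    filter_upwards [this] with t ht1 ht
    rw [Set.uIoc_of_le zero_le_one] at ht
    rw [hgγ t ⟨ht.1.le, lt_of_le_of_ne ht.2 ht1⟩, real_inner_smul_left, real_inner_self_eq_norm_sq]
    by_cases h0 : ‖deriv γ t‖ = 0
    · simp [h0]
    · field_simp
  have hm : σ.real Set.univ = 1 := le_antisymm hle1 (hJg ▸ h.Jpair_le_real_univ hC)
  have hgτ : ∀ᵐ x ∂σ, τ x = g x := h.ae_eq_of_le_Jpair hg hC (by rw [hm, hJg])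
  have real_le : ∀ {ν : Measure (Ed 2)}, ν Set.univ ≤ 1 → ν.real Set.univ ≤ 1 := fun hν =>
    ENNReal.toReal_le_of_le_ofReal zero_le_one (by simpa using hν)
  refine ⟨⟨h, ?_, ?_⟩, ?_⟩
  · refine divFree_iff.2 fun φ hφ hφs => ?_
    have h1 : ContDiff ℝ 1 φ := hφ.of_le (by exact_mod_cast le_top)
    rw [hrep _ (continuous_gradient h1) (hasCompactSupport_gradient hφs)]
    simp only [inner_gradient_left]
    rw [hγ.integral_fderiv_deriv h1, hcl, sub_self, mul_zero]
  · rw [← ofReal_measureReal (μ := σ), hm, ENNReal.ofReal_one]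
  · intro σ₁ τ₁ σ₂ τ₂ m₁ m₂ t ht hadd Φ hΦ hΦs
    obtain ⟨a1, a2, a3⟩ := convex_decomposition h m₁.1 m₂.1 ht hg hC hgτ hm (real_le m₁.2.2)
      (real_le m₂.2.2) hadd
    obtain ⟨b1, b2, b3⟩ := convex_decomposition h m₂.1 m₁.1 (t := 1 - t)
      ⟨sub_pos.2 ht.2, by linarith [ht.1]⟩ hg hC hgτ hm (real_le m₂.2.2)
      (real_le m₁.2.2) (fun Ψ h1 h2 => by rw [hadd Ψ h1 h2]; ring)
    exact ⟨simple_loop_dominated_eq hγ hinj hcl h m₁.1 m₁.2.1 (inv_ne_zero hℓ.ne') hrep hg hC hgτ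
        a1 hm a2 (inv_pos.2 (sub_pos.2 ht.2)) a3 hΦ hΦs,
      simple_loop_dominated_eq hγ hinj hcl h m₂.1 m₂.2.1 (inv_ne_zero hℓ.ne') hrep hg hC hgτ
        b1 hm b2 (by rw [sub_sub_cancel]; exact inv_pos.2 ht.1) b3 hΦ hΦs⟩

end SimpleLoopExtreme

section Polygons

/-- The line integral of `Φ` along the segment from `p` to `q`. -/
def segInt (Φ : Ed 2 → Ed 2) (p q : Ed 2) : ℝ :=
  ∫ s in (0:ℝ)..1, ⟪Φ (p + s • (q - p)), q - p⟫

/-- `s` is the total cost of some path of `m` steps from `p` to `q`. -/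
def PathCost (κ : Ed 2 → Ed 2 → ℝ) (m : ℕ) (p q : Ed 2) (s : ℝ) : Prop :=
  ∃ v : ℕ → Ed 2, v 0 = p ∧ v m = q ∧ ∑ i ∈ Finset.range m, κ (v i) (v (i + 1)) = s

/-- The closed polygon with vertices `v 0, …, v n = v 0` is simple. -/
def SimplePoly (n : ℕ) (v : ℕ → Ed 2) : Prop :=
  v n = v 0 ∧ (∀ i < n, v i ≠ v (i + 1)) ∧ ∀ i j, i < j → j < n →
    ∀ p ∈ segment ℝ (v i) (v (i + 1)), p ∈ segment ℝ (v j) (v (j + 1)) →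
      (j = i + 1 ∧ p = v j) ∨ (i = 0 ∧ j + 1 = n ∧ p = v 0)

lemma segInt_split {Φ : Ed 2 → Ed 2} (hΦ : Continuous Φ) {p q z : Ed 2}
    (hz : z ∈ segment ℝ p q) : segInt Φ p z + segInt Φ z q = segInt Φ p q := by
  rw [segment_eq_image'] at hz
  obtain ⟨a, -, rfl⟩ := hz
  set f : ℝ → ℝ := fun s => ⟪Φ (p + s • (q - p)), q - p⟫ with hf
  have hfc : Continuous f := by fun_prop
  have h1 : segInt Φ p (p + a • (q - p)) = ∫ s in (0:ℝ)..a, f s := by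
    have := intervalIntegral.smul_integral_comp_mul_left (a := 0) (b := 1) f a
    rw [mul_zero, mul_one, smul_eq_mul, ← intervalIntegral.integral_const_mul] at this
    rw [← this]
    refine intervalIntegral.integral_congr fun s _ => ?_
    simp only [hf, add_sub_cancel_left, real_inner_smul_right, smul_smul, mul_comm]
  have h2 : segInt Φ (p + a • (q - p)) q = ∫ s in a..1, f s := by
    have := intervalIntegral.smul_integral_comp_mul_add (a := 0) (b := 1) f (1 - a) a
    rw [mul_zero, mul_one, zero_add, sub_add_cancel, smul_eq_mul,
      ← intervalIntegral.integral_const_mul] at this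
    rw [← this]
    refine intervalIntegral.integral_congr fun s _ => ?_
    have e : q - (p + a • (q - p)) = (1 - a) • (q - p) := by module
    have e2 : p + a • (q - p) + s • ((1 - a) • (q - p)) = p + ((1 - a) * s + a) • (q - p) := by
      module
    simp only [hf, e, e2, real_inner_smul_right]
  rw [h1, h2, intervalIntegral.integral_add_adjacent_intervals (hfc.intervalIntegrable _ _)
    (hfc.intervalIntegrable _ _)]
  rfl

lemma segInt_symm (Φ : Ed 2 → Ed 2) (p q : Ed 2) : segInt Φ q p = -segInt Φ p q := by
  have := intervalIntegral.integral_comp_sub_left (a := 0) (b := 1)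
    (fun s => ⟪Φ (p + s • (q - p)), q - p⟫) 1
  rw [sub_self, sub_zero] at this
  unfold segInt
  rw [← this, ← intervalIntegral.integral_neg]
  refine intervalIntegral.integral_congr fun s _ => ?_
  have e : p + (1 - s) • (q - p) = q + s • (p - q) := by module
  simp only [e]
  rw [← inner_neg_right, neg_sub]

lemma abs_segInt_le {Φ : Ed 2 → Ed 2} {C : ℝ} (hC : ∀ x, ‖Φ x‖ ≤ C) (p q : Ed 2) :
    |segInt Φ p q| ≤ C * dist p q := by
  have := intervalIntegral.norm_integral_le_of_norm_le_const (a := 0) (b := 1)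
    (f := fun s => ⟪Φ (p + s • (q - p)), q - p⟫) (C := C * dist p q) fun s _ => by
      rw [dist_comm, dist_eq_norm, Real.norm_eq_abs]
      exact (abs_real_inner_le_norm _ _).trans
        (mul_le_mul_of_nonneg_right (hC _) (norm_nonneg _))
  simpa [segInt] using this

lemma PathCost.trans {κ : Ed 2 → Ed 2 → ℝ} {m m' : ℕ} {p q r : Ed 2} {s s' : ℝ}
    (h : PathCost κ m p q s) (h' : PathCost κ m' q r s') :
    PathCost κ (m + m') p r (s + s') := by
  obtain ⟨v, v0, vm, vs⟩ := h
  obtain ⟨w, w0, wm, ws⟩ := h'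
  refine ⟨fun i => if i ≤ m then v i else w (i - m), by simp [v0], ?_, ?_⟩
  · rcases Nat.eq_zero_or_pos m' with rfl | h
    · simp only [add_zero, le_refl, if_true]
      rw [vm, ← wm, w0]
    · beta_reduce
      rw [if_neg (by omega : ¬ m + m' ≤ m), Nat.add_sub_cancel_left, wm]
  · rw [Finset.sum_range_add, ← vs, ← ws]
    congr 1
    · refine Finset.sum_congr rfl fun i hi => ?_
      rw [Finset.mem_range] at hi
      beta_reduce
      rw [if_pos hi.le, if_pos (by omega : i + 1 ≤ m)]
    · refine Finset.sum_congr rfl fun i hi => ?_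
      beta_reduce
      rw [if_neg (by omega : ¬ m + i + 1 ≤ m), show m + i + 1 - m = i + 1 by omega]
      rcases Nat.eq_zero_or_pos i with rfl | h
      · simp [vm, w0]
      · rw [if_neg (by omega), Nat.add_sub_cancel_left]

lemma PathCost.single (κ : Ed 2 → Ed 2 → ℝ) (p q : Ed 2) : PathCost κ 1 p q (κ p q) :=
  ⟨fun i => if i = 0 then p else q, by simp, by simp, by simp⟩

lemma PathCost.sub_path (κ : Ed 2 → Ed 2 → ℝ) (v : ℕ → Ed 2) {a b : ℕ} (hab : a ≤ b) :
    PathCost κ (b - a) (v a) (v b) (∑ i ∈ Finset.Ico a b, κ (v i) (v (i + 1))) :=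
  ⟨fun i => v (a + i), by simp, by simp [Nat.add_sub_cancel' hab], by
    rw [Finset.sum_Ico_eq_sum_range]; rfl⟩

lemma segment_overlap {a b c p : Ed 2} (h1 : p ∈ segment ℝ a b) (h2 : p ∈ segment ℝ b c)
    (hp : p ≠ b) : c ∈ segment ℝ a b ∨ a ∈ segment ℝ b c := by
  rw [segment_symm, segment_eq_image'] at h1
  rw [segment_eq_image'] at h2
  obtain ⟨s, hs, rfl⟩ := h1
  obtain ⟨t, ht, hst⟩ := h2
  have hs0 : 0 < s := lt_of_le_of_ne hs.1 fun h => hp (by simp [← h])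
  have hst' : t • (c - b) = s • (a - b) := add_left_cancel hst
  have ht0 : 0 < t := by
    refine lt_of_le_of_ne ht.1 fun h => hp ?_
    change b + s • (a - b) = b
    rw [← hst', ← h]; simp
  rcases le_total s t with h | h
  · left
    rw [segment_symm, segment_eq_image']
    refine ⟨s / t, ⟨by positivity, (div_le_one ht0).2 h⟩, ?_⟩
    have : c - b = (s / t) • (a - b) := by
      rw [div_eq_inv_mul, mul_smul, ← hst', smul_smul, inv_mul_cancel₀ ht0.ne', one_smul]
    simp only [← this, add_sub_cancel]
  · right
    rw [segment_eq_image']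
    refine ⟨t / s, ⟨by positivity, (div_le_one hs0).2 h⟩, ?_⟩
    have : a - b = (t / s) • (c - b) := by
      rw [div_eq_inv_mul, mul_smul, hst', smul_smul, inv_mul_cancel₀ hs0.ne', one_smul]
    simp only [← this, add_sub_cancel]

lemma cost_overlap_le {κ : Ed 2 → Ed 2 → ℝ}
    (hsplit : ∀ p q z, z ∈ segment ℝ p q → κ p z + κ z q = κ p q)
    (hnn : ∀ p q, 0 ≤ κ p q + κ q p) {a b c p : Ed 2} (h1 : p ∈ segment ℝ a b)
    (h2 : p ∈ segment ℝ b c) (hp : p ≠ b) : κ a c ≤ κ a b + κ b c := by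
  rcases segment_overlap h1 h2 hp with h | h
  · linarith [hsplit _ _ _ h, hnn c b]
  · linarith [hsplit _ _ _ h, hnn a b]

/-- A closed polygon of negative cost with the least number of vertices is simple. -/
lemma exists_simplePoly_of_neg {κ : Ed 2 → Ed 2 → ℝ}
    (hsplit : ∀ p q z, z ∈ segment ℝ p q → κ p z + κ z q = κ p q)
    (hnn : ∀ p q, 0 ≤ κ p q + κ q p) {m : ℕ} {p₀ : Ed 2} {s₀ : ℝ} (h : PathCost κ m p₀ p₀ s₀)
    (hs₀ : s₀ < 0) :
    ∃ n v, SimplePoly n v ∧ ∑ i ∈ Finset.range n, κ (v i) (v (i + 1)) < 0 := by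
  classical
  have hex : ∃ n, ∃ p s, PathCost κ n p p s ∧ s < 0 := ⟨m, p₀, s₀, h, hs₀⟩
  obtain ⟨p, s, ⟨v, v0, vn, vs⟩, hs⟩ := Nat.find_spec hex
  have hmin : ∀ k < Nat.find hex, ∀ q r, PathCost κ k q q r → 0 ≤ r := by
    intro k hk q r hr
    by_contra hneg
    exact Nat.find_min hex hk ⟨q, r, hr, not_le.1 hneg⟩
  generalize Nat.find hex = n at *
  have hcl : v n = v 0 := vn.trans v0.symm
  have hself : ∀ q, κ q q = 0 := fun q => by
    have := hsplit q q q (left_mem_segment ℝ q q); linarith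
  set f : ℕ → ℝ := fun i => κ (v i) (v (i + 1)) with hf
  have hIco : ∀ a b c, a ≤ b → b ≤ c →
      ∑ i ∈ Finset.Ico a b, f i + ∑ i ∈ Finset.Ico b c, f i = ∑ i ∈ Finset.Ico a c, f i :=
    fun a b c h1 h2 => Finset.sum_Ico_consecutive _ h1 h2
  have hone : ∀ a, ∑ i ∈ Finset.Ico a (a + 1), f i = f a := fun a => by simp
  have htot : ∑ i ∈ Finset.Ico 0 n, f i = s := by rw [← vs, Finset.range_eq_Ico]
  refine ⟨n, v, ⟨hcl, fun i hi heq => ?_, fun i j hij hj p hpi hpj => ?_⟩, by rw [vs]; exact hs⟩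
  · have h1 := (PathCost.sub_path κ v (Nat.zero_le i))
    have h2 := (PathCost.sub_path κ v (Nat.succ_le_of_lt hi))
    rw [hcl] at h2
    rw [heq] at h1
    have h3 := hmin _ (by omega) _ _ (h1.trans h2)
    have h4 : f i = 0 := by simp only [hf, ← heq, hself]
    have h5 := hIco 0 i (i + 1) (by omega) (by omega)
    have h6 := hIco 0 (i + 1) n (by omega) (by omega)
    rw [hone] at h5
    simp only [← hf] at h3
    change 0 ≤ ∑ i ∈ Finset.Ico 0 i, f i + ∑ i ∈ Finset.Ico (i + 1) n, f i at h3
    linarith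
  · have A := PathCost.sub_path κ v (Nat.zero_le i)
    have B := PathCost.sub_path κ v (Nat.succ_le_of_lt hij)
    have D := PathCost.sub_path κ v (Nat.succ_le_of_lt hj)
    change PathCost κ _ _ _ (∑ i ∈ Finset.Ico 0 i, f i) at A
    change PathCost κ _ _ _ (∑ i ∈ Finset.Ico (i + 1) j, f i) at B
    change PathCost κ _ _ _ (∑ i ∈ Finset.Ico (j + 1) n, f i) at D
    have e1 := hIco 0 i (i + 1) (by omega) (by omega)
    have e2 := hIco 0 (i + 1) j (by omega) (by omega)
    have e3 := hIco 0 j (j + 1) (by omega) (by omega)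
    have e4 := hIco 0 (j + 1) n (by omega) (by omega)
    rw [hone] at e1 e3
    by_cases hadj : j = i + 1
    · left
      refine ⟨hadj, ?_⟩
      by_contra hp
      subst hadj
      have hle := cost_overlap_le hsplit hnn hpi hpj hp
      rw [hcl] at D
      have := hmin _ (by omega) _ _ ((A.trans (PathCost.single κ _ _)).trans D)
      have e5 : ∑ k ∈ Finset.Ico (i + 1) (i + 1), f k = 0 := by simp
      have e6 : f i = κ (v i) (v (i + 1)) := rfl
      have e7 : f (i + 1) = κ (v (i + 1)) (v (i + 1 + 1)) := rfl
      linarith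
    by_cases hwrap : i = 0 ∧ j + 1 = n
    · right
      refine ⟨hwrap.1, hwrap.2, ?_⟩
      obtain ⟨rfl, rfl⟩ := hwrap
      by_contra hp
      rw [hcl] at hpj
      have hle := cost_overlap_le hsplit hnn hpj hpi hp
      have := hmin _ (by omega) _ _ (B.trans (PathCost.single κ _ _))
      have e5 : ∑ k ∈ Finset.Ico 0 0, f k = 0 := by simp
      have e8 : ∑ k ∈ Finset.Ico (j + 1) (j + 1), f k = 0 := by simp
      have e6 : f 0 = κ (v 0) (v (0 + 1)) := rfl
      have e7 : f j = κ (v j) (v 0) := by simp only [hf, hcl]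
      simp only [zero_add] at *
      linarith
    · exfalso
      have P1 := hmin _ (by omega) _ _
        (((PathCost.single κ p _).trans B).trans (PathCost.single κ _ p))
      rw [hcl] at D
      have P2 := hmin _ (by omega) _ _ (((A.trans (PathCost.single κ _ p)).trans
        (PathCost.single κ p _)).trans D)
      have e5 : f i = κ (v i) (v (i + 1)) := rfl
      have e6 : f j = κ (v j) (v (j + 1)) := rfl
      have := hsplit _ _ _ hpi
      have := hsplit _ _ _ hpj
      linarith

end Polygons

section Potential

lemma DivFree.integral_fderiv_of_lipschitz {σ : Measure (Ed 2)} {τ : Ed 2 → Ed 2}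
    (h : IsPolarVM σ τ) (hd : DivFree σ τ) {ψ : Ed 2 → ℝ} (hψ : ContDiff ℝ (⊤ : ℕ∞) ψ) {K : ℝ≥0}
    (hK : LipschitzWith K ψ) : ∫ x, fderiv ℝ ψ x (τ x) ∂σ = 0 := by
  have := h.1
  let χ : ContDiffBump (0 : Ed 2) := ⟨1, 2, one_pos, one_lt_two⟩
  have hχ : ContDiff ℝ (⊤ : ℕ∞) χ := χ.contDiff
  have hχd : Differentiable ℝ χ := hχ.differentiable (by simp)
  obtain ⟨D, hD0, hD⟩ : ∃ D, 0 < D ∧ ∀ y, ‖y‖ * ‖fderiv ℝ χ y‖ ≤ D := by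
    have hc : Continuous fun y => ‖y‖ * ‖fderiv ℝ χ y‖ :=
      continuous_norm.mul (hχ.continuous_fderiv (by simp)).norm
    have hs : HasCompactSupport fun y => ‖y‖ * ‖fderiv ℝ χ y‖ :=
      (χ.hasCompactSupport.fderiv ℝ).norm.mul_left
    obtain ⟨D, hD⟩ := hs.exists_bound_of_continuous hc
    exact ⟨|D| + 1, by positivity, fun y =>
      ((le_abs_self _).trans (hD y)).trans ((le_abs_self D).trans (by linarith))⟩
  set g : Ed 2 → ℝ := fun x => ψ x - ψ 0 with hg
  have hgs : ContDiff ℝ (⊤ : ℕ∞) g := hψ.sub contDiff_const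
  have hgd : Differentiable ℝ g := hgs.differentiable (by simp)
  have hfg : ∀ x, fderiv ℝ g x = fderiv ℝ ψ x := fun x => fderiv_sub_const _
  have hgb : ∀ x, |g x| ≤ K * ‖x‖ := fun x => by
    have := hK.dist_le_mul x 0
    rwa [dist_zero_right, Real.dist_eq] at this
  set u : ℕ → Ed 2 → ℝ := fun n x => χ ((n + 1 : ℝ)⁻¹ • x) with hu
  have hus : ∀ n, ContDiff ℝ (⊤ : ℕ∞) (u n) := fun n => hχ.comp (contDiff_const_smul _)
  have hud : ∀ n x, fderiv ℝ (u n) x = (n + 1 : ℝ)⁻¹ • fderiv ℝ χ ((n + 1 : ℝ)⁻¹ • x) := by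
    intro n x
    exact fderiv_comp_smul _
  have huc : ∀ n, HasCompactSupport (u n) := fun n =>
    χ.hasCompactSupport.comp_homeomorph (Homeomorph.smulOfNeZero (n + 1 : ℝ)⁻¹ (by positivity))
  have hzero : ∀ n, ∫ x, fderiv ℝ (fun x => u n x * g x) x (τ x) ∂σ = 0 := fun n =>
    hd _ ((hus n).mul hgs) (huc n).mul_right
  have hlim : Tendsto (fun n : ℕ => ∫ x, fderiv ℝ (fun x => u n x * g x) x (τ x) ∂σ) atTop
      (nhds (∫ x, fderiv ℝ ψ x (τ x) ∂σ)) := by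
    refine tendsto_integral_of_dominated_convergence (fun _ => K + K * D) (fun n => ?_)
      (integrable_const _) (fun n => ?_) (ae_of_all _ fun x => ?_)
    · have hc := (((hus n).mul hgs).continuous_fderiv (by simp)).measurable
      exact (isBoundedBilinearMap_apply.continuous.measurable.comp
        (hc.prodMk h.2.1)).aestronglyMeasurable
    · filter_upwards [h.2.2] with x hx
      refine (ContinuousLinearMap.le_opNorm _ _).trans ?_
      rw [hx, mul_one, fderiv_fun_mul ((hus n).differentiable (by simp) x) (hgd x), hfg]
      refine (norm_add_le _ _).trans (add_le_add ?_ ?_)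
      · rw [norm_smul]
        have h1 : ‖u n x‖ ≤ 1 := by
          rw [Real.norm_eq_abs, abs_of_nonneg χ.nonneg]; exact χ.le_one
        calc _ ≤ 1 * (K : ℝ) := mul_le_mul h1 (norm_fderiv_le_of_lipschitz ℝ hK)
              (norm_nonneg _) zero_le_one
          _ = K := one_mul _
      · rw [norm_smul, hud, norm_smul]
        have hn : 0 < (n + 1 : ℝ)⁻¹ := by positivity
        have h2 := hD ((n + 1 : ℝ)⁻¹ • x)
        rw [norm_smul] at h2
        calc _ ≤ (K * ‖x‖) * (‖(n + 1 : ℝ)⁻¹‖ * ‖fderiv ℝ χ ((n + 1 : ℝ)⁻¹ • x)‖) :=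
              mul_le_mul_of_nonneg_right (hgb x) (by positivity)
          _ = K * (‖(n + 1 : ℝ)⁻¹‖ * ‖x‖ * ‖fderiv ℝ χ ((n + 1 : ℝ)⁻¹ • x)‖) := by ring
          _ ≤ K * D := mul_le_mul_of_nonneg_left h2 K.2
    · refine tendsto_const_nhds.congr' ?_
      obtain ⟨N, hN⟩ := exists_nat_gt ‖x‖
      filter_upwards [eventually_ge_atTop N] with n hn
      have hev : (fun x => u n x * g x) =ᶠ[nhds x] g := by
        have hlt : ‖x‖ < n + 1 := by
          have : (N : ℝ) ≤ n := by exact_mod_cast hn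
          linarith
        filter_upwards [continuous_norm.continuousAt.eventually (gt_mem_nhds hlt)] with y hy
        have : u n y = 1 := χ.one_of_mem_closedBall (by
          rw [mem_closedBall_zero_iff, norm_smul, Real.norm_eq_abs, abs_of_pos (by positivity),
            inv_mul_le_iff₀ (by positivity)]
          change ‖y‖ ≤ (n + 1) * 1
          linarith)
        rw [this, one_mul]
      rw [hev.fderiv_eq, hfg]
  simp only [hzero] at hlim
  exact (tendsto_nhds_unique hlim tendsto_const_nhds)

lemma exists_potential {Φ : Ed 2 → Ed 2} {c : ℝ}
    (hcl : ∀ m p s, PathCost (fun p q => c * dist p q - segInt Φ p q) m p p s → 0 ≤ s) :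
    ∃ ψ : Ed 2 → ℝ, ∀ x y, segInt Φ x y - c * dist x y ≤ ψ y - ψ x := by
  set κ : Ed 2 → Ed 2 → ℝ := fun p q => c * dist p q - segInt Φ p q with hκ
  have hbdd : ∀ x, BddBelow {s | ∃ m, PathCost κ m 0 x s} := by
    refine fun x => ⟨-κ x 0, ?_⟩
    rintro s ⟨m, hs⟩
    linarith [hcl _ _ _ (hs.trans (PathCost.single κ x 0))]
  have hne : ∀ x, {s | ∃ m, PathCost κ m 0 x s}.Nonempty := fun x =>
    ⟨_, 1, PathCost.single κ 0 x⟩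
  refine ⟨fun x => -sInf {s | ∃ m, PathCost κ m 0 x s}, fun x y => ?_⟩
  have : sInf {s | ∃ m, PathCost κ m 0 y s} - κ x y ≤ sInf {s | ∃ m, PathCost κ m 0 x s} := by
    refine le_csInf (hne x) ?_
    rintro s ⟨m, hs⟩
    linarith [csInf_le (hbdd y) ⟨_, hs.trans (PathCost.single κ x y)⟩]
  simp only [hκ] at this ⊢
  linarith

lemma segInt_sub_le {Φ : Ed 2 → Ed 2} (hΦ : Continuous Φ) {ω : ℝ} {t : Ed 2}
    (hω : ∀ x, ‖Φ x - Φ (x - t)‖ ≤ ω) (x y : Ed 2) :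
    segInt Φ x y - ω * dist x y ≤ segInt Φ (x - t) (y - t) := by
  have h2 : ∀ z, |segInt (fun x => Φ x - Φ (x - t)) x z| ≤ ω * dist x z := fun z =>
    abs_segInt_le hω x z
  have h3 : segInt (fun x => Φ x - Φ (x - t)) x y = segInt Φ x y - segInt Φ (x - t) (y - t) := by
    unfold segInt
    rw [← intervalIntegral.integral_sub]
    · refine intervalIntegral.integral_congr fun s _ => ?_
      have e : x + s • (y - x) - t = x - t + s • (y - x) := by abel
      simp only [inner_sub_left, sub_sub_sub_cancel_right, e]
    · exact Continuous.intervalIntegrable (by fun_prop) _ _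
    · exact Continuous.intervalIntegrable (by fun_prop) _ _
  linarith [h3 ▸ (abs_le.1 (h2 y)).2]

lemma inner_le_fderiv_of_segInt_le {Φ : Ed 2 → Ed 2} (hΦ : Continuous Φ) {c : ℝ} {ψ : Ed 2 → ℝ}
    (hψ : ∀ x y, segInt Φ x y - c * dist x y ≤ ψ y - ψ x) {x : Ed 2}
    (hd : DifferentiableAt ℝ ψ x) (v : Ed 2) :
    ⟪Φ x, v⟫ - c * ‖v‖ ≤ fderiv ℝ ψ x v := by
  have h1 : Tendsto (fun t : ℝ => t⁻¹ • (ψ (x + t • v) - ψ x)) (nhdsWithin 0 (Set.Ioi 0))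
      (nhds (fderiv ℝ ψ x v)) := by
    have := (hd.hasFDerivAt.hasLineDerivAt v).tendsto_slope_zero_right
    simpa using this
  have h2 : Tendsto (fun t : ℝ => (∫ s in (0:ℝ)..1, ⟪Φ (x + s • (t • v)), v⟫) - c * ‖v‖)
      (nhdsWithin 0 (Set.Ioi 0)) (nhds (⟪Φ x, v⟫ - c * ‖v‖)) := by
    refine (Tendsto.sub_const ?_ _).mono_left nhdsWithin_le_nhds
    have hc : Continuous fun t : ℝ => ∫ s in (0:ℝ)..1, ⟪Φ (x + s • (t • v)), v⟫ :=
      intervalIntegral.continuous_parametric_intervalIntegral_of_continuous' (by fun_prop) 0 1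
    simpa using hc.tendsto 0
  refine le_of_tendsto_of_tendsto h2 h1 ?_
  filter_upwards [self_mem_nhdsWithin] with t ht
  rw [Set.mem_Ioi] at ht
  have h3 := hψ x (x + t • v)
  have h4 : segInt Φ x (x + t • v) = t * ∫ s in (0:ℝ)..1, ⟪Φ (x + s • (t • v)), v⟫ := by
    unfold segInt
    simp only [add_sub_cancel_left, real_inner_smul_right]
    rw [intervalIntegral.integral_const_mul]
  rw [h4, dist_self_add_right, norm_smul, Real.norm_eq_abs, abs_of_pos ht] at h3
  rw [smul_eq_mul, ← mul_le_mul_iff_right₀ ht, mul_inv_cancel_left₀ ht.ne']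
  linarith

/-- Duality: a field whose closed path integrals are bounded by `c` times the length of the path
pairs with divergence-free measures of mass at most one to at most `c`. -/
lemma memJball.Jpair_le_of_path_cost_nonneg {σ : Measure (Ed 2)} {τ : Ed 2 → Ed 2}
    (h : memJball σ τ) {Φ : Ed 2 → Ed 2} (hΦ : Continuous Φ) (hs : HasCompactSupport Φ) {c : ℝ}
    (hc : 0 ≤ c)
    (hcl : ∀ m p s, PathCost (fun p q => c * dist p q - segInt Φ p q) m p p s → 0 ≤ s) :
    Jpair σ τ Φ ≤ c := by
  have := h.1.1
  obtain ⟨C, hC0, hC⟩ := exists_norm_le_of_hasCompactSupport hΦ hs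
  obtain ⟨ψ, hψ⟩ := exists_potential hcl
  have hL : LipschitzWith ⟨C + c, by positivity⟩ ψ := by
    refine LipschitzWith.of_dist_le_mul fun x y => ?_
    rw [Real.dist_eq, abs_le]
    change -((C + c) * dist x y) ≤ _ ∧ _ ≤ (C + c) * dist x y
    have h1 := hψ x y
    have h2 := hψ y x
    have h3 := abs_le.1 (abs_segInt_le hC x y)
    have h4 := abs_le.1 (abs_segInt_le hC y x)
    rw [dist_comm y x] at *
    constructor <;> linarith
  have hψc := hL.continuous
  refine le_of_forall_pos_le_add fun ω hω => ?_
  obtain ⟨δ, hδ, hδω⟩ := Metric.uniformContinuous_iff.1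
    (hs.uniformContinuous_of_continuous hΦ) ω hω
  let ρ : ContDiffBump (0 : Ed 2) := ⟨δ / 2, δ, by positivity, by linarith⟩
  set r : Ed 2 → ℝ := ρ.normed volume with hr
  have hrc : HasCompactSupport r := ρ.hasCompactSupport_normed
  have hrs : ContDiff ℝ (⊤ : ℕ∞) r := ρ.contDiff_normed
  have hint : ∀ f : Ed 2 → ℝ, Continuous f → Integrable fun t => r t * f t := fun f hf =>
    (hrs.continuous.mul hf).integrable_of_hasCompactSupport hrc.mul_right
  set χ : Ed 2 → ℝ := convolution r ψ (ContinuousLinearMap.lsmul ℝ ℝ) volume with hχ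
  have hχe : ∀ x, χ x = ∫ t, r t * ψ (x - t) := fun x => rfl
  have hχs : ContDiff ℝ (⊤ : ℕ∞) χ :=
    hrc.contDiff_convolution_left _ hrs hψc.locallyIntegrable
  have hone : ∫ t, r t = 1 := ρ.integral_normed
  have hsub : ∀ x y, χ y - χ x = ∫ t, r t * (ψ (y - t) - ψ (x - t)) := fun x y => by
    rw [hχe, hχe, ← integral_sub (hint _ (by fun_prop)) (hint _ (by fun_prop))]
    simp only [mul_sub]
  have hr0 : ∀ t, 0 ≤ r t := fun t => ρ.nonneg_normed t
  have hχL : LipschitzWith ⟨C + c, by positivity⟩ χ := by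
    refine LipschitzWith.of_dist_le_mul fun y x => ?_
    rw [Real.dist_eq, hsub, ← Real.norm_eq_abs]
    refine (norm_integral_le_of_norm_le ((hint (fun _ => (C + c) * dist y x) continuous_const))
      (ae_of_all _ fun t => ?_)).trans ?_
    · rw [norm_mul, Real.norm_eq_abs, abs_of_nonneg (hr0 t)]
      refine mul_le_mul_of_nonneg_left ?_ (hr0 t)
      have := hL.dist_le_mul (y - t) (x - t)
      rwa [dist_sub_right] at this
    · rw [integral_mul_const, hone, one_mul]; rfl
  have hχψ : ∀ x y, segInt Φ x y - (c + ω) * dist x y ≤ χ y - χ x := by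
    intro x y
    rw [hsub]
    calc _ = ∫ t, r t * (segInt Φ x y - (c + ω) * dist x y) := by
          rw [integral_mul_const, hone, one_mul]
      _ ≤ _ := by
          refine integral_mono (hint _ continuous_const) (hint _ (by fun_prop)) fun t => ?_
          by_cases ht : t ∈ Function.support r
          · refine mul_le_mul_of_nonneg_left ?_ (hr0 t)
            rw [hr, ρ.support_normed_eq, mem_ball_zero_iff] at ht
            have h1 := segInt_sub_le hΦ (t := t) (ω := ω) (fun x => by
              rw [← dist_eq_norm]
              exact (hδω (by rw [dist_eq_norm]; simpa using ht)).le) x y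
            have h2 := hψ (x - t) (y - t)
            rw [dist_sub_right] at h2
            linarith
          · rw [Function.mem_support, not_not] at ht
            simp only [ht, zero_mul, le_refl]
  have hz := DivFree.integral_fderiv_of_lipschitz h.1 h.2.1 hχs hχL
  have hI : Integrable (fun x => fderiv ℝ χ x (τ x)) σ := by
    refine Integrable.of_bound (C := C + c) ?_ ?_
    · exact (isBoundedBilinearMap_apply.continuous.measurable.comp
        ((hχs.continuous_fderiv (by simp)).measurable.prodMk h.1.2.1)).aestronglyMeasurable
    · filter_upwards [h.1.2.2] with x hx
      refine (ContinuousLinearMap.le_opNorm _ _).trans ?_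
      rw [hx, mul_one]
      exact norm_fderiv_le_of_lipschitz ℝ hχL
  calc Jpair σ τ Φ ≤ ∫ x, (fderiv ℝ χ x (τ x) + (c + ω)) ∂σ := by
        refine integral_mono_ae (h.1.integrable_inner hΦ.measurable hC)
          (hI.add (integrable_const _)) ?_
        filter_upwards [h.1.2.2] with x hx
        have := inner_le_fderiv_of_segInt_le hΦ hχψ (hχs.differentiable (by simp) x) (τ x)
        rw [hx, mul_one] at this
        linarith
    _ = (c + ω) * σ.real Set.univ := by
        rw [integral_add hI (integrable_const _), hz, integral_const, smul_eq_mul]; ring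
    _ ≤ (c + ω) * 1 := by
        refine mul_le_mul_of_nonneg_left ?_ (by positivity)
        exact ENNReal.toReal_mono ENNReal.one_ne_top h.2.2
    _ = c + ω := mul_one _

end Potential

section Winding

/-- A simple closed polygon with vertices `(x i, y i)` and without vertical edges. -/
structure GraphPoly (n : ℕ) (x y : ℕ → ℝ) : Prop where
  closed_x : x n = x 0
  closed_y : y n = y 0
  ne : ∀ i < n, x i ≠ x (i + 1)
  simple : ∀ i j, i < j → j < n → ∀ t ∈ Set.uIcc (x i) (x (i + 1)),
    t ∈ Set.uIcc (x j) (x (j + 1)) →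
    y i + (t - x i) / (x (i + 1) - x i) * (y (i + 1) - y i) =
      y j + (t - x j) / (x (j + 1) - x j) * (y (j + 1) - y j) →
    (j = i + 1 ∧ t = x j) ∨ (i = 0 ∧ j + 1 = n ∧ t = x 0)

/-- The height of the line through the vertices `i` and `i + 1` over the abscissa `t`. -/
def edgeHeight (x y : ℕ → ℝ) (i : ℕ) (t : ℝ) : ℝ :=
  y i + (t - x i) / (x (i + 1) - x i) * (y (i + 1) - y i)

/-- The direction of the `i`-th edge. -/
def edgeSign (x : ℕ → ℝ) (i : ℕ) : ℝ := if x i < x (i + 1) then 1 else -1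

/-- The half-open abscissa range of the `i`-th edge, containing its left endpoint if `b`. -/
def edgeCovers (x : ℕ → ℝ) (b : Bool) (i : ℕ) (t : ℝ) : Prop :=
  if b then x i ≤ t ∧ t < x (i + 1) ∨ x (i + 1) ≤ t ∧ t < x i
  else x i < t ∧ t ≤ x (i + 1) ∨ x (i + 1) < t ∧ t ≤ x i

open Classical in
/-- The signed number of edges below the point `(t, z)`. -/
def edgesBelow (n : ℕ) (x y : ℕ → ℝ) (b : Bool) (t z : ℝ) : ℝ :=
  ∑ j ∈ Finset.range n,
    if edgeCovers x b j t ∧ edgeHeight x y j t < z then edgeSign x j else 0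

/-- One-sided punctured neighbourhoods, on the right if `b`. -/
def sideNhds (b : Bool) (a : ℝ) : Filter ℝ :=
  if b then nhdsWithin a (Set.Ioi a) else nhdsWithin a (Set.Iio a)

instance (b : Bool) (a : ℝ) : (sideNhds b a).NeBot := by
  unfold sideNhds; split_ifs <;> infer_instance

lemma sideNhds_le (b : Bool) (a : ℝ) : sideNhds b a ≤ nhds a := by
  unfold sideNhds; split_ifs <;> exact nhdsWithin_le_nhds

variable {n : ℕ} {x y : ℕ → ℝ}

lemma continuous_edgeHeight (x y : ℕ → ℝ) (i : ℕ) : Continuous (edgeHeight x y i) := by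
  unfold edgeHeight; fun_prop

lemma edgeHeight_left (x y : ℕ → ℝ) (i : ℕ) : edgeHeight x y i (x i) = y i := by
  simp [edgeHeight]

lemma edgeHeight_right {i : ℕ} (h : x i ≠ x (i + 1)) :
    edgeHeight x y i (x (i + 1)) = y (i + 1) := by
  simp [edgeHeight, div_self (sub_ne_zero.2 h.symm)]

lemma edgeSign_eq (x : ℕ → ℝ) (i : ℕ) : edgeSign x i = 1 ∨ edgeSign x i = -1 := by
  unfold edgeSign; split_ifs <;> simp

lemma edgeCovers.mem_uIcc {b : Bool} {i : ℕ} {t : ℝ} (h : edgeCovers x b i t) :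
    t ∈ Set.uIcc (x i) (x (i + 1)) := by
  rw [Set.mem_uIcc]
  unfold edgeCovers at h
  cases b <;> simp only [if_true, Bool.false_eq_true, if_false] at h <;>
    rcases h with h | h
  · exact Or.inl ⟨h.1.le, h.2⟩
  · exact Or.inr ⟨h.1.le, h.2⟩
  · exact Or.inl ⟨h.1, h.2.le⟩
  · exact Or.inr ⟨h.1, h.2.le⟩

lemma eventually_edgeCovers_iff (x : ℕ → ℝ) (b : Bool) (i : ℕ) (a : ℝ) :
    ∀ᶠ t in sideNhds b a, edgeCovers x b i t ↔ edgeCovers x b i a := by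
  have key : ∀ c : ℝ, (∀ᶠ t in nhdsWithin a (Set.Ioi a), (c ≤ t ↔ c ≤ a) ∧ (t < c ↔ a < c)) ∧
      ∀ᶠ t in nhdsWithin a (Set.Iio a), (c < t ↔ c < a) ∧ (t ≤ c ↔ a ≤ c) := by
    intro c
    constructor
    · rcases lt_or_ge a c with h | h
      · filter_upwards [nhdsWithin_le_nhds (gt_mem_nhds h)] with t ht
        exact ⟨by simp [not_le.2 h, not_le.2 ht], by simp [h, ht]⟩
      · filter_upwards [self_mem_nhdsWithin] with t ht
        have := h.trans_lt ht
        exact ⟨by simp [h, this.le], by simp [not_lt.2 h, not_lt.2 this.le]⟩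
    · rcases lt_or_ge c a with h | h
      · filter_upwards [nhdsWithin_le_nhds (lt_mem_nhds h)] with t ht
        exact ⟨by simp [h, ht], by simp [not_le.2 h, not_le.2 ht]⟩
      · filter_upwards [self_mem_nhdsWithin] with t ht
        have : t < c := lt_of_lt_of_le ht h
        exact ⟨by simp [not_lt.2 h, not_lt.2 this.le], by simp [h, this.le]⟩
  cases b
  · filter_upwards [(key (x i)).2, (key (x (i + 1))).2] with t h1 h2
    simp only [edgeCovers, Bool.false_eq_true, if_false, h1.1, h1.2, h2.1, h2.2]
  · filter_upwards [(key (x i)).1, (key (x (i + 1))).1] with t h1 h2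
    simp only [edgeCovers, if_true, h1.1, h1.2, h2.1, h2.2]

lemma eventually_below_iff {b : Bool} {j : ℕ} {a : ℝ} {z : ℝ → ℝ}
    (hz : Continuous z) (hne : a ∈ Set.uIcc (x j) (x (j + 1)) → edgeHeight x y j a ≠ z a) :
    ∀ᶠ t in sideNhds b a, (edgeCovers x b j t ∧ edgeHeight x y j t < z t) ↔
      (edgeCovers x b j a ∧ edgeHeight x y j a < z a) := by
  have hc := continuous_edgeHeight x y j
  by_cases hcov : edgeCovers x b j a
  · rcases lt_or_gt_of_ne (hne hcov.mem_uIcc) with h | h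
    · filter_upwards [eventually_edgeCovers_iff x b j a,
        sideNhds_le b a ((isOpen_lt hc hz).mem_nhds h)] with t h1 h2
      simp only [h1, h, iff_true, hcov, true_and]
      exact h2
    · filter_upwards [eventually_edgeCovers_iff x b j a,
        sideNhds_le b a ((isOpen_lt hz hc).mem_nhds h)] with t h1 h2
      have h2' : z t < edgeHeight x y j t := h2
      simp [not_lt.2 h2'.le, not_lt.2 h.le]
  · filter_upwards [eventually_edgeCovers_iff x b j a] with t h1
    simp [h1, hcov]

open Classical in
lemma GraphPoly.edgesBelow_eq (h : GraphPoly n x y) (b : Bool) (t z : ℝ) :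
    edgesBelow n x y b t z = edgesBelow n x y true t z := by
  cases b
  swap
  · rfl
  set g : ℕ → ℝ := fun j => if x j = t ∧ y j < z then 1 else 0 with hg
  have hj : ∀ j ∈ Finset.range n,
      ((if edgeCovers x true j t ∧ edgeHeight x y j t < z then edgeSign x j else 0) -
      if edgeCovers x false j t ∧ edgeHeight x y j t < z then edgeSign x j else 0) =
      g j - g (j + 1) := by
    intro j hj
    rw [Finset.mem_range] at hj
    have hne := h.ne j hj
    by_cases h1 : x j = t
    · have h2 : x (j + 1) ≠ t := fun h2 => hne (h1.trans h2.symm)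
      subst h1
      simp only [hg, edgeHeight_left, edgeCovers, edgeSign, if_true, Bool.false_eq_true, if_false,
        lt_irrefl, le_refl, false_and, true_and, and_true, h2]
      rcases lt_or_gt_of_ne hne with h3 | h3
      · simp [h3, not_lt.2 h3.le]
      · simp only [h3, h3.le, not_lt.2 h3.le, true_and, false_and, or_false, or_true,
          if_false]
        split_ifs <;> simp
    · by_cases h2 : x (j + 1) = t
      · subst h2
        simp only [hg, edgeHeight_right hne, edgeCovers, edgeSign, if_true, Bool.false_eq_true,
          if_false, lt_irrefl, le_refl, and_false, false_and, true_and, and_true, hne]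
        rcases lt_or_gt_of_ne hne with h3 | h3
        · simp [h3, not_lt.2 h3.le]
        · simp only [h3, not_lt.2 h3.le, true_and, false_and, or_false, false_or, if_false]
          split_ifs <;> simp
      · have : edgeCovers x true j t ↔ edgeCovers x false j t := by
          have e1 : x j ≤ t ↔ x j < t := ⟨fun h => lt_of_le_of_ne h h1, le_of_lt⟩
          have e2 : x (j + 1) ≤ t ↔ x (j + 1) < t := ⟨fun h => lt_of_le_of_ne h h2, le_of_lt⟩
          have e3 : t ≤ x j ↔ t < x j := ⟨fun h => lt_of_le_of_ne h (Ne.symm h1), le_of_lt⟩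
          have e4 : t ≤ x (j + 1) ↔ t < x (j + 1) :=
            ⟨fun h => lt_of_le_of_ne h (Ne.symm h2), le_of_lt⟩
          simp only [edgeCovers, if_true, Bool.false_eq_true, if_false, e1, e2, e3, e4]
        simp only [this, hg, h1, h2, false_and, if_false, sub_self]
  have hsum := Finset.sum_congr rfl hj
  rw [Finset.sum_sub_distrib, Finset.sum_range_sub'] at hsum
  have : g 0 = g n := by simp only [hg, h.closed_x, h.closed_y]
  unfold edgesBelow
  linarith

/-- The strict abscissa range of an edge. -/
def edgeInner (x : ℕ → ℝ) (i : ℕ) : Set ℝ :=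
  Set.Ioo (min (x i) (x (i + 1))) (max (x i) (x (i + 1)))

lemma mem_edgeInner {i : ℕ} {t : ℝ} (h : t ∈ Set.uIcc (x i) (x (i + 1))) (h1 : t ≠ x i)
    (h2 : t ≠ x (i + 1)) : t ∈ edgeInner x i := by
  rw [Set.mem_uIcc] at h
  rcases h with h | h
  · have e1 := lt_of_le_of_ne h.1 h1.symm
    have e2 := lt_of_le_of_ne h.2 h2
    exact ⟨min_lt_of_left_lt e1, lt_max_of_lt_right e2⟩
  · have e1 := lt_of_le_of_ne h.1 h2.symm
    have e2 := lt_of_le_of_ne h.2 h1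
    exact ⟨min_lt_of_right_lt e1, lt_max_of_lt_left e2⟩

lemma ne_of_mem_edgeInner {i : ℕ} {t : ℝ} (h : t ∈ edgeInner x i) : t ≠ x i ∧ t ≠ x (i + 1) := by
  obtain ⟨h1, h2⟩ := h
  constructor
  · rintro rfl
    rcases min_lt_iff.1 h1 with h | h
    · exact lt_irrefl _ h
    · rcases lt_max_iff.1 h2 with h' | h'
      · exact lt_irrefl _ h'
      · exact lt_asymm h h'
  · rintro rfl
    rcases min_lt_iff.1 h1 with h | h
    · rcases lt_max_iff.1 h2 with h' | h'
      · exact lt_asymm h h'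
      · exact lt_irrefl _ h'
    · exact lt_irrefl _ h

lemma edgeInner_subset (x : ℕ → ℝ) (i : ℕ) : edgeInner x i ⊆ Set.uIcc (x i) (x (i + 1)) :=
  Set.Ioo_subset_Icc_self

lemma GraphPoly.height_ne (h : GraphPoly n x y) {i j : ℕ} (hi : i < n) (hj : j < n) (hij : i ≠ j)
    {t : ℝ} (ht : t ∈ edgeInner x i) (htj : t ∈ Set.uIcc (x j) (x (j + 1))) :
    edgeHeight x y j t ≠ edgeHeight x y i t := by
  intro heq
  obtain ⟨h1, h2⟩ := ne_of_mem_edgeInner ht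
  have hti := edgeInner_subset x i ht
  rcases lt_or_gt_of_ne hij with hlt | hlt
  · rcases h.simple i j hlt hj t hti htj heq.symm with ⟨rfl, h3⟩ | ⟨rfl, -, h3⟩
    · exact h2 h3
    · exact h1 h3
  · rcases h.simple j i hlt hi t htj hti heq with ⟨rfl, h3⟩ | ⟨rfl, h4, h3⟩
    · exact h1 h3
    · exact h2 (by rw [h4, h.closed_x, h3])

lemma GraphPoly.vertex_height_ne (h : GraphPoly n x y) {i j : ℕ} (hi : i + 1 < n) (hj : j < n)
    (hij : j ≠ i) (hij' : j ≠ i + 1) (ht : x (i + 1) ∈ Set.uIcc (x j) (x (j + 1))) :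
    edgeHeight x y j (x (i + 1)) ≠ y (i + 1) := by
  intro heq
  have e1 : edgeHeight x y (i + 1) (x (i + 1)) = y (i + 1) := edgeHeight_left _ _ _
  have e2 : edgeHeight x y i (x (i + 1)) = y (i + 1) := edgeHeight_right (h.ne i (by omega))
  rcases lt_or_gt_of_ne hij with hlt | hlt
  · rcases h.simple j i hlt (by omega) _ ht Set.right_mem_uIcc (heq.trans e2.symm) with
      ⟨-, h3⟩ | ⟨-, h4, -⟩
    · exact h.ne i (by omega) h3.symm
    · omega
  · rcases h.simple (i + 1) j (by omega) hj _ Set.left_mem_uIcc ht (e1.trans heq.symm) with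
      ⟨rfl, h3⟩ | ⟨h4, -⟩
    · exact h.ne (i + 1) (by omega) h3
    · omega

lemma eventually_mem_edgeInner {b : Bool} {c a : ℝ} (hne : c ≠ a) (hb : b = true ↔ a < c) :
    ∀ᶠ t in sideNhds b a, t ∈ Set.Ioo (min c a) (max c a) := by
  cases b
  · have hc : c < a := lt_of_le_of_ne (not_lt.1 fun h => by simpa using hb.2 h) hne
    rw [min_eq_left hc.le, max_eq_right hc.le]
    exact Ioo_mem_nhdsLT hc
  · have hc : a < c := hb.1 rfl
    rw [min_eq_right hc.le, max_eq_left hc.le]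
    exact Ioo_mem_nhdsGT hc

open Classical in
lemma GraphPoly.exists_sideIndex (h : GraphPoly n x y) {i : ℕ} (hi : i < n) :
    ∃ m, ∀ t ∈ edgeInner x i,
      2 * edgesBelow n x y true t (edgeHeight x y i t) + edgeSign x i = m := by
  set f : ℝ → ℝ := fun t => edgesBelow n x y true t (edgeHeight x y i t) with hf
  have hloc : ∀ a ∈ edgeInner x i, ∀ᶠ t in nhds a, f t = f a := by
    intro a ha
    have hb : ∀ b : Bool, ∀ᶠ t in sideNhds b a, f t = f a := by
      intro b
      have : ∀ᶠ t in sideNhds b a, ∀ j ∈ Finset.range n,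
          ((edgeCovers x b j t ∧ edgeHeight x y j t < edgeHeight x y i t) ↔
          (edgeCovers x b j a ∧ edgeHeight x y j a < edgeHeight x y i a)) := by
        rw [Filter.eventually_all_finset]
        intro j hj
        rw [Finset.mem_range] at hj
        rcases eq_or_ne i j with rfl | hij
        · simp
        · exact eventually_below_iff (continuous_edgeHeight x y i) (h.height_ne hi hj hij ha)
      filter_upwards [this] with t ht
      simp only [hf]
      rw [← h.edgesBelow_eq b, ← h.edgesBelow_eq b a]
      unfold edgesBelow
      exact Finset.sum_congr rfl fun j hj => by simp only [ht j hj]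
    rw [← pure_sup_nhdsNE, ← Set.Iio_union_Ioi, nhdsWithin_union]
    exact ⟨rfl, hb false, hb true⟩
  have hpre : IsPreconnected (edgeInner x i) := isPreconnected_Ioo
  rcases (edgeInner x i).eq_empty_or_nonempty with he | ⟨a, ha⟩
  · exact ⟨0, by simp [he]⟩
  · refine ⟨2 * f a + edgeSign x i, fun t ht => ?_⟩
    have hd : ∀ z ∈ edgeInner x i, HasDerivAt f 0 z := fun z hz =>
      (hasDerivAt_const z (f z)).congr_of_eventuallyEq (hloc z hz)
    have : f t = f a := by
      refine isOpen_Ioo.is_const_of_deriv_eq_zero hpre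
        (fun z hz => (hd z hz).differentiableAt.differentiableWithinAt)
        (fun z hz => (hd z hz).deriv) ht ha
    rw [← this]

open Classical in
lemma GraphPoly.eventually_edgesBelow_eq (h : GraphPoly n x y) {i e e' : ℕ} (hi : i + 1 < n)
    (he : e = i ∧ e' = i + 1 ∨ e = i + 1 ∧ e' = i) (b : Bool) :
    ∀ᶠ t in sideNhds b (x (i + 1)), edgesBelow n x y true t (edgeHeight x y e t) =
      edgesBelow n x y true (x (i + 1)) (y (i + 1)) +
      if edgeCovers x b e' t ∧ edgeHeight x y e' t < edgeHeight x y e t then edgeSign x e'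
      else 0 := by
  have e1 : edgeHeight x y (i + 1) (x (i + 1)) = y (i + 1) := edgeHeight_left _ _ _
  have e2 : edgeHeight x y i (x (i + 1)) = y (i + 1) := edgeHeight_right (h.ne i (by omega))
  have hea : edgeHeight x y e (x (i + 1)) = y (i + 1) := by
    rcases he with ⟨rfl, -⟩ | ⟨rfl, -⟩ <;> assumption
  have hea' : edgeHeight x y e' (x (i + 1)) = y (i + 1) := by
    rcases he with ⟨-, rfl⟩ | ⟨-, rfl⟩ <;> assumption
  have hne : e ≠ e' := by omega
  have : ∀ᶠ t in sideNhds b (x (i + 1)), ∀ j ∈ Finset.range n, j ≠ e → j ≠ e' →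
      ((edgeCovers x b j t ∧ edgeHeight x y j t < edgeHeight x y e t) ↔
      (edgeCovers x b j (x (i + 1)) ∧ edgeHeight x y j (x (i + 1)) < y (i + 1))) := by
    rw [Filter.eventually_all_finset]
    intro j hj
    rw [Finset.mem_range] at hj
    by_cases h1 : j = e
    · simp [h1]
    by_cases h2 : j = e'
    · simp [h2]
    have hja := h.vertex_height_ne hi hj (by omega) (by omega)
    rw [← hea] at hja ⊢
    filter_upwards [eventually_below_iff (b := b) (continuous_edgeHeight x y e) hja] with t ht _ _
    exact ht
  filter_upwards [this] with t ht
  rw [← h.edgesBelow_eq b, ← h.edgesBelow_eq b (x (i + 1))]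
  unfold edgesBelow
  have he' : e' ∈ Finset.range n := by rw [Finset.mem_range]; omega
  rw [← Finset.sum_ite_eq_of_mem (Finset.range n) e' (fun _ => if edgeCovers x b e' t ∧
    edgeHeight x y e' t < edgeHeight x y e t then edgeSign x e' else 0) he',
    ← Finset.sum_add_distrib]
  refine Finset.sum_congr rfl fun j hj => ?_
  by_cases h1 : j = e
  · subst h1
    simp [hea, hne.symm]
  by_cases h2 : j = e'
  · subst h2
    simp [hea']
  · simp only [ht j hj h1 h2, Ne.symm h2, if_false, add_zero]

lemma edgeCovers_of_mem_edgeInner {i : ℕ} {t : ℝ} (h : t ∈ edgeInner x i) (b : Bool) :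
    edgeCovers x b i t := by
  obtain ⟨h1, h2⟩ := h
  unfold edgeCovers
  rcases min_lt_iff.1 h1 with h | h
  · rcases lt_max_iff.1 h2 with h' | h'
    · exact absurd h (lt_asymm h')
    · cases b <;> simp [h, h', h.le, h'.le]
  · rcases lt_max_iff.1 h2 with h' | h'
    · cases b <;> simp [h, h', h.le, h'.le]
    · exact absurd h (lt_asymm h')

lemma eventually_not_edgeCovers {b : Bool} {i : ℕ} {a c : ℝ} (hne : c ≠ a)
    (hb : ¬ (b = true ↔ a < c)) (hx : x i = a ∧ x (i + 1) = c ∨ x i = c ∧ x (i + 1) = a) :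
    ∀ᶠ t in sideNhds b a, ¬ edgeCovers x b i t := by
  filter_upwards [eventually_edgeCovers_iff x b i a] with t ht
  rw [ht]
  unfold edgeCovers
  cases b
  · have hc : a < c := by
      by_contra hc
      exact hb (by simp [hc])
    rcases hx with ⟨h1, h2⟩ | ⟨h1, h2⟩ <;> simp [h1, h2, not_lt.2 hc.le]
  · have hc : c < a := lt_of_le_of_ne (not_lt.1 fun hc => hb (by simp [hc])) hne
    rcases hx with ⟨h1, h2⟩ | ⟨h1, h2⟩ <;> simp [h1, h2, not_lt.2 hc.le]

lemma GraphPoly.sideIndex_eq_succ (h : GraphPoly n x y) {i : ℕ} (hi : i + 1 < n) {m m' : ℝ}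
    (hm : ∀ t ∈ edgeInner x i,
      2 * edgesBelow n x y true t (edgeHeight x y i t) + edgeSign x i = m)
    (hm' : ∀ t ∈ edgeInner x (i + 1),
      2 * edgesBelow n x y true t (edgeHeight x y (i + 1) t) + edgeSign x (i + 1) = m') :
    m = m' := by
  classical
  set a := x (i + 1) with ha
  have hni : x i ≠ a := h.ne i (by omega)
  have hni' : x (i + 1 + 1) ≠ a := (h.ne (i + 1) hi).symm
  set b : Bool := decide (a < x i) with hb
  set b' : Bool := decide (a < x (i + 1 + 1)) with hb'
  have hbi : b = true ↔ a < x i := by simp [hb]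
  have hbi' : b' = true ↔ a < x (i + 1 + 1) := by simp [hb']
  have E1 : ∀ᶠ t in sideNhds b a, t ∈ edgeInner x i := eventually_mem_edgeInner hni hbi
  have E2 : ∀ᶠ t in sideNhds b' a, t ∈ edgeInner x (i + 1) := by
    have := eventually_mem_edgeInner hni' hbi'
    rwa [min_comm, max_comm] at this
  have F1 := h.eventually_edgesBelow_eq hi (Or.inl ⟨rfl, rfl⟩) b
  have F2 := h.eventually_edgesBelow_eq hi (Or.inr ⟨rfl, rfl⟩) b'
  have s1 : edgeSign x i = if b then -1 else 1 := by
    unfold edgeSign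
    rcases lt_or_gt_of_ne hni with h1 | h1
    · rw [if_pos h1, if_neg (by rw [hbi]; exact not_lt.2 h1.le)]
    · rw [if_neg (not_lt.2 h1.le), if_pos (hbi.2 h1)]
  have s2 : edgeSign x (i + 1) = if b' then 1 else -1 := by
    unfold edgeSign
    simp only [hbi']
    rfl
  by_cases hbb : b = b'
  · rw [← hbb] at E2 F2 s2
    obtain ⟨t, t1, t2, t3, t4⟩ := (E1.and (E2.and (F1.and F2))).exists
    have g1 := hm t t1
    have g2 := hm' t t2
    rw [t3] at g1
    rw [t4] at g2
    have hne := h.height_ne (by omega) hi (by omega) t1 (edgeInner_subset x (i + 1) t2)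
    have c1 := edgeCovers_of_mem_edgeInner t1 b
    have c2 := edgeCovers_of_mem_edgeInner t2 b
    have s3 : edgeSign x (i + 1) = -edgeSign x i := by rw [s1, s2]; split_ifs <;> simp
    rw [s3] at g1 g2
    rcases lt_or_gt_of_ne hne with h1 | h1
    · rw [if_pos ⟨c2, h1⟩] at g1
      rw [if_neg (fun h => lt_asymm h1 h.2)] at g2
      linarith
    · rw [if_neg (fun h => lt_asymm h1 h.2)] at g1
      rw [if_pos ⟨c1, h1⟩] at g2
      linarith
  · have G1 : ∀ᶠ t in sideNhds b a, ¬ edgeCovers x b (i + 1) t :=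
      eventually_not_edgeCovers hni' (fun h => hbb (Bool.eq_iff_iff.2 (h.trans hbi'.symm)))
        (Or.inl ⟨rfl, rfl⟩)
    have G2 : ∀ᶠ t in sideNhds b' a, ¬ edgeCovers x b' i t :=
      eventually_not_edgeCovers hni (fun h => hbb (Bool.eq_iff_iff.2 (hbi.trans h.symm)))
        (Or.inr ⟨rfl, rfl⟩)
    obtain ⟨t, t1, t2, t3⟩ := (E1.and (F1.and G1)).exists
    obtain ⟨t', t1', t2', t3'⟩ := (E2.and (F2.and G2)).exists
    have g1 := hm t t1
    have g2 := hm' t' t1'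
    rw [t2, if_neg (fun h => t3 h.1)] at g1
    rw [t2', if_neg (fun h => t3' h.1)] at g2
    have s3 : edgeSign x (i + 1) = edgeSign x i := by
      rw [s1, s2]
      revert hbb
      cases b <;> cases b' <;> simp
    rw [s3] at g2
    linarith

lemma GraphPoly.exists_common_sideIndex (h : GraphPoly n x y) :
    ∃ m, ∀ i < n, ∀ t ∈ edgeInner x i,
      2 * edgesBelow n x y true t (edgeHeight x y i t) + edgeSign x i = m := by
  rcases Nat.eq_zero_or_pos n with h0 | h0
  · exact ⟨0, fun i hi => by omega⟩
  obtain ⟨m, hm⟩ := h.exists_sideIndex h0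
  refine ⟨m, fun i => ?_⟩
  induction i with
  | zero => exact fun _ => hm
  | succ i ih =>
    intro hi
    obtain ⟨m', hm'⟩ := h.exists_sideIndex hi
    rw [h.sideIndex_eq_succ hi (ih (by omega)) hm']
    exact hm'

/-- The winding number of a simple polygon is at most one in absolute value. -/
lemma GraphPoly.abs_edgesBelow_le (h : GraphPoly n x y) {t : ℝ} (ht : ∀ i ≤ n, t ≠ x i) (z : ℝ) :
    |edgesBelow n x y true t z| ≤ 1 := by
  classical
  obtain ⟨m, hm⟩ := h.exists_common_sideIndex
  have hcov : ∀ i < n, edgeCovers x true i t → t ∈ edgeInner x i := fun i hi hc =>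
    mem_edgeInner hc.mem_uIcc (ht i hi.le) (ht (i + 1) hi)
  set A := (Finset.range n).filter fun j => edgeCovers x true j t ∧ edgeHeight x y j t < z with hA
  rcases A.eq_empty_or_nonempty with he | hne
  · have : edgesBelow n x y true t z = 0 := by
      unfold edgesBelow
      rw [← Finset.sum_filter, ← hA, he, Finset.sum_empty]
    simp [this]
  have hmem : ∀ j, j ∈ A ↔ j < n ∧ edgeCovers x true j t ∧ edgeHeight x y j t < z := fun j => by
    rw [hA, Finset.mem_filter, Finset.mem_range]
  obtain ⟨k, hk, hkmin⟩ := A.exists_min_image (fun j => edgeHeight x y j t) hne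
  obtain ⟨l, hl, hlmax⟩ := A.exists_max_image (fun j => edgeHeight x y j t) hne
  rw [hmem] at hk hl
  have h1 : edgesBelow n x y true t (edgeHeight x y k t) = 0 := by
    unfold edgesBelow
    refine Finset.sum_eq_zero fun j hj => if_neg fun hj' => ?_
    rw [Finset.mem_range] at hj
    exact absurd hj'.2 (not_lt.2 (hkmin j ((hmem j).2 ⟨hj, hj'.1, hj'.2.trans hk.2.2⟩)))
  have h2 : edgesBelow n x y true t z =
      edgesBelow n x y true t (edgeHeight x y l t) + edgeSign x l := by
    unfold edgesBelow
    rw [← Finset.sum_ite_eq_of_mem (Finset.range n) l (fun _ => edgeSign x l)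
      (Finset.mem_range.2 hl.1), ← Finset.sum_add_distrib]
    refine Finset.sum_congr rfl fun j hj => ?_
    rw [Finset.mem_range] at hj
    rcases eq_or_ne l j with rfl | hjl
    · simp [hl.2.1, hl.2.2]
    · have : (edgeCovers x true j t ∧ edgeHeight x y j t < z) ↔
          edgeCovers x true j t ∧ edgeHeight x y j t < edgeHeight x y l t := by
        refine and_congr_right fun hc => ⟨fun hz => lt_of_le_of_ne
          (hlmax j ((hmem j).2 ⟨hj, hc, hz⟩)) ?_, fun hz => hz.trans hl.2.2⟩
        exact h.height_ne hl.1 hj hjl (hcov l hl.1 hl.2.1) hc.mem_uIcc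
      simp only [this, hjl, if_false, add_zero]
  have h3 := hm k hk.1 t (hcov k hk.1 hk.2.1)
  have h4 := hm l hl.1 t (hcov l hl.1 hl.2.1)
  rw [h1] at h3
  have h5 : edgesBelow n x y true t z = (edgeSign x k + edgeSign x l) / 2 := by linarith
  rw [h5]
  rcases edgeSign_eq x k with e | e <;> rcases edgeSign_eq x l with e' | e' <;> rw [e, e'] <;>
    norm_num

end Winding

section PlanarBound

variable {n : ℕ} {x y : ℕ → ℝ}

open Classical in
lemma GraphPoly.abs_sum_edges_le (h : GraphPoly n x y) {t : ℝ} (ht : ∀ i ≤ n, t ≠ x i)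
    {ψ : ℝ → ℝ} (hψ : ContDiff ℝ 1 ψ) {R D : ℝ} (hR : 0 ≤ R) (hs : ∀ z, R < |z| → ψ z = 0)
    (hD : ∀ z, |deriv ψ z| ≤ D) :
    |∑ i ∈ Finset.range n, if edgeCovers x true i t then edgeSign x i * ψ (edgeHeight x y i t)
      else 0| ≤ 2 * R * D := by
  have hcs : HasCompactSupport ψ := by
    refine HasCompactSupport.intro (isCompact_Icc (a := -R) (b := R)) fun z hz => hs z ?_
    rw [← not_le, abs_le]; exact hz
  have hdc : Continuous (deriv ψ) := hψ.continuous_deriv le_rfl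
  have hdi : Integrable (deriv ψ) := hdc.integrable_of_hasCompactSupport hcs.deriv
  have hd0 : ∀ z, R < |z| → deriv ψ z = 0 := by
    intro z hz
    have : ψ =ᶠ[nhds z] fun _ => 0 := by
      filter_upwards [(isOpen_lt continuous_const continuous_abs).mem_nhds hz] with w hw
      exact hs w hw
    rw [this.deriv_eq, deriv_const]
  have hrep : ∀ b, ψ b = -∫ z, (Set.Ioi b).indicator (deriv ψ) z := fun b => by
    rw [integral_indicator measurableSet_Ioi, hcs.integral_Ioi_deriv_eq hψ, neg_neg]
  have hsum : (∑ i ∈ Finset.range n, if edgeCovers x true i t then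
      edgeSign x i * ψ (edgeHeight x y i t) else 0) =
      -∫ z, edgesBelow n x y true t z * deriv ψ z := by
    have : ∀ z, edgesBelow n x y true t z * deriv ψ z = ∑ i ∈ Finset.range n,
        (if edgeCovers x true i t then edgeSign x i else 0) *
        (Set.Ioi (edgeHeight x y i t)).indicator (deriv ψ) z := by
      intro z
      unfold edgesBelow
      rw [Finset.sum_mul]
      refine Finset.sum_congr rfl fun i _ => ?_
      by_cases h1 : edgeCovers x true i t <;> by_cases h2 : edgeHeight x y i t < z <;>
        simp [h1, h2]
    simp only [this]
    rw [integral_finsetSum _ fun i _ => (hdi.indicator measurableSet_Ioi).const_mul _,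
      ← Finset.sum_neg_distrib]
    refine Finset.sum_congr rfl fun i _ => ?_
    rw [integral_const_mul]
    split_ifs
    · rw [hrep]; ring
    · simp
  rw [hsum, abs_neg, ← Real.norm_eq_abs]
  have hb : ∀ z, ‖edgesBelow n x y true t z * deriv ψ z‖ ≤ (Set.Icc (-R) R).indicator
      (fun _ => D) z := by
    intro z
    by_cases hz : z ∈ Set.Icc (-R) R
    · rw [Set.indicator_of_mem hz, norm_mul]
      calc _ ≤ 1 * D := mul_le_mul (h.abs_edgesBelow_le ht z) (hD z) (abs_nonneg _) zero_le_one
        _ = D := one_mul D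
    · rw [Set.indicator_of_notMem hz, hd0 z (by rw [← not_le, abs_le]; exact hz)]
      simp
  refine (norm_integral_le_of_norm_le ?_ (ae_of_all _ hb)).trans ?_
  · exact (integrable_indicator_iff measurableSet_Icc).2 (by simp)
  · rw [integral_indicator measurableSet_Icc]
    simp only [integral_const, smul_eq_mul, measureReal_restrict_apply_univ, Real.volume_real_Icc]
    rw [max_eq_left (by linarith)]
    linarith

open Classical in
lemma integral_edge_eq (x : ℕ → ℝ) (i : ℕ) {f : ℝ → ℝ} (hf : Continuous f) :
    Integrable (fun t => if edgeCovers x true i t then edgeSign x i * f t else 0) ∧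
    ∫ t in (x i)..(x (i + 1)), f t =
      ∫ t, if edgeCovers x true i t then edgeSign x i * f t else 0 := by
  rcases lt_or_ge (x i) (x (i + 1)) with h | h
  · have e : (fun t => if edgeCovers x true i t then edgeSign x i * f t else 0) =
        (Set.Ico (x i) (x (i + 1))).indicator f := by
      ext t
      have : edgeCovers x true i t ↔ t ∈ Set.Ico (x i) (x (i + 1)) := by
        simp only [edgeCovers, if_true, Set.mem_Ico, or_iff_left_iff_imp]
        intro h'; linarith
      simp only [this, edgeSign, h, if_true, one_mul, Set.indicator_apply]
    rw [e, integrable_indicator_iff measurableSet_Ico, integral_indicator measurableSet_Ico,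
      intervalIntegral.integral_of_le h.le, integral_Ico_eq_integral_Ioc]
    exact ⟨(hf.integrableOn_Icc).mono_set Set.Ico_subset_Icc_self, rfl⟩
  · have e : (fun t => if edgeCovers x true i t then edgeSign x i * f t else 0) =
        (Set.Ico (x (i + 1)) (x i)).indicator (fun t => -f t) := by
      ext t
      have : edgeCovers x true i t ↔ t ∈ Set.Ico (x (i + 1)) (x i) := by
        simp only [edgeCovers, if_true, Set.mem_Ico, or_iff_right_iff_imp]
        intro h'; linarith
      simp only [this, edgeSign, not_lt.2 h, if_false, neg_mul, one_mul, Set.indicator_apply]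
    rw [e, integrable_indicator_iff measurableSet_Ico, integral_indicator measurableSet_Ico,
      intervalIntegral.integral_of_ge h, integral_Ico_eq_integral_Ioc, integral_neg]
    exact ⟨(hf.neg.integrableOn_Icc).mono_set Set.Ico_subset_Icc_self, rfl⟩

lemma GraphPoly.abs_sum_integral_le (h : GraphPoly n x y) {Ψ : ℝ → ℝ → ℝ}
    (hΨ : Continuous (Function.uncurry Ψ)) (hΨd : ∀ t, ContDiff ℝ 1 (Ψ t)) {R D : ℝ} (hR : 0 ≤ R)
    (hs : ∀ t z, R < |z| → Ψ t z = 0) (hs' : ∀ t z, R < |t| → Ψ t z = 0)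
    (hD : ∀ t z, |deriv (Ψ t) z| ≤ D) :
    |∑ i ∈ Finset.range n, ∫ t in (x i)..(x (i + 1)), Ψ t (edgeHeight x y i t)| ≤
      4 * R ^ 2 * D := by
  classical
  have hc : ∀ i, Continuous fun t => Ψ t (edgeHeight x y i t) := fun i =>
    hΨ.comp (continuous_id.prodMk (continuous_edgeHeight x y i))
  rw [Finset.sum_congr rfl fun i _ => (integral_edge_eq x i (hc i)).2,
    ← integral_finsetSum _ fun i _ => (integral_edge_eq x i (hc i)).1, ← Real.norm_eq_abs]
  have hae : ∀ᵐ t : ℝ, ∀ i ≤ n, t ≠ x i := by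
    rw [ae_all_iff]
    intro i
    filter_upwards [compl_mem_ae_iff.2 (Real.volume_singleton (a := x i))] with t ht _
    exact ht
  have hb : ∀ᵐ t : ℝ, ‖∑ i ∈ Finset.range n, if edgeCovers x true i t then
      edgeSign x i * Ψ t (edgeHeight x y i t) else 0‖ ≤
      (Set.Icc (-R) R).indicator (fun _ => 2 * R * D) t := by
    filter_upwards [hae] with t ht
    by_cases hz : t ∈ Set.Icc (-R) R
    · rw [Set.indicator_of_mem hz]
      exact h.abs_sum_edges_le ht (hΨd t) hR (hs t) (hD t)
    · rw [Set.indicator_of_notMem hz]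
      have := fun z => hs' t z (by rw [← not_le, abs_le]; exact hz)
      simp [this]
  have hI : Integrable ((Set.Icc (-R) R).indicator fun _ => 2 * R * D) :=
    (integrable_indicator_iff measurableSet_Icc).2 (integrableOn_const (by simp))
  refine (norm_integral_le_of_norm_le hI hb).trans ?_
  rw [integral_indicator measurableSet_Icc]
  simp only [integral_const, smul_eq_mul, measureReal_restrict_apply_univ, Real.volume_real_Icc]
  rw [max_eq_left (by linarith)]
  apply le_of_eq; ring

end PlanarBound

section SimplePolygonBound

/-- The point with `k`-th coordinate `t - ε * z` and other coordinate `z`. -/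
def shearPoint (k k' : Fin 2) (ε t z : ℝ) : Ed 2 :=
  (t - ε * z) • EuclideanSpace.single k (1:ℝ) + z • EuclideanSpace.single k' (1:ℝ)

lemma shearPoint_fst {k k' : Fin 2} (hk : k ≠ k') (ε t z : ℝ) :
    shearPoint k k' ε t z k = t - ε * z := by
  simp [shearPoint, hk]

lemma shearPoint_snd {k k' : Fin 2} (hk : k ≠ k') (ε t z : ℝ) :
    shearPoint k k' ε t z k' = z := by
  simp [shearPoint, hk.symm]

lemma ext_of_ne {k k' : Fin 2} (hk : k ≠ k') {p q : Ed 2} (h : p k = q k) (h' : p k' = q k') :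
    p = q := by
  ext l
  have : l = k ∨ l = k' := by omega
  rcases this with rfl | rfl <;> assumption

lemma segInt_smul_single {Ψ : Ed 2 → ℝ} (k : Fin 2) (p q : Ed 2) :
    segInt (fun z => Ψ z • EuclideanSpace.single k (1:ℝ)) p q =
      ∫ s in (0:ℝ)..1, Ψ (p + s • (q - p)) * (q k - p k) := by
  unfold segInt
  refine intervalIntegral.integral_congr fun s _ => ?_
  simp [real_inner_smul_left, EuclideanSpace.inner_single_left]

lemma edge_param {k k' : Fin 2} (hk : k ≠ k') {ε : ℝ} {v : ℕ → Ed 2} {i : ℕ}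
    (hne : v i k + ε * v i k' ≠ v (i + 1) k + ε * v (i + 1) k') (s : ℝ) :
    shearPoint k k' ε
      (v i k + ε * v i k' + s * (v (i + 1) k + ε * v (i + 1) k' - (v i k + ε * v i k')))
      (edgeHeight (fun i => v i k + ε * v i k') (fun i => v i k') i
        (v i k + ε * v i k' + s * (v (i + 1) k + ε * v (i + 1) k' - (v i k + ε * v i k')))) =
      v i + s • (v (i + 1) - v i) := by
  have h1 : edgeHeight (fun i => v i k + ε * v i k') (fun i => v i k') i
      (v i k + ε * v i k' + s * (v (i + 1) k + ε * v (i + 1) k' - (v i k + ε * v i k'))) =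
      v i k' + s * (v (i + 1) k' - v i k') := by
    unfold edgeHeight
    rw [add_sub_cancel_left, mul_div_assoc, div_self (sub_ne_zero.2 hne.symm), mul_one]
  rw [h1]
  refine ext_of_ne hk ?_ ?_
  · rw [shearPoint_fst hk]; simp; ring
  · rw [shearPoint_snd hk]; simp

lemma SimplePoly.graphPoly {n : ℕ} {v : ℕ → Ed 2} (h : SimplePoly n v) {k k' : Fin 2}
    (hk : k ≠ k') {ε : ℝ}
    (hne : ∀ i < n, v i k + ε * v i k' ≠ v (i + 1) k + ε * v (i + 1) k') :
    GraphPoly n (fun i => v i k + ε * v i k') (fun i => v i k') := by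
  refine ⟨by simp only [h.1], by simp only [h.1], hne, fun i j hij hj t hti htj heq => ?_⟩
  have key : ∀ i < n, t ∈ Set.uIcc (v i k + ε * v i k') (v (i + 1) k + ε * v (i + 1) k') →
      shearPoint k k' ε t (edgeHeight (fun i => v i k + ε * v i k') (fun i => v i k') i t) ∈
        segment ℝ (v i) (v (i + 1)) := by
    intro i hi ht
    rw [← segment_eq_uIcc, segment_eq_image'] at ht
    obtain ⟨s, hs, rfl⟩ := ht
    rw [segment_eq_image']
    exact ⟨s, hs, (edge_param hk (hne i hi) s).symm⟩
  have h1 := key i (hij.trans hj) hti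
  have h2 := key j hj htj
  have heq' : edgeHeight (fun i => v i k + ε * v i k') (fun i => v i k') i t =
    edgeHeight (fun i => v i k + ε * v i k') (fun i => v i k') j t := heq
  rw [heq'] at h1
  set z := edgeHeight (fun i => v i k + ε * v i k') (fun i => v i k') j t
  have hX : ∀ q, shearPoint k k' ε t z = q → t = q k + ε * q k' := by
    rintro q rfl
    rw [shearPoint_fst hk, shearPoint_snd hk]; ring
  rcases h.2.2 i j hij hj _ h1 h2 with ⟨h3, h4⟩ | ⟨h3, h4, h5⟩
  · exact Or.inl ⟨h3, hX _ h4⟩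
  · exact Or.inr ⟨h3, h4, hX _ h5⟩

/-- The circulation of a fixed smooth field along simple polygons is bounded. -/
lemma exists_abs_sum_segInt_le {Ψ : Ed 2 → ℝ} (hΨ : ContDiff ℝ 1 Ψ) (hs : HasCompactSupport Ψ)
    (k : Fin 2) : ∃ C, ∀ n v, SimplePoly n v → |∑ i ∈ Finset.range n,
      segInt (fun z => Ψ z • EuclideanSpace.single k (1:ℝ)) (v i) (v (i + 1))| ≤ C := by
  obtain ⟨k', hk⟩ : ∃ k' : Fin 2, k ≠ k' := ⟨k + 1, by fin_cases k <;> simp⟩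
  obtain ⟨R, hR0, hR⟩ : ∃ R, 0 < R ∧ ∀ p, R < ‖p‖ → Ψ p = 0 := by
    obtain ⟨R, hR0, hR⟩ := hs.isCompact.isBounded.exists_pos_norm_le
    exact ⟨R, hR0, fun p hp => image_eq_zero_of_notMem_tsupport fun h => not_le.2 hp (hR p h)⟩
  obtain ⟨D, hD⟩ := (hs.fderiv ℝ).exists_bound_of_continuous (hΨ.continuous_fderiv one_ne_zero)
  refine ⟨4 * (2 * R) ^ 2 * (D * 2), fun n v h => ?_⟩
  set f := fun k => ∑ i ∈ Finset.range n,
      segInt (fun z => Ψ z • EuclideanSpace.single k (1:ℝ)) (v i) (v (i + 1)) with hf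
  have hlim : Tendsto (fun ε : ℝ => |f k + ε * f k'|) (nhdsWithin 0 {0}ᶜ) (nhds |f k|) := by
    have hc : Continuous fun ε : ℝ => |f k + ε * f k'| := by fun_prop
    have := hc.tendsto 0
    rw [zero_mul, add_zero] at this
    exact this.mono_left nhdsWithin_le_nhds
  refine le_of_tendsto hlim ?_
  have hgen : ∀ᶠ ε : ℝ in nhdsWithin 0 {0}ᶜ, ∀ i ∈ Finset.range n,
      v i k + ε * v i k' ≠ v (i + 1) k + ε * v (i + 1) k' := by
    rw [Filter.eventually_all_finset]
    intro i hi
    by_cases h0 : v i k = v (i + 1) k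
    · have h1 : v i k' ≠ v (i + 1) k' := fun h1 =>
        h.2.1 i (Finset.mem_range.1 hi) (ext_of_ne hk h0 h1)
      filter_upwards [self_mem_nhdsWithin] with ε hε heq
      rw [h0, add_right_inj] at heq
      exact h1 (mul_left_cancel₀ hε heq)
    · have hc : Continuous fun ε : ℝ => v i k + ε * v i k' - (v (i + 1) k + ε * v (i + 1) k') := by
        fun_prop
      have := hc.continuousAt (x := 0) |>.eventually_ne (y := 0) (by
        simpa using sub_ne_zero.2 h0)
      filter_upwards [nhdsWithin_le_nhds this] with ε hε heq
      exact hε (sub_eq_zero.2 heq)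
  have hsmall : ∀ᶠ ε : ℝ in nhdsWithin 0 {0}ᶜ, |ε| ≤ 1 := by
    refine nhdsWithin_le_nhds ?_
    filter_upwards [Metric.ball_mem_nhds (0:ℝ) one_pos] with ε hε
    rw [mem_ball_zero_iff] at hε
    exact hε.le
  filter_upwards [hgen, hsmall] with ε hε hε1
  have hg := h.graphPoly hk fun i hi => hε i (Finset.mem_range.2 hi)
  have hG : ∀ t, ContDiff ℝ 1 fun z => shearPoint k k' ε t z := fun t => by
    unfold shearPoint; fun_prop
  have hbound := hg.abs_sum_integral_le (Ψ := fun t z => Ψ (shearPoint k k' ε t z)) (R := 2 * R)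
    (D := D * 2) ?_ (fun t => hΨ.comp (hG t)) (by positivity) ?_ ?_ ?_
  · refine le_trans (le_of_eq ?_) hbound
    congr 1
    rw [hf]
    simp only
    rw [Finset.mul_sum, ← Finset.sum_add_distrib]
    refine Finset.sum_congr rfl fun i hi => ?_
    rw [segInt_smul_single, segInt_smul_single, ← intervalIntegral.integral_const_mul,
      ← intervalIntegral.integral_add]
    · have := intervalIntegral.smul_integral_comp_mul_add (a := 0) (b := 1)
        (fun t => Ψ (shearPoint k k' ε t
          (edgeHeight (fun i => v i k + ε * v i k') (fun i => v i k') i t)))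
        (v (i + 1) k + ε * v (i + 1) k' - (v i k + ε * v i k')) (v i k + ε * v i k')
      rw [mul_zero, mul_one, zero_add, sub_add_cancel] at this
      rw [← this, smul_eq_mul, ← intervalIntegral.integral_const_mul]
      refine intervalIntegral.integral_congr fun s _ => ?_
      have e := edge_param hk (hε i hi) s
      rw [add_comm (v i k + ε * v i k'), mul_comm s] at e
      simp only [e]
      ring
    · exact Continuous.intervalIntegrable (by have := hΨ.continuous; fun_prop) _ _
    · exact Continuous.intervalIntegrable (by have := hΨ.continuous; fun_prop) _ _
  · have := hΨ.continuous
    unfold shearPoint Function.uncurry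
    fun_prop
  · intro t z hz
    apply hR
    have := PiLp.norm_apply_le (shearPoint k k' ε t z) k'
    rw [shearPoint_snd hk, Real.norm_eq_abs] at this
    linarith
  · intro t z ht
    apply hR
    have h1 := PiLp.norm_apply_le (shearPoint k k' ε t z) k'
    have h2 := PiLp.norm_apply_le (shearPoint k k' ε t z) k
    rw [shearPoint_snd hk, Real.norm_eq_abs] at h1
    rw [shearPoint_fst hk, Real.norm_eq_abs] at h2
    have h3 : |t| ≤ |t - ε * z| + |ε * z| := by
      have := abs_add_le (t - ε * z) (ε * z)
      rwa [sub_add_cancel] at this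
    have h4 : |ε * z| ≤ |z| := by
      rw [abs_mul]; exact mul_le_of_le_one_left (abs_nonneg _) hε1
    linarith
  · intro t z
    have hder : HasDerivAt (fun z => shearPoint k k' ε t z)
        (-ε • EuclideanSpace.single k (1:ℝ) + EuclideanSpace.single k' (1:ℝ)) z := by
      unfold shearPoint
      have h1 : HasDerivAt (fun z : ℝ => t - ε * z) (-ε) z := by
        simpa using ((hasDerivAt_id z).const_mul ε).const_sub t
      have h2 := (h1.smul_const (EuclideanSpace.single k (1:ℝ))).add
        ((hasDerivAt_id z).smul_const (EuclideanSpace.single k' (1:ℝ)))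
      rw [one_smul] at h2
      exact h2
    have hd := ((hΨ.differentiable one_ne_zero _).hasFDerivAt.comp_hasDerivAt z hder).deriv
    change |deriv (Ψ ∘ fun z => shearPoint k k' ε t z) z| ≤ _
    rw [hd, ← Real.norm_eq_abs]
    refine (ContinuousLinearMap.le_opNorm _ _).trans
      (mul_le_mul (hD _) ?_ (norm_nonneg _) ((norm_nonneg _).trans (hD 0)))
    refine (norm_add_le _ _).trans ?_
    rw [norm_smul, norm_neg, Real.norm_eq_abs]
    simp only [PiLp.norm_single, norm_one, mul_one]
    linarith

end SimplePolygonBound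

section PolygonCurve

/-- The length of a polygonal path. -/
def polyLength (v : ℕ → Ed 2) (n : ℕ) : ℝ := ∑ i ∈ Finset.range n, dist (v i) (v (i + 1))

lemma polyLength_nonneg (v : ℕ → Ed 2) (n : ℕ) : 0 ≤ polyLength v n :=
  Finset.sum_nonneg fun _ _ => dist_nonneg

lemma lipschitzWith_glue {K : ℝ≥0} {f g : ℝ → Ed 2} (hf : LipschitzWith K f)
    (hg : LipschitzWith K g) {a : ℝ} (h : f a = g a) :
    LipschitzWith K fun t => if t ≤ a then f t else g t := by
  have key : ∀ s t, s ≤ t → dist (if s ≤ a then f s else g s) (if t ≤ a then f t else g t) ≤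
      K * (t - s) := by
    intro s t hst
    by_cases ht : t ≤ a
    · rw [if_pos ht, if_pos (hst.trans ht)]
      have := hf.dist_le_mul s t
      rwa [Real.dist_eq, abs_sub_comm, abs_of_nonneg (by linarith)] at this
    · rw [if_neg ht]
      by_cases hs : s ≤ a
      · rw [if_pos hs]
        have h1 := hf.dist_le_mul s a
        have h2 := hg.dist_le_mul a t
        rw [Real.dist_eq, abs_sub_comm, abs_of_nonneg (by linarith)] at h1 h2
        have h3 := dist_triangle (f s) (f a) (g t)
        rw [h] at h3 h1
        linarith
      · rw [if_neg hs]
        have := hg.dist_le_mul s t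
        rwa [Real.dist_eq, abs_sub_comm, abs_of_nonneg (by linarith)] at this
  refine LipschitzWith.of_dist_le_mul fun s t => ?_
  rw [Real.dist_eq]
  rcases le_total s t with h1 | h1
  · exact (key s t h1).trans (by rw [abs_sub_comm]; gcongr; exact le_abs_self _)
  · rw [dist_comm]
    exact (key t s h1).trans (by gcongr; exact le_abs_self _)

lemma integral_inner_deriv_glue {K : ℝ≥0} {f g : ℝ → Ed 2} (hf : LipschitzWith K f)
    (hg : LipschitzWith K g) {a x y : ℝ} (h : f a = g a) (hx : x ≤ a) (hy : a ≤ y)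
    {Φ : Ed 2 → Ed 2} (hΦ : Continuous Φ) :
    ∫ t in x..y, ⟪Φ (if t ≤ a then f t else g t), deriv (fun t => if t ≤ a then f t else g t) t⟫ =
      (∫ t in x..a, ⟪Φ (f t), deriv f t⟫) + ∫ t in a..y, ⟪Φ (g t), deriv g t⟫ := by
  have hl := lipschitzWith_glue hf hg h
  rw [← intervalIntegral.integral_add_adjacent_intervals
    (hl.intervalIntegrable_inner_deriv hΦ x a) (hl.intervalIntegrable_inner_deriv hΦ a y)]
  congr 1
  · refine intervalIntegral.integral_congr_Ioo_of_le hx fun t ht => ?_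
    have : (fun t => if t ≤ a then f t else g t) =ᶠ[nhds t] f := by
      filter_upwards [Iio_mem_nhds ht.2] with s hs
      exact if_pos (Set.mem_Iio.1 hs).le
    simp only [this.deriv_eq, if_pos ht.2.le]
  · refine intervalIntegral.integral_congr_Ioo_of_le hy fun t ht => ?_
    have : (fun t => if t ≤ a then f t else g t) =ᶠ[nhds t] g := by
      filter_upwards [Ioi_mem_nhds ht.1] with s hs
      exact if_neg (not_le.2 hs)
    simp only [this.deriv_eq, if_neg (not_le.2 ht.1)]

lemma exists_arclength_segment (p q : Ed 2) (a : ℝ) :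
    ∃ g : ℝ → Ed 2, LipschitzWith 1 g ∧ g a = p ∧ g (a + dist p q) = q ∧
      ∀ Φ : Ed 2 → Ed 2, ∫ t in a..(a + dist p q), ⟪Φ (g t), deriv g t⟫ = segInt Φ p q := by
  set d := dist p q with hd
  set u : Ed 2 := d⁻¹ • (q - p) with hu
  have hdu : d • u = q - p := by
    rcases eq_or_ne d 0 with h | h
    · rw [h, zero_smul, dist_eq_zero.1 h, sub_self]
    · rw [hu, smul_inv_smul₀ h]
  have hnu : ‖u‖ ≤ 1 := by
    rw [hu, norm_smul, ← dist_eq_norm, dist_comm, ← hd, norm_inv, Real.norm_eq_abs,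
      abs_of_nonneg dist_nonneg]
    exact inv_mul_le_one
  refine ⟨fun t => p + (t - a) • u, ?_, by simp, by simp [hdu], fun Φ => ?_⟩
  · refine LipschitzWith.of_dist_le_mul fun s t => ?_
    rw [dist_add_left, dist_eq_norm, ← sub_smul, sub_sub_sub_cancel_right, norm_smul,
      NNReal.coe_one, one_mul, Real.dist_eq]
    exact mul_le_of_le_one_right (abs_nonneg _) hnu
  · have hder : ∀ t, deriv (fun t => p + (t - a) • u) t = u := fun t => by
      have h := (((hasDerivAt_id t).sub_const a).smul_const u).const_add p
      rw [one_smul] at h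
      exact h.deriv
    simp only [hder]
    have := intervalIntegral.smul_integral_comp_mul_add (a := 0) (b := 1)
      (fun t => ⟪Φ (p + (t - a) • u), u⟫) d a
    rw [mul_zero, mul_one, zero_add, add_comm d a] at this
    rw [← this, smul_eq_mul, ← intervalIntegral.integral_const_mul]
    unfold segInt
    refine intervalIntegral.integral_congr fun s _ => ?_
    simp only [add_sub_cancel_right]
    rw [← real_inner_smul_right, mul_comm d s, mul_smul, hdu]

lemma exists_arclength_polygon (v : ℕ → Ed 2) (n : ℕ) :
    ∃ g : ℝ → Ed 2, LipschitzWith 1 g ∧ g 0 = v 0 ∧ g (polyLength v n) = v n ∧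
      ∀ Φ : Ed 2 → Ed 2, Continuous Φ → ∫ t in (0:ℝ)..(polyLength v n), ⟪Φ (g t), deriv g t⟫ =
        ∑ i ∈ Finset.range n, segInt Φ (v i) (v (i + 1)) := by
  induction n with
  | zero =>
    exact ⟨fun _ => v 0, LipschitzWith.const' (v 0), rfl, rfl, fun Φ _ => by simp [polyLength]⟩
  | succ n ih =>
    obtain ⟨f, hf, f0, fn, fi⟩ := ih
    obtain ⟨g, hg, ga, gb, gi⟩ := exists_arclength_segment (v n) (v (n + 1)) (polyLength v n)
    set a := polyLength v n with ha
    have ha0 : 0 ≤ a := polyLength_nonneg v n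
    have hb : polyLength v (n + 1) = a + dist (v n) (v (n + 1)) := by
      rw [polyLength, Finset.sum_range_succ]; rfl
    have hab : a ≤ a + dist (v n) (v (n + 1)) := by linarith [dist_nonneg (x := v n) (y := v (n + 1))]
    have hl := lipschitzWith_glue hf hg (fn.trans ga.symm)
    refine ⟨_, hl, by simp [ha0, f0], ?_, fun Φ hΦ => ?_⟩
    · rw [hb]
      split_ifs with h
      · have h0 : dist (v n) (v (n + 1)) = 0 := le_antisymm (by linarith) dist_nonneg
        rw [h0, add_zero, fn, dist_eq_zero.1 h0]
      · exact gb
    · rw [hb, Finset.sum_range_succ, ← fi Φ hΦ, ← gi Φ,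
        integral_inner_deriv_glue hf hg (fn.trans ga.symm) ha0 hab hΦ]

lemma integral_inner_deriv_comp_mul (g : ℝ → Ed 2) (Φ : Ed 2 → Ed 2) (ℓ : ℝ) (c a b : ℝ) :
    ∫ t in a..b, ⟪Φ (g (c + ℓ * t)), deriv (fun t => g (c + ℓ * t)) t⟫ =
      ∫ t in (c + ℓ * a)..(c + ℓ * b), ⟪Φ (g t), deriv g t⟫ := by
  rw [← intervalIntegral.smul_integral_comp_add_mul, smul_eq_mul,
    ← intervalIntegral.integral_const_mul]
  refine intervalIntegral.integral_congr fun s _ => ?_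
  have : deriv (fun t => g (c + ℓ * t)) s = ℓ • deriv g (c + ℓ * s) := by
    have := deriv_comp_mul_left ℓ (fun t => g (c + t)) s
    rw [deriv_comp_const_add] at this
    exact this
  simp only [this, real_inner_smul_right]

lemma exists_memJball_polygon {n : ℕ} {v : ℕ → Ed 2} (h : v n = v 0) (hℓ : 0 < polyLength v n) :
    ∃ σ τ, memJball σ τ ∧ ∀ Φ : Ed 2 → Ed 2, Continuous Φ → HasCompactSupport Φ →
      Jpair σ τ Φ = (polyLength v n)⁻¹ *
        ∑ i ∈ Finset.range n, segInt Φ (v i) (v (i + 1)) := by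
  obtain ⟨g, hg, g0, gn, gi⟩ := exists_arclength_polygon v n
  obtain ⟨σ, τ, hp, hd, hm, hJ⟩ := hg.exists_polar_divFree hℓ.le (by rw [g0, gn, h])
  refine ⟨ENNReal.ofReal (polyLength v n)⁻¹ • σ, τ, ⟨hp.ofReal_smul _, hd.ofReal_smul _, ?_⟩,
    fun Φ hΦ hs => ?_⟩
  · rw [Measure.smul_apply, smul_eq_mul]
    refine (mul_le_mul_right hm _).trans ?_
    rw [NNReal.coe_one, one_mul, sub_zero, ← ENNReal.ofReal_mul (by positivity),
      inv_mul_cancel₀ hℓ.ne', ENNReal.ofReal_one]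
  · rw [Jpair_ofReal_smul (by positivity), hJ Φ hΦ hs, gi Φ hΦ]

end PolygonCurve

/-- A functional on test fields that is represented by an element of the unit ball of
`J(ℝ²)`. -/
def IsBallFunctional (L : (Ed 2 → Ed 2) → ℝ) : Prop :=
  ∃ (σ : Measure (Ed 2)) (τ : Ed 2 → Ed 2), memJball σ τ ∧
    ∀ Φ : Ed 2 → Ed 2, Continuous Φ → HasCompactSupport Φ → L Φ = Jpair σ τ Φ

theorem isBallFunctional_zero : IsBallFunctional (fun _ => 0) := by
  refine ⟨0, fun _ => 0, ⟨isPolarVM_zero measurable_const, ?_, by simp⟩, ?_⟩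
  · intro φ _ _
    simp
  · intro Φ _ _
    simp [Jpair]

theorem IsBallFunctional.apply_gradient {L : (Ed 2 → Ed 2) → ℝ} (h : IsBallFunctional L)
    {φ : Ed 2 → ℝ} (hφ : ContDiff ℝ (⊤ : ℕ∞) φ) (hs : HasCompactSupport φ) :
    L (gradient φ) = 0 := by
  obtain ⟨σ, τ, h1, h2⟩ := h
  have h3 : ContDiff ℝ 1 φ := hφ.of_le (by exact_mod_cast le_top)
  rw [h2 _ (continuous_gradient h3) (hasCompactSupport_gradient hs)]
  exact divFree_iff.1 h1.2.1 φ hφ hs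

theorem integrable_inner_truncId (m : Measure (Ed 2 × Ed 2)) [IsFiniteMeasure m]
    {Φ : Ed 2 → Ed 2} (hΦ : Continuous Φ) (hs : HasCompactSupport Φ) :
    Integrable (fun z : Ed 2 × Ed 2 => (⟪Φ z.1, truncId z.2⟫ : ℝ)) m := by
  obtain ⟨C, hC, hb⟩ := exists_norm_le_of_hasCompactSupport hΦ hs
  refine Integrable.of_bound (C := C) ?_ (Eventually.of_forall fun z => ?_)
  · exact ((hΦ.comp continuous_fst).inner
      (continuous_truncId.comp continuous_snd)).aestronglyMeasurable
  · calc ‖(⟪Φ z.1, truncId z.2⟫ : ℝ)‖ ≤ ‖Φ z.1‖ * ‖truncId z.2‖ := norm_inner_le_norm _ _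
      _ ≤ C * 1 := by gcongr; exacts [hb _, norm_truncId_le _]
      _ = C := mul_one C

theorem exists_measure_of_combination {ι : Type*} (t : Finset ι) (w : ι → ℝ)
    (L : ι → (Ed 2 → Ed 2) → ℝ) (hw : ∀ i, 0 ≤ w i) (hL : ∀ i, IsBallFunctional (L i)) :
    ∃ m : Measure (Ed 2 × Ed 2), IsFiniteMeasure m ∧ m.real Set.univ ≤ ∑ i ∈ t, w i ∧
      ∀ Φ : Ed 2 → Ed 2, Continuous Φ → HasCompactSupport Φ →
        ∫ z, ⟪Φ z.1, truncId z.2⟫ ∂m = ∑ i ∈ t, w i * L i Φ := by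
  classical
  induction t using Finset.induction_on with
  | empty => exact ⟨0, inferInstance, by simp, by simp⟩
  | insert j t hj ih =>
    obtain ⟨m, hm, hmu, hmΦ⟩ := ih
    obtain ⟨σ, τ, ⟨⟨hf, hτ, h1⟩, -, hmass⟩, hLΦ⟩ := hL j
    have hg : Measurable fun x => (x, τ x) := measurable_id.prodMk hτ
    have hfin : IsFiniteMeasure (σ.map fun x => (x, τ x)) := Measure.isFiniteMeasure_map _ _
    have hfin' : IsFiniteMeasure (ENNReal.ofReal (w j) • σ.map fun x => (x, τ x)) :=
      Measure.smul_finite _ ENNReal.ofReal_ne_top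
    refine ⟨m + ENNReal.ofReal (w j) • σ.map (fun x => (x, τ x)), inferInstance, ?_, ?_⟩
    · rw [measureReal_add_apply, measureReal_ennreal_smul_apply, Finset.sum_insert hj, add_comm,
        ENNReal.toReal_ofReal (hw j)]
      refine add_le_add ?_ hmu
      have : (σ.map fun x => (x, τ x)).real Set.univ ≤ 1 := by
        rw [measureReal_def, Measure.map_apply hg MeasurableSet.univ]
        exact ENNReal.toReal_le_of_le_ofReal zero_le_one (by simpa using hmass)
      nlinarith [hw j]
    · intro Φ hΦ hs
      rw [integral_add_measure (integrable_inner_truncId _ hΦ hs)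
        (integrable_inner_truncId _ hΦ hs), integral_smul_measure,
        integral_map hg.aemeasurable (((hΦ.comp continuous_fst).inner
          (continuous_truncId.comp continuous_snd)).aestronglyMeasurable), hmΦ Φ hΦ hs,
        Finset.sum_insert hj, add_comm, ENNReal.toReal_ofReal (hw j), hLΦ Φ hΦ hs, Jpair,
        smul_eq_mul]
      congr 2
      refine integral_congr_ae (h1.mono fun x hx => ?_)
      simp only
      rw [truncId_of_norm_le hx.le]

/-- Ultralimits of finite combinations of unit-ball functionals with total weight converging to
`θ` are represented by a divergence-free measure of mass at most `θ`. -/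
theorem exists_polar_divFree_of_ultralimit {α : Type*} (𝒰 : Ultrafilter α) {ι : α → Type*}
    (t : ∀ a, Finset (ι a)) (w : ∀ a, ι a → ℝ) (L : ∀ a, ι a → (Ed 2 → Ed 2) → ℝ)
    (hw : ∀ a i, 0 ≤ w a i) (hL : ∀ a i, IsBallFunctional (L a i)) {θ : ℝ}
    (hθ : Tendsto (fun a => ∑ i ∈ t a, w a i) 𝒰 (nhds θ)) :
    ∃ (σ : Measure (Ed 2)) (τ : Ed 2 → Ed 2), IsPolarVM σ τ ∧ DivFree σ τ ∧
      σ Set.univ ≤ ENNReal.ofReal θ ∧ ∀ Φ : Ed 2 → Ed 2, Continuous Φ → HasCompactSupport Φ →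
        Tendsto (fun a => ∑ i ∈ t a, w a i * L a i Φ) 𝒰 (nhds (Jpair σ τ Φ)) := by
  choose m hmf hmu hmΦ using fun a =>
    exists_measure_of_combination (t a) (w a) (L a) (hw a) (hL a)
  obtain ⟨θ', hθ'⟩ : ∃ θ', Tendsto (fun a => (m a).real Set.univ) 𝒰 (nhds θ') := by
    refine 𝒰.exists_tendsto_of_bounded (x₀ := 0) (C := θ + 1) ?_
    filter_upwards [hθ.eventually_le_const (lt_add_one θ)] with a ha
    rw [Real.dist_eq, sub_zero, abs_of_nonneg measureReal_nonneg]
    exact (hmu a).trans ha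
  have hle : θ' ≤ θ := le_of_tendsto_of_tendsto' hθ' hθ hmu
  obtain ⟨σ, τ, hp, hmass, hlim⟩ := exists_polar_of_ultralimit 𝒰 m hθ'
  have hlim' : ∀ Φ : Ed 2 → Ed 2, Continuous Φ → HasCompactSupport Φ →
      Tendsto (fun a => ∑ i ∈ t a, w a i * L a i Φ) 𝒰 (nhds (Jpair σ τ Φ)) :=
    fun Φ hΦ hs => (hlim Φ hΦ hs).congr fun a => hmΦ a Φ hΦ hs
  refine ⟨σ, τ, hp, ?_, hmass.trans (ENNReal.ofReal_le_ofReal hle), hlim'⟩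
  rw [divFree_iff]
  intro φ hφ hs
  have h3 : ContDiff ℝ 1 φ := hφ.of_le (by exact_mod_cast le_top)
  refine tendsto_nhds_unique (hlim' _ (continuous_gradient h3) (hasCompactSupport_gradient hs)) ?_
  refine tendsto_const_nhds.congr fun a => (Finset.sum_eq_zero fun i _ => ?_).symm
  rw [(hL a i).apply_gradient hφ hs, mul_zero]

/-- If convex combinations of unit-ball functionals converge to an extreme point, then so does,
up to normalization, each partial combination. -/
theorem IsExtremeJ.tendsto_partial_combination {σ : Measure (Ed 2)} {τ : Ed 2 → Ed 2}
    (h : IsExtremeJ σ τ) {α : Type*} (𝒰 : Ultrafilter α) {ι : α → Type*} [∀ a, Fintype (ι a)]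
    (p : ∀ a, ι a → Prop) [∀ a, DecidablePred (p a)]
    (w : ∀ a, ι a → ℝ) (L : ∀ a, ι a → (Ed 2 → Ed 2) → ℝ)
    (hw : ∀ a i, 0 ≤ w a i) (hw1 : ∀ a, ∑ i, w a i = 1) (hL : ∀ a i, IsBallFunctional (L a i))
    (hlim : ∀ Φ : Ed 2 → Ed 2, Continuous Φ → HasCompactSupport Φ →
      Tendsto (fun a => ∑ i, w a i * L a i Φ) 𝒰 (nhds (Jpair σ τ Φ))) :
    ∃ θ, 0 ≤ θ ∧ Tendsto (fun a => ∑ i with p a i, w a i) 𝒰 (nhds θ) ∧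
      ∀ Φ : Ed 2 → Ed 2, Continuous Φ → HasCompactSupport Φ →
        Tendsto (fun a => ∑ i with p a i, w a i * L a i Φ) 𝒰 (nhds (θ * Jpair σ τ Φ)) := by
  have h0 : ∀ a, 0 ≤ ∑ i with p a i, w a i := fun a => Finset.sum_nonneg fun i _ => hw a i
  have h1 : ∀ a, ∑ i with p a i, w a i ≤ 1 := fun a => by
    rw [← hw1 a]
    exact Finset.sum_le_sum_of_subset_of_nonneg (Finset.subset_univ _) fun i _ _ => hw a i
  obtain ⟨θ, hθ⟩ : ∃ θ, Tendsto (fun a => ∑ i with p a i, w a i) 𝒰 (nhds θ) := by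
    refine 𝒰.exists_tendsto_of_bounded (x₀ := 0) (C := 1) (Eventually.of_forall fun a => ?_)
    rw [Real.dist_eq, sub_zero, abs_of_nonneg (h0 a)]
    exact h1 a
  have hθ0 : 0 ≤ θ := ge_of_tendsto' hθ h0
  have hθ1 : θ ≤ 1 := le_of_tendsto' hθ h1
  have hθ' : Tendsto (fun a => ∑ i with ¬ p a i, w a i) 𝒰 (nhds (1 - θ)) := by
    refine (tendsto_const_nhds.sub hθ).congr fun a => ?_
    rw [← hw1 a, ← Finset.sum_filter_add_sum_filter_not Finset.univ (p a), add_sub_cancel_left]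
  obtain ⟨σ₁, τ₁, p₁, d₁, m₁, l₁⟩ := exists_polar_divFree_of_ultralimit 𝒰 _ w L hw hL hθ
  obtain ⟨σ₂, τ₂, p₂, d₂, m₂, l₂⟩ := exists_polar_divFree_of_ultralimit 𝒰 _ w L hw hL hθ'
  refine ⟨θ, hθ0, hθ, fun Φ hΦ hs => ?_⟩
  rw [← h.eq_mul_of_add_eq hθ0 hθ1 p₁ p₂ d₁ d₂ m₁ m₂ (fun Φ hΦ hs => ?_) hΦ hs]
  · exact l₁ Φ hΦ hs
  · refine tendsto_nhds_unique ((l₁ Φ hΦ hs).add (l₂ Φ hΦ hs)) ((hlim Φ hΦ hs).congr fun a => ?_)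
    rw [Finset.sum_filter_add_sum_filter_not]

/-- A finite family of convex weights on functionals in `S` whose combination is `ε`-close to `M`
on the finite set `F` of test fields. -/
def ApproxByCombination (S : Set ((Ed 2 → Ed 2) → ℝ)) (M : (Ed 2 → Ed 2) → ℝ)
    (F : Finset (Ed 2 → Ed 2)) (ε : ℝ) : Prop :=
  ∃ (ι : Type) (_ : Fintype ι) (w : ι → ℝ) (L : ι → (Ed 2 → Ed 2) → ℝ),
    (∀ i, 0 ≤ w i) ∧ ∑ i, w i = 1 ∧ (∀ i, L i ∈ S) ∧ ∀ Φ ∈ F, |∑ i, w i * L i Φ - M Φ| < ε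

/-- Milman's converse of the Krein–Milman theorem: an extreme point that is approximated by convex
combinations of functionals in `S` is approximated by elements of `S`. -/
theorem IsExtremeJ.exists_mem_abs_sub_lt {σ : Measure (Ed 2)} {τ : Ed 2 → Ed 2}
    (h : IsExtremeJ σ τ) {S : Set ((Ed 2 → Ed 2) → ℝ)} (hS : ∀ L ∈ S, IsBallFunctional L)
    (happ : ∀ F : Finset (Ed 2 → Ed 2), (∀ Φ ∈ F, Continuous Φ ∧ HasCompactSupport Φ) →
      ∀ ε, 0 < ε → ApproxByCombination S (Jpair σ τ) F ε)
    {F : Finset (Ed 2 → Ed 2)} (hF : ∀ Φ ∈ F, Continuous Φ ∧ HasCompactSupport Φ)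
    {ε : ℝ} (hε : 0 < ε) : ∃ L ∈ S, ∀ Φ ∈ F, |L Φ - Jpair σ τ Φ| < ε := by
  classical
  by_contra! hcon
  have key : ∀ a : Finset {Φ : Ed 2 → Ed 2 // Continuous Φ ∧ HasCompactSupport Φ} × ℕ,
      ApproxByCombination S (Jpair σ τ) (a.1.image Subtype.val) (1 / ((a.2 : ℝ) + 1)) := by
    intro a
    refine happ _ (fun Φ hΦ => ?_) _ (by positivity)
    obtain ⟨Ψ, -, rfl⟩ := Finset.mem_image.1 hΦ
    exact Ψ.2
  choose ι hι w L hw hw1 hLS happr using key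
  set 𝒰 := Ultrafilter.of
    (atTop : Filter (Finset {Φ : Ed 2 → Ed 2 // Continuous Φ ∧ HasCompactSupport Φ} × ℕ)) with h𝒰
  have hle : 𝒰.toFilter ≤ atTop := Ultrafilter.of_le _
  have hlim : ∀ Φ : Ed 2 → Ed 2, Continuous Φ → HasCompactSupport Φ →
      Tendsto (fun a => ∑ i, w a i * L a i Φ) 𝒰 (nhds (Jpair σ τ Φ)) := by
    intro Φ hΦ hs
    refine Tendsto.mono_left ?_ hle
    rw [tendsto_iff_dist_tendsto_zero]
    have hz : Tendsto (fun a : Finset {Φ : Ed 2 → Ed 2 // Continuous Φ ∧ HasCompactSupport Φ} × ℕ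
        => 1 / ((a.2 : ℝ) + 1)) atTop (nhds 0) :=
      tendsto_one_div_add_atTop_nhds_zero_nat.comp
        (by rw [← prod_atTop_atTop_eq]; exact tendsto_snd)
    refine squeeze_zero' (Eventually.of_forall fun _ => dist_nonneg) ?_ hz
    filter_upwards [eventually_ge_atTop (({⟨Φ, hΦ, hs⟩} : Finset _), 0)] with a ha
    exact (happr a Φ (Finset.mem_image_of_mem Subtype.val
      (ha.1 (Finset.mem_singleton_self (⟨Φ, hΦ, hs⟩ : {Φ : Ed 2 → Ed 2 // _}))))).le
  have hsmall : ∀ Φ ∈ F, ∀ s : ℝ,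
      Tendsto (fun a => ∑ i with ε ≤ s * (L a i Φ - Jpair σ τ Φ), w a i) 𝒰 (nhds 0) := by
    intro Φ hΦ s
    obtain ⟨θ, hθ0, hθ, hθΦ⟩ := h.tendsto_partial_combination 𝒰
      (fun a i => ε ≤ s * (L a i Φ - Jpair σ τ Φ)) w L hw hw1 (fun a i => hS _ (hLS a i)) hlim
    have hle' : ε * θ ≤ s * (θ * Jpair σ τ Φ - θ * Jpair σ τ Φ) := by
      refine le_of_tendsto_of_tendsto' (hθ.const_mul ε)
        (((hθΦ Φ (hF Φ hΦ).1 (hF Φ hΦ).2).sub (hθ.mul_const _)).const_mul s) fun a => ?_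
      rw [Finset.sum_mul, ← Finset.sum_sub_distrib, Finset.mul_sum, Finset.mul_sum]
      refine Finset.sum_le_sum fun i hi => ?_
      have := mul_le_mul_of_nonneg_left (Finset.mem_filter.1 hi).2 (hw a i)
      linarith
    have : θ = 0 := by nlinarith
    rwa [this] at hθ
  have hsum : Tendsto (fun a => ∑ Φ ∈ F, ((∑ i with ε ≤ 1 * (L a i Φ - Jpair σ τ Φ), w a i)
      + ∑ i with ε ≤ -1 * (L a i Φ - Jpair σ τ Φ), w a i)) 𝒰 (nhds 0) := by
    have := tendsto_finsetSum F fun Φ hΦ => (hsmall Φ hΦ 1).add (hsmall Φ hΦ (-1))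
    simpa using this
  have : (1 : ℝ) ≤ 0 := by
    refine ge_of_tendsto' hsum fun a => ?_
    refine (hw1 a).ge.trans ?_
    simp_rw [Finset.sum_filter, ← Finset.sum_add_distrib]
    rw [Finset.sum_comm]
    refine Finset.sum_le_sum fun i _ => ?_
    obtain ⟨Φ, hΦ, hb⟩ := hcon _ (hLS a i)
    have hnn : ∀ Ψ ∈ F, 0 ≤ (if ε ≤ 1 * (L a i Ψ - Jpair σ τ Ψ) then w a i else 0)
        + if ε ≤ -1 * (L a i Ψ - Jpair σ τ Ψ) then w a i else 0 := fun Ψ _ => by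
      have := hw a i
      split_ifs <;> linarith
    refine le_trans ?_ (Finset.single_le_sum hnn hΦ)
    have := hw a i
    rcases le_abs.1 hb with hb | hb
    · rw [if_pos (by linarith)]
      split_ifs <;> linarith
    · rw [if_pos (show ε ≤ -1 * (L a i Φ - Jpair σ τ Φ) by linarith)]
      split_ifs <;> linarith
  linarith

/-- The zero functional and the normalized simple closed polygons. -/
def polygonFunctionals : Set ((Ed 2 → Ed 2) → ℝ) :=
  {L | (L = fun _ => 0) ∨ ∃ n v, SimplePoly n v ∧ 0 < polyLength v n ∧
    L = fun Φ => (polyLength v n)⁻¹ * ∑ i ∈ Finset.range n, segInt Φ (v i) (v (i + 1))}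

theorem isBallFunctional_of_mem_polygonFunctionals {L : (Ed 2 → Ed 2) → ℝ}
    (hL : L ∈ polygonFunctionals) : IsBallFunctional L := by
  rcases hL with rfl | ⟨n, v, hv, hpos, rfl⟩
  · exact isBallFunctional_zero
  · obtain ⟨σ, τ, h, hJ⟩ := exists_memJball_polygon hv.1 hpos
    exact ⟨σ, τ, h, fun Φ hΦ hs => (hJ Φ hΦ hs).symm⟩

theorem polyLength_pos_of_simplePoly {n : ℕ} {v : ℕ → Ed 2} (hv : SimplePoly n v) (hn : 0 < n) :
    0 < polyLength v n :=
  Finset.sum_pos' (fun _ _ => dist_nonneg)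
    ⟨0, Finset.mem_range.2 hn, dist_pos.2 (hv.2.1 0 hn)⟩

theorem IsPolarVM.Jpair_sum_smul {σ : Measure (Ed 2)} {τ : Ed 2 → Ed 2} (h : IsPolarVM σ τ)
    {κ : Type*} (t : Finset κ) (c : κ → ℝ) (Φ : κ → Ed 2 → Ed 2)
    (hΦ : ∀ k, Continuous (Φ k) ∧ HasCompactSupport (Φ k)) :
    Jpair σ τ (fun x => ∑ k ∈ t, c k • Φ k x) = ∑ k ∈ t, c k * Jpair σ τ (Φ k) := by
  unfold Jpair
  simp_rw [sum_inner, real_inner_smul_left]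
  rw [integral_finsetSum]
  · simp_rw [integral_const_mul]
  · exact fun k _ => (h.integrable_pair (hΦ k).1 (hΦ k).2).const_mul _

/-- Every element of the unit ball of `J(ℝ²)` is approximated on finitely many test fields by
convex combinations of normalized simple closed polygons and zero. -/
theorem memJball.approxByCombination {σ : Measure (Ed 2)} {τ : Ed 2 → Ed 2} (h : memJball σ τ)
    {F : Finset (Ed 2 → Ed 2)} (hF : ∀ Φ ∈ F, Continuous Φ ∧ HasCompactSupport Φ)
    {ε : ℝ} (hε : 0 < ε) : ApproxByCombination polygonFunctionals (Jpair σ τ) F ε := by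
  classical
  let ev : ((Ed 2 → Ed 2) → ℝ) → (F → ℝ) := fun L Φ => L Φ
  by_cases hmem : ev (Jpair σ τ) ∈ closure (convexHull ℝ (ev '' polygonFunctionals))
  · obtain ⟨y, hy, hd⟩ := Metric.mem_closure_iff.1 hmem ε hε
    obtain ⟨ι, hι, w, z, hw, hw1, hz, rfl⟩ := mem_convexHull_iff_exists_fintype.1 hy
    choose L hL hLz using hz
    refine ⟨ι, hι, w, L, hw, hw1, hL, fun Φ hΦ => ?_⟩
    have h1 := (dist_le_pi_dist (ev (Jpair σ τ)) (∑ i, w i • z i) ⟨Φ, hΦ⟩).trans_lt hd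
    rw [dist_comm, Real.dist_eq, Finset.sum_apply] at h1
    simpa [← hLz, ev] using h1
  exfalso
  obtain ⟨f, u, hfu, huf⟩ := geometric_hahn_banach_closed_point
    (convex_convexHull ℝ _).closure isClosed_closure hmem
  have hfu' : ∀ L ∈ polygonFunctionals, f (ev L) < u := fun L hL =>
    hfu _ (subset_closure (subset_convexHull ℝ _ ⟨L, hL, rfl⟩))
  have hu : 0 < u := by
    have h0 := hfu' (fun _ => 0) (Or.inl rfl)
    have : ev (fun _ => 0) = 0 := rfl
    rwa [this, map_zero] at h0
  set c : F → ℝ := fun Φ => f (Pi.single Φ 1) with hc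
  set Φs : Ed 2 → Ed 2 := fun x => ∑ Φ : F, c Φ • (Φ : Ed 2 → Ed 2) x with hΦs
  have hF' : ∀ Φ : F, Continuous (Φ : Ed 2 → Ed 2) ∧ HasCompactSupport (Φ : Ed 2 → Ed 2) :=
    fun Φ => hF Φ Φ.2
  have hcont : Continuous Φs := continuous_finsetSum _ fun Φ _ => (hF' Φ).1.const_smul (c Φ)
  have hcpt : HasCompactSupport Φs := by
    have : IsCompact (⋃ Φ : F, tsupport (Φ : Ed 2 → Ed 2)) :=
      isCompact_iUnion fun Φ => (hF' Φ).2
    refine HasCompactSupport.intro this fun x hx => Finset.sum_eq_zero fun Φ _ => ?_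
    rw [image_eq_zero_of_notMem_tsupport fun h => hx (Set.mem_iUnion.2 ⟨Φ, h⟩), smul_zero]
  have hf : ∀ x : F → ℝ, f x = ∑ Φ, c Φ * x Φ := by
    intro x
    have := LinearMap.pi_apply_eq_sum_univ (f : (F → ℝ) →ₗ[ℝ] ℝ) x
    simp only [ContinuousLinearMap.coe_coe] at this
    rw [this]
    refine Finset.sum_congr rfl fun Φ _ => ?_
    rw [smul_eq_mul, mul_comm]
    congr 2
    funext j
    simp [Pi.single_apply, eq_comm]
  have hJ : ∀ σ' τ', IsPolarVM σ' τ' → Jpair σ' τ' Φs = f (ev (Jpair σ' τ')) := by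
    intro σ' τ' h'
    rw [hf, h'.Jpair_sum_smul _ _ _ hF']
  refine huf.not_ge ?_
  rw [← hJ σ τ h.1]
  refine h.Jpair_le_of_path_cost_nonneg hcont hcpt hu.le fun m p s hs => ?_
  by_contra! hneg
  obtain ⟨n, v, hv, hsum⟩ := exists_simplePoly_of_neg
    (κ := fun p q => u * dist p q - segInt Φs p q) (fun p q z hz => by
      rw [← segInt_split hcont hz, ← dist_add_dist_of_mem_segment hz]
      ring) (fun p q => by
      rw [segInt_symm, dist_comm q p]
      have := mul_nonneg hu.le (dist_nonneg (x := p) (y := q))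
      linarith) hs hneg
  have hn : 0 < n := by
    rcases Nat.eq_zero_or_pos n with rfl | hn
    · simp at hsum
    · exact hn
  have hpos := polyLength_pos_of_simplePoly hv hn
  have hlt := hfu' _ (Or.inr ⟨n, v, hv, hpos, rfl⟩)
  obtain ⟨σ', τ', h', hJ'⟩ := exists_memJball_polygon hv.1 hpos
  have heq : ev (fun Φ => (polyLength v n)⁻¹ *
      ∑ i ∈ Finset.range n, segInt Φ (v i) (v (i + 1))) = ev (Jpair σ' τ') :=
    funext fun Φ => (hJ' _ (hF' Φ).1 (hF' Φ).2).symm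
  rw [heq, ← hJ σ' τ' h'.1, hJ' _ hcont hcpt, inv_mul_lt_iff₀ hpos] at hlt
  rw [Finset.sum_sub_distrib, ← Finset.mul_sum] at hsum
  change u * polyLength v n - _ < 0 at hsum
  linarith [mul_comm u (polyLength v n)]

/-- Extreme points are limits of normalized simple closed polygons and zero. -/
theorem IsExtremeJ.exists_mem_polygonFunctionals {σ : Measure (Ed 2)} {τ : Ed 2 → Ed 2}
    (h : IsExtremeJ σ τ) {F : Finset (Ed 2 → Ed 2)}
    (hF : ∀ Φ ∈ F, Continuous Φ ∧ HasCompactSupport Φ) {ε : ℝ} (hε : 0 < ε) :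
    ∃ L ∈ polygonFunctionals, ∀ Φ ∈ F, |L Φ - Jpair σ τ Φ| < ε :=
  h.exists_mem_abs_sub_lt (fun _ hL => isBallFunctional_of_mem_polygonFunctionals hL)
    (fun _ hF' _ hε' => h.1.approxByCombination hF' hε') hF hε

section Convergence

variable {γ : ℝ → Ed 2} {K : ℝ≥0}

theorem LipschitzWith.integral_inner_const_deriv (hγ : LipschitzWith K γ) (c : Ed 2) (a b : ℝ) :
    ∫ t in a..b, (⟪c, deriv γ t⟫ : ℝ) = ⟪c, γ b - γ a⟫ := by
  have h := hγ.integral_fderiv_deriv (innerSL ℝ c).contDiff a b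
  simp only [ContinuousLinearMap.fderiv, innerSL_apply_apply] at h
  rw [h, inner_sub_right]

theorem LipschitzWith.abs_integral_inner_deriv_sub_le (hγ : LipschitzWith K γ)
    {Φ : Ed 2 → Ed 2} (hΦ : Continuous Φ) {a b : ℝ} (hab : a ≤ b) {ε : ℝ}
    (hε : ∀ t ∈ Set.Icc a b, ‖Φ (γ t) - Φ (γ a)‖ ≤ ε) :
    |(∫ t in a..b, ⟪Φ (γ t), deriv γ t⟫) - ⟪Φ (γ a), γ b - γ a⟫| ≤ ε * K * (b - a) := by
  rw [← hγ.integral_inner_const_deriv, ← intervalIntegral.integral_sub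
    (hγ.intervalIntegrable_inner_deriv hΦ a b)
    (hγ.intervalIntegrable_inner_deriv (continuous_const (y := Φ (γ a))) a b),
    ← Real.norm_eq_abs, ← abs_of_nonneg (sub_nonneg.2 hab)]
  refine intervalIntegral.norm_integral_le_of_norm_le_const fun t ht => ?_
  rw [Set.uIoc_of_le hab] at ht
  rw [← inner_sub_left]
  have h1 := hε t (Set.Ioc_subset_Icc_self ht)
  exact (norm_inner_le_norm _ _).trans
    (mul_le_mul h1 (hγ.norm_deriv_le t) (norm_nonneg _) ((norm_nonneg _).trans h1))

/-- Riemann sums of a vector field along a Lipschitz curve converge uniformly. -/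
theorem LipschitzWith.abs_integral_inner_deriv_sub_sum_le (hγ : LipschitzWith K γ)
    {Φ : Ed 2 → Ed 2} (hΦ : Continuous Φ) {ε δ : ℝ}
    (hmod : ∀ x y, dist x y < δ → dist (Φ x) (Φ y) < ε) {N : ℕ} (hN : 0 < N) (hδ : K / N < δ) :
    |(∫ t in (0:ℝ)..1, ⟪Φ (γ t), deriv γ t⟫) - ∑ i ∈ Finset.range N,
      (⟪Φ (γ (i / N)), γ ((i + 1 : ℕ) / N) - γ (i / N)⟫ : ℝ)| ≤ ε * K := by
  have hN' : (0 : ℝ) < N := Nat.cast_pos.2 hN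
  have hsum := intervalIntegral.sum_integral_adjacent_intervals (μ := volume)
    (f := fun t => (⟪Φ (γ t), deriv γ t⟫ : ℝ)) (a := fun i : ℕ => (i : ℝ) / N) (n := N)
    fun i _ => hγ.intervalIntegrable_inner_deriv hΦ _ _
  simp only [Nat.cast_zero, zero_div, div_self hN'.ne'] at hsum
  rw [← hsum, ← Finset.sum_sub_distrib]
  have hlen : ∀ i : ℕ, ((i + 1 : ℕ) : ℝ) / N - i / N = 1 / N := fun i => by
    push_cast
    ring
  refine (Finset.abs_sum_le_sum_abs _ _).trans ((Finset.sum_le_card_nsmul _ _ (ε * K * (1 / N))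
    fun i _ => ?_).trans_eq ?_)
  · have hle : (i : ℝ) / N ≤ (i + 1 : ℕ) / N := by
      rw [← sub_nonneg, hlen]
      positivity
    rw [← hlen i]
    refine hγ.abs_integral_inner_deriv_sub_le hΦ hle fun t ht => ?_
    rw [← dist_eq_norm]
    refine (hmod _ _ ((hγ.dist_le_mul _ _).trans_lt (lt_of_le_of_lt ?_ hδ))).le
    rw [Real.dist_eq, abs_of_nonneg (sub_nonneg.2 ht.1), div_eq_mul_one_div (K : ℝ)]
    gcongr
    rw [← hlen i]
    linarith [ht.2]
  · rw [Finset.card_range, nsmul_eq_mul]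
    field_simp

theorem tendsto_integral_inner_deriv {α : Type*} {l : Filter α} {g : α → ℝ → Ed 2}
    (hg : ∀ a, LipschitzWith K (g a)) (hγ : LipschitzWith K γ)
    (hlim : ∀ t, Tendsto (fun a => g a t) l (nhds (γ t))) {Φ : Ed 2 → Ed 2} (hΦ : Continuous Φ)
    (hs : HasCompactSupport Φ) :
    Tendsto (fun a => ∫ t in (0:ℝ)..1, ⟪Φ (g a t), deriv (g a) t⟫) l
      (nhds (∫ t in (0:ℝ)..1, ⟪Φ (γ t), deriv γ t⟫)) := by
  rw [Metric.tendsto_nhds]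
  intro ε hε
  obtain ⟨δ, hδ, hmod⟩ := Metric.uniformContinuous_iff.1
    (hs.uniformContinuous_of_continuous hΦ) (ε / (3 * (K + 1))) (by positivity)
  obtain ⟨N, hN⟩ := exists_nat_gt ((K : ℝ) / δ)
  have hN0 : 0 < N := by
    rw [← Nat.cast_pos (α := ℝ)]
    exact lt_of_le_of_lt (by positivity) hN
  have hKN : (K : ℝ) / N < δ := by
    rwa [div_lt_comm₀ (Nat.cast_pos.2 hN0) hδ]
  have hsmall : ε / (3 * (K + 1)) * K ≤ ε / 3 := by
    rw [div_mul_eq_mul_div, div_le_div_iff₀ (by positivity) (by positivity)]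
    nlinarith [K.2]
  have hR : Tendsto (fun a => ∑ i ∈ Finset.range N,
      (⟪Φ (g a (i / N)), g a ((i + 1 : ℕ) / N) - g a (i / N)⟫ : ℝ)) l
      (nhds (∑ i ∈ Finset.range N, (⟪Φ (γ (i / N)), γ ((i + 1 : ℕ) / N) - γ (i / N)⟫ : ℝ))) :=
    tendsto_finsetSum _ fun i _ => ((hΦ.tendsto _).comp (hlim _)).inner ((hlim _).sub (hlim _))
  filter_upwards [Metric.tendsto_nhds.1 hR (ε / 3) (by positivity)] with a ha
  have h1 := ((hg a).abs_integral_inner_deriv_sub_sum_le hΦ (fun x y => @hmod x y) hN0 hKN).trans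
    hsmall
  have h2 := (hγ.abs_integral_inner_deriv_sub_sum_le hΦ (fun x y => @hmod x y) hN0 hKN).trans
    hsmall
  rw [Real.dist_eq] at ha ⊢
  rw [abs_le] at h1 h2
  rw [abs_lt] at ha ⊢
  constructor <;> linarith [h1.1, h1.2, h2.1, h2.2, ha.1, ha.2]

end Convergence

/-- A nonzero vector measure is detected by a test field `Ψ • eₖ` with `Ψ` smooth. -/
theorem IsPolarVM.exists_smul_single_Jpair_ne_zero {σ : Measure (Ed 2)} {τ : Ed 2 → Ed 2}
    (h : IsPolarVM σ τ) {Φ : Ed 2 → Ed 2} (hΦ : Continuous Φ) (hs : HasCompactSupport Φ)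
    (hne : Jpair σ τ Φ ≠ 0) :
    ∃ (Ψ : Ed 2 → ℝ) (k : Fin 2), ContDiff ℝ 1 Ψ ∧ HasCompactSupport Ψ ∧
      Jpair σ τ (fun z => Ψ z • EuclideanSpace.single k (1:ℝ)) ≠ 0 := by
  have hf := h.1
  have hfield : ∀ {Ψ : Ed 2 → ℝ} (k : Fin 2), Continuous Ψ → HasCompactSupport Ψ →
      Continuous (fun z => Ψ z • EuclideanSpace.single k (1:ℝ)) ∧
      HasCompactSupport (fun z => Ψ z • EuclideanSpace.single k (1:ℝ)) := fun k hc hs =>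
    ⟨hc.smul continuous_const, hs.smul_right⟩
  have hc : ∀ k : Fin 2, Continuous (fun z => Φ z k) := fun k => by fun_prop
  have hcs : ∀ k : Fin 2, HasCompactSupport (fun z => Φ z k) := fun k =>
    hs.comp_left (g := fun v : Ed 2 => v k) rfl
  obtain ⟨k, hk⟩ : ∃ k : Fin 2,
      Jpair σ τ (fun z => Φ z k • EuclideanSpace.single k (1:ℝ)) ≠ 0 := by
    by_contra! hcon
    have h1 := h.Jpair_sum_smul Finset.univ (fun _ : Fin 2 => (1:ℝ))
      (fun k z => Φ z k • EuclideanSpace.single k (1:ℝ)) fun k => hfield k (hc k) (hcs k)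
    simp only [hcon, mul_zero, Finset.sum_const_zero, one_smul] at h1
    refine hne (h1 ▸ ?_)
    congr 1
    funext z
    ext i
    fin_cases i <;> simp
  set c := |Jpair σ τ (fun z => Φ z k • EuclideanSpace.single k (1:ℝ))| with hcdef
  have hcpos : 0 < c := abs_pos.2 hk
  set ε := c / (2 * (σ.real Set.univ + 1)) with hε
  have hεpos : 0 < ε := by positivity
  obtain ⟨Ψ, hΨ, hclose, hsub⟩ := (hc k).exists_contDiff_approx 1
    (continuous_const (y := ε)) fun _ => hεpos
  have hΨs : HasCompactSupport Ψ := (hcs k).mono hsub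
  refine ⟨Ψ, k, by exact_mod_cast hΨ, hΨs, fun h0 => ?_⟩
  have h2 := h.abs_Jpair_le (C := ε) (Φ := (fun z => Ψ z • EuclideanSpace.single k (1:ℝ))
    - fun z => Φ z k • EuclideanSpace.single k (1:ℝ)) fun x => by
      rw [Pi.sub_apply, ← sub_smul, norm_smul, PiLp.norm_single, norm_one, mul_one]
      exact (hclose x).le
  rw [h.Jpair_sub (hfield k hΨ.continuous hΨs).1 (hfield k hΨ.continuous hΨs).2
    (hfield k (hc k) (hcs k)).1 (hfield k (hc k) (hcs k)).2, h0, zero_sub, abs_neg, ← hcdef] at h2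
  have h3 : ε * σ.real Set.univ < c := by
    have h4 : ε * (2 * (σ.real Set.univ + 1)) = c := by
      rw [hε]
      field_simp
    nlinarith [measureReal_nonneg (μ := σ) (s := Set.univ)]
  linarith

theorem exists_loop_bounds {Ψ : Ed 2 → ℝ} (hΨ : ContDiff ℝ 1 Ψ) (hs : HasCompactSupport Ψ)
    (k : Fin 2) {J : ℝ} (hJ : J ≠ 0) :
    ∃ δ M R : ℝ, 0 < δ ∧ ∀ L ∈ polygonFunctionals,
      |L (fun z => Ψ z • EuclideanSpace.single k (1:ℝ)) - J| < |J| / 2 →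
      ∃ (l : ℝ≥0) (γ : ℝ → Ed 2), LipschitzWith l γ ∧ γ 0 = γ 1 ∧ δ ≤ l ∧ l ≤ M ∧ ‖γ 0‖ ≤ R ∧
        ∀ Φ : Ed 2 → Ed 2, Continuous Φ →
          L Φ = (l : ℝ)⁻¹ * ∫ t in (0:ℝ)..1, ⟪Φ (γ t), deriv γ t⟫ := by
  obtain ⟨C, hC⟩ := exists_abs_sum_segInt_le hΨ hs k
  obtain ⟨Λ, hΛ⟩ := hΨ.lipschitzWith_of_hasCompactSupport hs one_ne_zero
  obtain ⟨R, hR⟩ := hs.isCompact.isBounded.exists_norm_le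
  have hJ' : 0 < |J| := abs_pos.2 hJ
  refine ⟨|J| / (2 * (Λ + 1)), 2 * C / |J|, R + 2 * C / |J|, by positivity, fun L hL hclose => ?_⟩
  have hlow : |J| / 2 < |L (fun z => Ψ z • EuclideanSpace.single k (1:ℝ))| := by
    have := abs_sub_abs_le_abs_sub J (L fun z => Ψ z • EuclideanSpace.single k (1:ℝ))
    rw [abs_sub_comm] at this
    linarith
  rcases hL with rfl | ⟨n, v, hv, hpos, rfl⟩
  · simp only [abs_zero] at hlow
    linarith
  set Φ₀ : Ed 2 → Ed 2 := fun z => Ψ z • EuclideanSpace.single k (1:ℝ) with hΦ₀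
  have hΦ₀c : Continuous Φ₀ := hΨ.continuous.smul continuous_const
  obtain ⟨g, hg, hg0, hg1, hgΦ⟩ := exists_arclength_polygon v n
  set l : ℝ≥0 := ⟨polyLength v n, hpos.le⟩ with hl
  have hl' : (l : ℝ) = polyLength v n := rfl
  set γ : ℝ → Ed 2 := fun t => g (0 + l * t) with hγdef
  have hγ : LipschitzWith l γ := by
    refine LipschitzWith.of_dist_le_mul fun s t => (hg.dist_le_mul _ _).trans_eq ?_
    rw [NNReal.coe_one, one_mul, Real.dist_eq, Real.dist_eq, add_sub_add_left_eq_sub, ← mul_sub,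
      abs_mul, NNReal.abs_eq]
  have hcl : γ 0 = γ 1 := by
    simp only [hγdef, mul_zero, mul_one, zero_add, hl', hg0, hg1, hv.1]
  have hint : ∀ Φ : Ed 2 → Ed 2, Continuous Φ → ∫ t in (0:ℝ)..1, ⟪Φ (γ t), deriv γ t⟫ =
      ∑ i ∈ Finset.range n, segInt Φ (v i) (v (i + 1)) := fun Φ hΦ => by
    rw [hγdef, integral_inner_deriv_comp_mul, ← hgΦ Φ hΦ]
    simp [hl']
  rw [abs_mul, abs_of_pos (inv_pos.2 hpos), lt_inv_mul_iff₀ hpos] at hlow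
  have hlM : (l : ℝ) ≤ 2 * C / |J| := by
    rw [le_div_iff₀ hJ', hl']
    linarith [hC n v hv]
  refine ⟨l, γ, hγ, hcl, ?_, hlM, ?_, fun Φ hΦ => by
    simp only [hint Φ hΦ, hl']⟩
  · have h1 := hγ.abs_integral_inner_deriv_sub_le hΦ₀c zero_le_one (ε := Λ * l) fun t ht => by
      rw [hΦ₀]
      simp only
      rw [← sub_smul, norm_smul, PiLp.norm_single, norm_one, mul_one, ← dist_eq_norm]
      refine (hΛ.dist_le_mul _ _).trans ?_
      gcongr
      refine (hγ.dist_le_mul _ _).trans (mul_le_of_le_one_right l.2 ?_)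
      rw [Real.dist_eq, sub_zero, abs_of_nonneg ht.1]
      exact ht.2
    rw [← hcl, sub_self, inner_zero_right, sub_zero, hint _ hΦ₀c] at h1
    rw [div_le_iff₀ (by positivity), hl']
    rw [hl'] at h1
    have h2 : polyLength v n * (|J| / 2) < polyLength v n * (Λ * polyLength v n) := by
      linarith
    nlinarith [lt_of_mul_lt_mul_left h2 hpos.le]
  · obtain ⟨t, ht, hne⟩ : ∃ t ∈ Set.Icc (0:ℝ) 1, Ψ (γ t) ≠ 0 := by
      by_contra! hcon
      rw [← hint _ hΦ₀c, intervalIntegral.integral_congr (g := fun _ => (0:ℝ)) fun t ht => by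
        rw [Set.uIcc_of_le zero_le_one] at ht
        simp [hΦ₀, hcon t ht]] at hlow
      simp only [intervalIntegral.integral_zero, abs_zero] at hlow
      nlinarith
    have h1 := hR _ (subset_tsupport _ hne)
    have h2 : dist (γ 0) (γ t) ≤ l := by
      refine (hγ.dist_le_mul _ _).trans (mul_le_of_le_one_right l.2 ?_)
      rw [Real.dist_eq, zero_sub, abs_neg, abs_of_nonneg ht.1]
      exact ht.2
    rw [dist_eq_norm] at h2
    linarith [norm_le_norm_add_norm_sub' (γ 0) (γ t)]

/-- An extreme point of the unit ball of `J(ℝ²)` is carried by a closed Lipschitz curve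
parametrized with speed at most its mass normalization. -/
theorem IsExtremeJ.exists_lipschitz_loop {σ : Measure (Ed 2)} {τ : Ed 2 → Ed 2}
    (h : IsExtremeJ σ τ) :
    ∃ (l : ℝ≥0) (γ : ℝ → Ed 2), 0 < l ∧ LipschitzWith l γ ∧ γ 0 = γ 1 ∧
      ∀ Φ : Ed 2 → Ed 2, Continuous Φ → HasCompactSupport Φ →
        Jpair σ τ Φ = (l : ℝ)⁻¹ * ∫ t in (0:ℝ)..1, ⟪Φ (γ t), deriv γ t⟫ := by
  classical
  obtain ⟨Φ, hΦ, hΦs, hne⟩ := h.exists_Jpair_ne_zero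
  obtain ⟨Ψ, k, hΨ, hΨs, hJ⟩ := h.1.1.exists_smul_single_Jpair_ne_zero hΦ hΦs hne
  obtain ⟨δ, M, R, hδ, hbd⟩ := exists_loop_bounds hΨ hΨs k hJ
  set Φ₀ : Ed 2 → Ed 2 := fun z => Ψ z • EuclideanSpace.single k (1:ℝ) with hΦ₀
  have hΦ₀c : Continuous Φ₀ := hΨ.continuous.smul continuous_const
  have hΦ₀s : HasCompactSupport Φ₀ := hΨs.smul_right
  have key : ∀ a : Finset {Φ : Ed 2 → Ed 2 // Continuous Φ ∧ HasCompactSupport Φ} × ℕ,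
      ∃ (l : ℝ≥0) (γ : ℝ → Ed 2), LipschitzWith l γ ∧ γ 0 = γ 1 ∧ δ ≤ l ∧ l ≤ M ∧ ‖γ 0‖ ≤ R ∧
        ∀ Φ ∈ a.1, |(l : ℝ)⁻¹ * (∫ t in (0:ℝ)..1, ⟪Φ.1 (γ t), deriv γ t⟫) - Jpair σ τ Φ.1|
          < 1 / ((a.2 : ℝ) + 1) := by
    intro a
    obtain ⟨L, hL, hLF⟩ := h.exists_mem_polygonFunctionals
      (F := insert Φ₀ (a.1.image Subtype.val)) (fun Φ hΦ => by
        rcases Finset.mem_insert.1 hΦ with rfl | hΦ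
        · exact ⟨hΦ₀c, hΦ₀s⟩
        · obtain ⟨Φ', -, rfl⟩ := Finset.mem_image.1 hΦ
          exact Φ'.2)
      (ε := min (1 / ((a.2 : ℝ) + 1)) (|Jpair σ τ Φ₀| / 2))
      (lt_min (by positivity) (half_pos (abs_pos.2 hJ)))
    obtain ⟨l, γ, h1, h2, h3, h4, h5, h6⟩ := hbd L hL
      ((hLF Φ₀ (Finset.mem_insert_self _ _)).trans_le (min_le_right _ _))
    refine ⟨l, γ, h1, h2, h3, h4, h5, fun Φ hΦ => ?_⟩
    rw [← h6 _ Φ.2.1]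
    exact (hLF _ (Finset.mem_insert_of_mem (Finset.mem_image_of_mem _ hΦ))).trans_le
      (min_le_left _ _)
  choose l γ hγ hcl hδl hlM hγR happ using key
  set 𝒰 := Ultrafilter.of
    (atTop : Filter (Finset {Φ : Ed 2 → Ed 2 // Continuous Φ ∧ HasCompactSupport Φ} × ℕ)) with h𝒰
  have hle : 𝒰.toFilter ≤ atTop := Ultrafilter.of_le _
  obtain ⟨θ, hθ⟩ : ∃ θ, Tendsto (fun a => (l a : ℝ)) 𝒰 (nhds θ) := by
    refine 𝒰.exists_tendsto_of_bounded (x₀ := 0) (C := M) (Eventually.of_forall fun a => ?_)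
    rw [Real.dist_eq, sub_zero, NNReal.abs_eq]
    exact hlM a
  have hδθ : δ ≤ θ := ge_of_tendsto' hθ hδl
  have hM0 : 0 ≤ M := (l (∅, 0)).2.trans (hlM _)
  have hlim : ∀ t, ∃ x, Tendsto (fun a => γ a t) 𝒰 (nhds x) := by
    intro t
    refine 𝒰.exists_tendsto_of_bounded (x₀ := 0) (C := M * |t| + R)
      (Eventually.of_forall fun a => ?_)
    have h1 := (hγ a).dist_le_mul t 0
    rw [Real.dist_eq, sub_zero] at h1
    have h2 := mul_le_mul_of_nonneg_right (hlM a) (abs_nonneg t)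
    have h3 := dist_triangle (γ a t) (γ a 0) 0
    rw [dist_zero_right (γ a 0)] at h3
    linarith [hγR a]
  choose G hG using hlim
  have hGlip : LipschitzWith ⟨θ, hδ.le.trans hδθ⟩ G := by
    refine LipschitzWith.of_dist_le_mul fun s t => ?_
    exact le_of_tendsto_of_tendsto' ((hG s).dist (hG t)) (hθ.mul_const _)
      fun a => (hγ a).dist_le_mul s t
  have hlM' : ∀ a, l a ≤ (⟨M, hM0⟩ : ℝ≥0) := fun a => hlM a
  have hθM : θ ≤ M := le_of_tendsto' hθ hlM
  refine ⟨⟨θ, hδ.le.trans hδθ⟩, G, hδ.trans_le hδθ, hGlip, ?_, fun Φ hΦ hs => ?_⟩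
  · refine tendsto_nhds_unique (hG 0) ((hG 1).congr fun a => (hcl a).symm)
  · have h1 := tendsto_integral_inner_deriv (K := ⟨M, hM0⟩)
      (fun a => (hγ a).weaken (hlM' a)) (hGlip.weaken hθM) hG hΦ hs
    refine tendsto_nhds_unique ?_ ((hθ.inv₀ (hδ.trans_le hδθ).ne').mul h1)
    rw [tendsto_iff_dist_tendsto_zero]
    have hz : Tendsto (fun a : Finset {Φ : Ed 2 → Ed 2 // Continuous Φ ∧ HasCompactSupport Φ} × ℕ
        => 1 / ((a.2 : ℝ) + 1)) 𝒰 (nhds 0) :=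
      (tendsto_one_div_add_atTop_nhds_zero_nat.comp
        (by rw [← prod_atTop_atTop_eq]; exact tendsto_snd)).mono_left hle
    refine squeeze_zero' (Eventually.of_forall fun _ => dist_nonneg) ?_ hz
    filter_upwards [hle (eventually_ge_atTop (({⟨Φ, hΦ, hs⟩} : Finset _), 0))] with a ha
    rw [dist_comm, Real.dist_eq, abs_sub_comm]
    exact (happ a ⟨Φ, hΦ, hs⟩ (ha.1 (Finset.mem_singleton_self _))).le

section MinimalLoop

variable {σ : Measure (Ed 2)} {τ : Ed 2 → Ed 2} {γ : ℝ → Ed 2} {l : ℝ≥0}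

/-- Sub-loops of a loop carrying an extreme point carry a multiple of that extreme point. -/
theorem IsExtremeJ.integral_subloop (h : IsExtremeJ σ τ) (hl : 0 < l) (hγ : LipschitzWith l γ)
    (hcl : γ 0 = γ 1)
    (hJ : ∀ Φ : Ed 2 → Ed 2, Continuous Φ → HasCompactSupport Φ →
      Jpair σ τ Φ = (l : ℝ)⁻¹ * ∫ t in (0:ℝ)..1, ⟪Φ (γ t), deriv γ t⟫)
    {a b : ℝ} (ha : 0 ≤ a) (hab : a ≤ b) (hb : b ≤ 1) (hloop : γ a = γ b)
    {Φ : Ed 2 → Ed 2} (hΦ : Continuous Φ) (hs : HasCompactSupport Φ) :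
    ∫ t in a..b, ⟪Φ (γ t), deriv γ t⟫ = (b - a) * l * Jpair σ τ Φ := by
  have hl' : (0:ℝ) < l := hl
  have hγ' : LipschitzWith l fun t => γ ((b - a) + 1 * t) :=
    LipschitzWith.of_dist_le_mul fun s t => (hγ.dist_le_mul _ _).trans_eq (by simp)
  have hglue : γ a = γ ((b - a) + 1 * a) := by
    rw [hloop]
    congr 1
    ring
  have hle : a ≤ 1 - (b - a) := by linarith
  have hend : (b - a) + 1 * (1 - (b - a)) = 1 := by ring
  obtain ⟨σ₁, τ₁, p₁, d₁, m₁, J₁⟩ := hγ.exists_polar_divFree hab hloop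
  obtain ⟨σ₂, τ₂, p₂, d₂, m₂, J₂⟩ := (lipschitzWith_glue hγ hγ' hglue).exists_polar_divFree
    (a := 0) (b := 1 - (b - a)) (ha.trans hle) (by
      rw [if_pos ha]
      split_ifs with h1
      · have h2 : 1 - (b - a) = a := le_antisymm h1 hle
        have h3 : b = 1 := by linarith
        rw [h2, hcl, hloop, h3]
      · rw [hend, hcl])
  have hmass : ∀ {ν : Measure (Ed 2)} {x : ℝ}, ν Set.univ ≤ ENNReal.ofReal (l * x) →
      (ENNReal.ofReal (l : ℝ)⁻¹ • ν) Set.univ ≤ ENNReal.ofReal x := fun {ν x} hν => by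
    rw [Measure.smul_apply, smul_eq_mul]
    refine (mul_le_mul_right hν _).trans_eq ?_
    rw [← ENNReal.ofReal_mul (by positivity), inv_mul_cancel_left₀ hl'.ne']
  rw [sub_zero] at m₂
  have hinv : (0:ℝ) ≤ (l : ℝ)⁻¹ := by positivity
  have key := h.eq_mul_of_add_eq (sub_nonneg.2 hab) (by linarith) (p₁.ofReal_smul (l : ℝ)⁻¹)
    (p₂.ofReal_smul (l : ℝ)⁻¹) (d₁.ofReal_smul _) (d₂.ofReal_smul _) (hmass m₁) (hmass m₂)
    (fun Φ hΦ hs => by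
      have hi := fun x y => hγ.intervalIntegrable_inner_deriv hΦ x y
      rw [Jpair_ofReal_smul hinv, Jpair_ofReal_smul hinv, ← mul_add, J₁ Φ hΦ hs, J₂ Φ hΦ hs,
        hJ Φ hΦ hs, integral_inner_deriv_glue hγ hγ' hglue ha hle hΦ,
        integral_inner_deriv_comp_mul, hend, show b - a + 1 * a = b by ring,
        ← intervalIntegral.integral_add_adjacent_intervals (hi 0 a) (hi a 1),
        ← intervalIntegral.integral_add_adjacent_intervals (hi a b) (hi b 1)]
      ring) hΦ hs
  rw [Jpair_ofReal_smul hinv, J₁ Φ hΦ hs, inv_mul_eq_iff_eq_mul₀ hl'.ne'] at key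
  rw [key]
  ring

/-- A loop carrying an extreme point contains a simple loop carrying it. -/
theorem IsExtremeJ.exists_injOn_subloop (h : IsExtremeJ σ τ) (hl : 0 < l)
    (hγ : LipschitzWith l γ) (hcl : γ 0 = γ 1)
    (hJ : ∀ Φ : Ed 2 → Ed 2, Continuous Φ → HasCompactSupport Φ →
      Jpair σ τ Φ = (l : ℝ)⁻¹ * ∫ t in (0:ℝ)..1, ⟪Φ (γ t), deriv γ t⟫) :
    ∃ a b : ℝ, a < b ∧ γ a = γ b ∧ Set.InjOn γ (Set.Ico a b) ∧
      ∀ Φ : Ed 2 → Ed 2, Continuous Φ → HasCompactSupport Φ →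
        ∫ t in a..b, ⟪Φ (γ t), deriv γ t⟫ = (b - a) * l * Jpair σ τ Φ := by
  have hl' : (0:ℝ) < l := hl
  obtain ⟨Φ₀, hΦ₀, hs₀, hne⟩ := h.exists_Jpair_ne_zero
  have hpos : 0 < |Jpair σ τ Φ₀| / 2 := half_pos (abs_pos.2 hne)
  obtain ⟨δ, hδ, hmod⟩ := Metric.uniformContinuous_iff.1
    (hs₀.uniformContinuous_of_continuous hΦ₀) _ hpos
  have hlong : ∀ a b : ℝ, 0 ≤ a → a < b → b ≤ 1 → γ a = γ b → δ / l ≤ b - a := by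
    intro a b ha hab hb hloop
    by_contra! hlt
    rw [lt_div_iff₀ hl'] at hlt
    have h1 := hγ.abs_integral_inner_deriv_sub_le hΦ₀ hab.le (ε := |Jpair σ τ Φ₀| / 2)
      fun t ht => by
        rw [← dist_eq_norm]
        refine (hmod ((hγ.dist_le_mul _ _).trans_lt (lt_of_le_of_lt ?_ hlt))).le
        rw [Real.dist_eq, abs_of_nonneg (sub_nonneg.2 ht.1), mul_comm]
        gcongr
        exact ht.2
    rw [← hloop, sub_self, inner_zero_right, sub_zero,
      h.integral_subloop hl hγ hcl hJ ha hab.le hb hloop hΦ₀ hs₀, abs_mul,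
      abs_of_pos (mul_pos (sub_pos.2 hab) hl')] at h1
    have h2 : 0 < (b - a) * l := mul_pos (sub_pos.2 hab) hl'
    nlinarith
  set S : Set (ℝ × ℝ) := (Set.Icc 0 1 ×ˢ Set.Icc 0 1) ∩ {p | γ p.1 = γ p.2 ∧ δ / l ≤ p.2 - p.1}
    with hS
  have hScpt : IsCompact S := by
    refine (isCompact_Icc.prod isCompact_Icc).inter_right (IsClosed.inter ?_ ?_)
    · exact isClosed_eq (hγ.continuous.comp continuous_fst) (hγ.continuous.comp continuous_snd)
    · exact isClosed_le continuous_const (continuous_snd.sub continuous_fst)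
  have hSne : S.Nonempty := ⟨(0, 1), by
    refine ⟨⟨⟨le_rfl, zero_le_one⟩, ⟨zero_le_one, le_rfl⟩⟩, hcl, ?_⟩
    exact hlong 0 1 le_rfl zero_lt_one le_rfl hcl⟩
  obtain ⟨⟨a, b⟩, ⟨⟨⟨ha, -⟩, -, hb⟩, hloop, hlen⟩, hmin⟩ := hScpt.exists_isMinOn hSne
    (continuous_snd.sub continuous_fst).continuousOn
  simp only at ha hb hloop hlen
  have hab : a < b := by
    have : 0 < δ / l := by positivity
    linarith
  have hinj : ∀ s t, a ≤ s → s < t → t < b → γ s ≠ γ t := by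
    intro s t hs hst ht heq
    have hlen' := hlong s t (ha.trans hs) hst (ht.le.trans hb) heq
    have h1 : b - a ≤ t - s := hmin (show (s, t) ∈ S from
      ⟨⟨⟨ha.trans hs, (hst.trans ht).le.trans hb⟩, (ha.trans hs).trans hst.le, ht.le.trans hb⟩,
        heq, hlen'⟩)
    linarith
  refine ⟨a, b, hab, hloop, fun s hs t ht heq => ?_, fun Φ hΦ hs =>
    h.integral_subloop hl hγ hcl hJ ha hab.le hb hloop hΦ hs⟩
  rcases lt_trichotomy s t with hlt | rfl | hlt
  · exact absurd heq (hinj s t hs.1 hlt ht.2)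
  · rfl
  · exact absurd heq.symm (hinj t s ht.1 hlt hs.2)

/-- An extreme point of the unit ball of `J(ℝ²)` is a normalized simple loop. -/
theorem IsExtremeJ.exists_simple_loop (h : IsExtremeJ σ τ) :
    ∃ γ : ℝ → Ed 2, IsLip γ ∧ Set.InjOn γ (Set.Ico (0:ℝ) 1) ∧ γ 0 = γ 1 ∧
      ∀ Φ : Ed 2 → Ed 2, Continuous Φ → HasCompactSupport Φ →
        Jpair σ τ Φ = (∫ t in (0:ℝ)..1, ‖deriv γ t‖)⁻¹ *
          ∫ t in (0:ℝ)..1, ⟪Φ (γ t), deriv γ t⟫ := by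
  obtain ⟨l, g, hl, hg, hcl, hJ⟩ := h.exists_lipschitz_loop
  obtain ⟨a, b, hab, hloop, hinj, hint⟩ := h.exists_injOn_subloop hl hg hcl hJ
  have hl' : (0:ℝ) < l := hl
  have hd : 0 < b - a := sub_pos.2 hab
  have hlip : LipschitzWith ((b - a).toNNReal * l) fun t => g (a + (b - a) * t) := by
    refine LipschitzWith.of_dist_le_mul fun s t => (hg.dist_le_mul _ _).trans_eq ?_
    rw [Real.dist_eq, Real.dist_eq, add_sub_add_left_eq_sub, ← mul_sub, abs_mul, abs_of_pos hd,
      NNReal.coe_mul, Real.coe_toNNReal _ hd.le]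
    ring
  set γ : ℝ → Ed 2 := fun t => g (a + (b - a) * t) with hγ
  have hγΦ : ∀ Φ : Ed 2 → Ed 2, Continuous Φ → HasCompactSupport Φ →
      ∫ t in (0:ℝ)..1, ⟪Φ (γ t), deriv γ t⟫ = (b - a) * l * Jpair σ τ Φ := fun Φ hΦ hs => by
    rw [hγ, integral_inner_deriv_comp_mul, ← hint Φ hΦ hs]
    congr 1 <;> ring
  have hpos : 0 < (b - a) * l := mul_pos hd hl'
  have hlen : ∫ t in (0:ℝ)..1, ‖deriv γ t‖ = (b - a) * l := by
    refine le_antisymm ?_ ?_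
    · refine (intervalIntegral.integral_mono_on zero_le_one (intervalIntegrable_norm_deriv hlip 0 1)
        intervalIntegrable_const fun t _ => hlip.norm_deriv_le t).trans_eq ?_
      simp [hd.le]
    · have h1 : σ.real Set.univ ≤ ((b - a) * l)⁻¹ * ∫ t in (0:ℝ)..1, ‖deriv γ t‖ := by
        refine h.1.1.real_univ_le fun Φ hΦ hs hb => ?_
        rw [le_inv_mul_iff₀ hpos, ← hγΦ Φ hΦ hs]
        exact (le_abs_self _).trans (abs_integral_inner_deriv_le hlip zero_le_one hb)
      rwa [h.real_univ, le_inv_mul_iff₀ hpos, mul_one] at h1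
  refine ⟨γ, ⟨_, hlip⟩, fun s hs t ht heq => ?_, ?_, fun Φ hΦ hs => ?_⟩
  · have hmem : ∀ r ∈ Set.Ico (0:ℝ) 1, a + (b - a) * r ∈ Set.Ico a b := fun r hr =>
      ⟨by nlinarith [hr.1], by nlinarith [hr.2]⟩
    exact mul_left_cancel₀ hd.ne' (add_left_cancel (hinj (hmem s hs) (hmem t ht) heq))
  · simp only [hγ, mul_zero, add_zero, mul_one, add_sub_cancel]
    exact hloop
  · rw [hlen, hγΦ Φ hΦ hs, inv_mul_cancel_left₀ hpos.ne']

end MinimalLoop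

/-- **Extreme points of the unit ball of `J(ℝ²)`** are exactly the normalized measures
`μ_γ/ℓ(γ)` induced by closed simple Lipschitz curves `γ ∈ Γ`. -/
theorem extreme_points_of_J_ball (σ : Measure (Ed 2)) (τ : Ed 2 → Ed 2)
    (h : IsPolarVM σ τ) :
    IsExtremeJ σ τ ↔
      ∃ γ : ℝ → Ed 2, IsLip γ ∧ Set.InjOn γ (Set.Ico (0:ℝ) 1) ∧ γ 0 = γ 1 ∧
        ∀ Φ : Ed 2 → Ed 2, Continuous Φ → HasCompactSupport Φ →
          Jpair σ τ Φ =
            (∫ t in (0:ℝ)..1, ‖deriv γ t‖)⁻¹ * ∫ t in (0:ℝ)..1, ⟪Φ (γ t), deriv γ t⟫ := by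
  refine ⟨fun hext => hext.exists_simple_loop, ?_⟩
  rintro ⟨γ, ⟨K, hγ⟩, hinj, hcl, hrep⟩
  exact simple_loop_isExtremeJ hγ hinj hcl h hrep
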